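/- arXiv:2202.01243 — 2 statements merged into one kernel-verified Lean document; each statement's English description precedes it below -/
import Mathlib

section
/- Consider sequences n, p = p(n), D = D(n) with n + 1 < p ≤ D and p/n → γ ∈ (1, ∞) as n → ∞. In the Gaussian linear regression setting with ridge regularization parameter λ > 0, let x₀ ∈ ℝ^D be a sequence of deterministic test vectors such that ‖x₀,ₚ‖²/p converges to a positive limit, and suppose x₀ is not a training point (m = 0), so that ŷ₀ = x₀,ₚᵀ (XₚᵀXₚ + nλI)⁻¹ Xₚᵀ y with all n rows of X drawn i.i.d. N(0, I_D). Define σ₀,λ² := [g′(−λ)·γ/(1 + g(−λ)·γ)²]·(σ² + 1 − p/D)·(‖x₀,ₚ‖²/p) + (1 − 2λ·g(−λ) + λ²·g′(−λ))·(‖x₀,ₚ‖²/D). Then the law of ŷ₀/σ₀,λ converges weakly to the standard normal N(0,1); that is, ŷ₀ conditioned on m = 0 and x₀ is asymptotically Gaussian with mean 0 and variance σ₀,λ². -/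
open MeasureTheory ProbabilityTheory Matrix Filter Topology
open scoped NNReal ENNReal

open Classical in
/-- The Moore–Penrose pseudoinverse of a real matrix, characterized by the four
Penrose equations (which determine it uniquely when a solution exists, as it
always does over `ℝ`). -/
noncomputable def pinv {m n : ℕ} (A : Matrix (Fin m) (Fin n) ℝ) : Matrix (Fin n) (Fin m) ℝ :=
  if h : ∃ B : Matrix (Fin n) (Fin m) ℝ,
      A * B * A = A ∧ B * A * B = B ∧ (A * B)ᵀ = A * B ∧ (B * A)ᵀ = B * A
  then h.choose else 0

/-- The law of a vector of `k` i.i.d. standard Gaussian entries. -/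
noncomputable def stdGaussianVec (k : ℕ) : Measure (Fin k → ℝ) :=
  Measure.pi fun _ => gaussianReal 0 1

/-- The law of an `n × D` random matrix with i.i.d. standard Gaussian entries. -/
noncomputable def stdGaussianMatrix (n D : ℕ) : Measure (Fin n → Fin D → ℝ) :=
  Measure.pi fun _ => stdGaussianVec D
/-- The random coefficient vector `β ∼ N(0, (1/D)·I_D)`, modeled as `β = b/√D`
for a standard Gaussian vector `b`. -/
noncomputable def coeffs (D : ℕ) (b : Fin D → ℝ) : Fin D → ℝ := fun j => b j / Real.sqrt D

/-- The `n × p` submatrix of the first `p` columns of an `n × D` matrix. -/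
def firstCols (n p D : ℕ) (hpD : p ≤ D) (Xe : Fin n → Fin D → ℝ) :
    Matrix (Fin n) (Fin p) ℝ :=
  Matrix.of fun i j => Xe i (Fin.castLE hpD j)

/-- The Stieltjes transform of the Marchenko–Pastur law with aspect ratio `γ`,
evaluated at `−λ`:
`g(−λ) = (−(1 − γ + λ) + sqrt((1 − γ + λ)² + 4γλ)) / (2γλ)`. -/
noncomputable def mpStieltjes (γ lam : ℝ) : ℝ :=
  (-(1 - γ + lam) + Real.sqrt ((1 - γ + lam) ^ 2 + 4 * γ * lam)) / (2 * γ * lam)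

/-- The ridge-regularized prediction `ŷ₀ = x₀,ₚᵀ(XₚᵀXₚ + nλI)⁻¹Xₚᵀy` at a test
point `x₀`, as a function of the sample `ω = (X entries, b, e)` where the
coefficients are `β = b/√D`, the noise is `ε = σe`, and `yᵢ = xᵢᵀβ + εᵢ`. -/
noncomputable def ridgePrediction (σ lam : ℝ) (n p D : ℕ) (hpD : p ≤ D) (x₀ : Fin D → ℝ)
    (ω : (Fin n → Fin D → ℝ) × (Fin D → ℝ) × (Fin n → ℝ)) : ℝ :=
  ∑ j : Fin p, x₀ (Fin.castLE hpD j) *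
    (((firstCols n p D hpD ω.1)ᵀ * firstCols n p D hpD ω.1 + ((n : ℝ) * lam) • 1)⁻¹ *ᵥ
      ((firstCols n p D hpD ω.1)ᵀ *ᵥ
        (fun i => (∑ jd, ω.1 i jd * coeffs D ω.2.1 jd) + σ * ω.2.2 i))) j



/-! ### Gaussian laws -/

instance stdGaussianVec_prob (k : ℕ) : IsProbabilityMeasure (stdGaussianVec k) := by
  unfold stdGaussianVec; infer_instance

instance stdGaussianMatrix_prob (n D : ℕ) : IsProbabilityMeasure (stdGaussianMatrix n D) := by
  unfold stdGaussianMatrix; infer_instance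

/-- `Y` is centred Gaussian of variance `A` under `μ`. -/
def GLaw {Ω : Type*} [MeasurableSpace Ω] (μ : Measure Ω) (Y : Ω → ℝ) (A : ℝ) : Prop :=
  Measurable Y ∧ 0 ≤ A ∧ μ.map Y = gaussianReal 0 A.toNNReal

theorem GLaw.congr_var {Ω : Type*} [MeasurableSpace Ω] {μ : Measure Ω} {Y : Ω → ℝ} {A B : ℝ}
    (h : GLaw μ Y A) (hAB : A = B) : GLaw μ Y B := hAB ▸ h

theorem GLaw.pi_sum {ι : Type*} [Fintype ι] {E : ι → Type*} [∀ i, MeasurableSpace (E i)]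
    (μ : ∀ i, Measure (E i)) [∀ i, IsProbabilityMeasure (μ i)] (f : ∀ i, E i → ℝ) (A : ι → ℝ)
    (h : ∀ i, GLaw (μ i) (f i) (A i)) :
    GLaw (Measure.pi μ) (fun x => ∑ i, f i (x i)) (∑ i, A i) := by
  have hm : ∀ i, Measurable (f i) := fun i => (h i).1
  have hp : ∀ i, IsProbabilityMeasure ((μ i).map (f i)) := fun i =>
    Measure.isProbabilityMeasure_map (hm i).aemeasurable
  refine ⟨by fun_prop, Finset.sum_nonneg fun i _ => (h i).2.1, ?_⟩
  have e1 : (Measure.pi μ).map (fun x => ∑ i, f i (x i)) =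
      (Measure.pi fun i => (μ i).map (f i)).map (fun p => ∑ i, p i) := by
    rw [← Measure.pi_map_pi (fun i => (hm i).aemeasurable), Measure.map_map (by fun_prop) (by fun_prop)]
    rfl
  rw [e1]
  apply Measure.ext_of_charFun
  rw [charFun_map_sum_pi_eq_prod]
  ext t
  simp only [Finset.prod_apply, (h _).2.2, charFun_gaussianReal]
  rw [← Complex.exp_sum]
  congr 1
  have : ((∑ i, A i).toNNReal : ℂ) = ∑ i, ((A i).toNNReal : ℂ) := by
    have h2 : (((∑ i, A i).toNNReal : ℝ)) = ∑ i, (((A i).toNNReal : ℝ)) := by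
      rw [Real.coe_toNNReal _ (Finset.sum_nonneg fun i _ => (h i).2.1)]
      exact Finset.sum_congr rfl fun i _ => (Real.coe_toNNReal _ (h i).2.1).symm
    exact_mod_cast h2
  rw [this]
  simp [Finset.sum_mul, Finset.sum_div, Finset.sum_neg_distrib]

theorem GLaw.const_mul_std (a : ℝ) : GLaw (gaussianReal 0 1) (fun x => a * x) (a * a) := by
  refine ⟨by fun_prop, mul_self_nonneg a, ?_⟩
  rw [gaussianReal_map_const_mul]
  congr 1
  · simp
  · ext; simp [mul_self_nonneg, sq]

theorem gl_vec {k : ℕ} (a : Fin k → ℝ) : GLaw (stdGaussianVec k) (fun z => a ⬝ᵥ z) (a ⬝ᵥ a) :=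
  GLaw.pi_sum (fun _ => gaussianReal 0 1) (fun i x => a i * x) (fun i => a i * a i)
    (fun i => GLaw.const_mul_std (a i))

theorem gl_mat {n k : ℕ} (a : Fin n → Fin k → ℝ) :
    GLaw (stdGaussianMatrix n k) (fun W => ∑ i, a i ⬝ᵥ W i) (∑ i, a i ⬝ᵥ a i) :=
  GLaw.pi_sum (fun _ => stdGaussianVec k) (fun i x => a i ⬝ᵥ x) (fun i => a i ⬝ᵥ a i)
    (fun i => gl_vec (a i))

theorem GLaw.add_prod {Ω Ω' : Type*} [MeasurableSpace Ω] [MeasurableSpace Ω'] {μ : Measure Ω}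
    {ν : Measure Ω'} [IsProbabilityMeasure μ] [IsProbabilityMeasure ν] {Y : Ω → ℝ} {Y' : Ω' → ℝ}
    {A A' : ℝ} (h : GLaw μ Y A) (h' : GLaw ν Y' A') :
    GLaw (μ.prod ν) (fun p => Y p.1 + Y' p.2) (A + A') := by
  have hY := h.1
  have hY' := h'.1
  refine ⟨by fun_prop, add_nonneg h.2.1 h'.2.1, ?_⟩
  have e1 : (μ.prod ν).map (fun p => Y p.1 + Y' p.2) =
      ((μ.map Y).prod (ν.map Y')).map (fun p => p.1 + p.2) := by
    rw [Measure.map_prod_map _ _ hY hY', Measure.map_map (by fun_prop) (by fun_prop)]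
    rfl
  rw [e1, h.2.2, h'.2.2]
  apply Measure.ext_of_charFun
  rw [charFun_map_add_prod_eq_mul]
  ext t
  simp only [Pi.mul_apply, charFun_gaussianReal]
  rw [← Complex.exp_add, Real.toNNReal_add h.2.1 h'.2.1]
  congr 1
  push_cast
  ring

theorem gauss_moment_four : ∫ x, x ^ 4 ∂(gaussianReal 0 1) = 3 := by
  have h := iteratedDeriv_mgf_zero (X := id) (μ := gaussianReal 0 1) (by
    rw [integrableExpSet_id_gaussianReal]; simp) 4
  simp only [Pi.pow_apply, id] at h
  have hf : mgf id (gaussianReal 0 1) = fun t => Real.exp (t ^ 2 / 2) := by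
    rw [mgf_id_gaussianReal]; simp
  have e0 : ∀ t : ℝ, HasDerivAt (fun t : ℝ => Real.exp (t ^ 2 / 2)) (t * Real.exp (t ^ 2 / 2)) t := by
    intro t
    have := (((hasDerivAt_id t).pow 2).div_const 2).exp
    simp only [Pi.pow_apply, id] at this
    convert this using 1
    simp; ring
  have d1 : deriv (fun t : ℝ => Real.exp (t ^ 2 / 2)) = fun t => t * Real.exp (t ^ 2 / 2) :=
    funext fun t => (e0 t).deriv
  have d2 : deriv (fun t : ℝ => t * Real.exp (t ^ 2 / 2)) =
      fun t => (1 + t ^ 2) * Real.exp (t ^ 2 / 2) := funext fun t => by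
    have := ((hasDerivAt_id t).mul (e0 t)).deriv
    simp only [id] at this
    refine Eq.trans this ?_
    ring
  have d3 : deriv (fun t : ℝ => (1 + t ^ 2) * Real.exp (t ^ 2 / 2)) =
      fun t => (3 * t + t ^ 3) * Real.exp (t ^ 2 / 2) := funext fun t => by
    have := ((((hasDerivAt_id t).pow 2).const_add 1).mul (e0 t)).deriv
    simp only [id, Pi.pow_apply] at this
    refine Eq.trans this ?_
    simp; ring
  have d4 : deriv (fun t : ℝ => (3 * t + t ^ 3) * Real.exp (t ^ 2 / 2)) =
      fun t => (3 + 6 * t ^ 2 + t ^ 4) * Real.exp (t ^ 2 / 2) := funext fun t => by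
    have := ((((hasDerivAt_id t).const_mul 3).add ((hasDerivAt_id t).pow 3)).mul (e0 t)).deriv
    simp only [id, Pi.pow_apply, Pi.add_apply] at this
    refine Eq.trans this ?_
    simp; ring
  rw [hf] at h
  simp only [iteratedDeriv_succ, iteratedDeriv_zero, d1, d2, d3, d4] at h
  rw [← h]; simp

section moments
variable {Ω : Type*} [MeasurableSpace Ω] {μ : Measure Ω} {Y : Ω → ℝ} {A : ℝ}

theorem GLaw.map_eq (h : GLaw μ Y A) : μ.map Y = (gaussianReal 0 1).map (fun x => √A * x) := by
  have h2 := GLaw.const_mul_std (√A)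
  rw [Real.mul_self_sqrt h.2.1] at h2
  rw [h.2.2, h2.2.2]

theorem GLaw.integral_comp (h : GLaw μ Y A) {f : ℝ → ℝ} (hf : Measurable f) :
    ∫ ω, f (Y ω) ∂μ = ∫ x, f (√A * x) ∂(gaussianReal 0 1) := by
  rw [← integral_map (φ := Y) h.1.aemeasurable hf.aestronglyMeasurable, h.map_eq,
    integral_map (by fun_prop) hf.aestronglyMeasurable]

theorem GLaw.memLp (h : GLaw μ Y A) (k : ℕ) : MemLp Y k μ := by
  have := memLp_id_gaussianReal (μ := 0) (v := A.toNNReal) k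
  rw [← h.2.2] at this
  exact this.comp_of_map h.1.aemeasurable

theorem GLaw.integrable_pow (h : GLaw μ Y A) (k : ℕ) : Integrable (fun ω => Y ω ^ k) μ := by
  rcases Nat.eq_zero_or_pos k with rfl | hk
  · have : IsFiniteMeasure μ := by
      have : IsProbabilityMeasure (μ.map Y) := by rw [h.2.2]; infer_instance
      have := Measure.isProbabilityMeasure_of_map (μ := μ) Y
      infer_instance
    simp
  have := (h.memLp k).integrable_norm_pow (by omega)
  refine this.mono' (by have := h.1; fun_prop) (ae_of_all _ fun x => ?_)
  simp

theorem GLaw.sq (h : GLaw μ Y A) : ∫ ω, Y ω ^ 2 ∂μ = A := by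
  rw [h.integral_comp (f := fun x => x ^ 2) (by fun_prop)]
  simp_rw [mul_pow, integral_const_mul, Real.sq_sqrt h.2.1]
  have : ∫ x, x ^ 2 ∂(gaussianReal 0 1) = 1 := by
    have h3 := variance_fun_id_gaussianReal (μ := 0) (v := 1)
    rw [variance_eq_integral (by fun_prop)] at h3
    simpa using h3
  rw [this, mul_one]

theorem GLaw.four (h : GLaw μ Y A) : ∫ ω, Y ω ^ 4 ∂μ = 3 * A ^ 2 := by
  rw [h.integral_comp (f := fun x => x ^ 4) (by fun_prop)]
  simp_rw [mul_pow, integral_const_mul, gauss_moment_four]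
  have : √A ^ 4 = A ^ 2 := by
    rw [show √A ^ 4 = (√A ^ 2) ^ 2 by ring, Real.sq_sqrt h.2.1]
  rw [this]; ring

/-- Jointly Gaussian pair. -/
def GPair {Ω : Type*} [MeasurableSpace Ω] (μ : Measure Ω) (Y Y' : Ω → ℝ) (A C B : ℝ) : Prop :=
  ∀ a b : ℝ, GLaw μ (fun ω => a * Y ω + b * Y' ω) (a * a * A + 2 * (a * b) * C + b * b * B)

variable {Y' : Ω → ℝ} {C B : ℝ}

theorem GPair.left (h : GPair μ Y Y' A C B) : GLaw μ Y A := by simpa using h 1 0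
theorem GPair.right (h : GPair μ Y Y' A C B) : GLaw μ Y' B := by simpa using h 0 1

theorem GPair.mul_eq (h : GPair μ Y Y' A C B) :
    Integrable (fun ω => Y ω * Y' ω) μ ∧ ∫ ω, Y ω * Y' ω ∂μ = C := by
  have h1 := h 1 1
  have h2 := h 1 (-1)
  have i1 := h1.integrable_pow 2
  have i2 := h2.integrable_pow 2
  have e : (fun ω => Y ω * Y' ω) = fun ω => (1/4) * ((1 * Y ω + 1 * Y' ω) ^ 2 -
      (1 * Y ω + (-1) * Y' ω) ^ 2) := by ext; ring
  rw [e]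
  refine ⟨(i1.sub i2).const_mul _, ?_⟩
  rw [integral_const_mul, integral_sub i1 i2, h1.sq, h2.sq]; ring

theorem GPair.sq_mul_sq (h : GPair μ Y Y' A C B) :
    Integrable (fun ω => Y ω ^ 2 * Y' ω ^ 2) μ ∧
      ∫ ω, Y ω ^ 2 * Y' ω ^ 2 ∂μ = A * B + 2 * C ^ 2 := by
  have h1 := h 1 1
  have h2 := h 1 (-1)
  have i1 := h1.integrable_pow 4
  have i2 := h2.integrable_pow 4
  have i3 := h.left.integrable_pow 4
  have i4 := h.right.integrable_pow 4
  have e : (fun ω => Y ω ^ 2 * Y' ω ^ 2) = fun ω => (1/12) * (((1 * Y ω + 1 * Y' ω) ^ 4 +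
      (1 * Y ω + (-1) * Y' ω) ^ 4) - (2 * Y ω ^ 4 + 2 * Y' ω ^ 4)) := by ext; ring
  rw [e]
  have j1 : Integrable (fun ω => (1 * Y ω + 1 * Y' ω) ^ 4 + (1 * Y ω + (-1) * Y' ω) ^ 4) μ :=
    i1.add i2
  have j2 : Integrable (fun ω => 2 * Y ω ^ 4 + 2 * Y' ω ^ 4) μ :=
    (i3.const_mul 2).add (i4.const_mul 2)
  refine ⟨(j1.sub j2).const_mul _, ?_⟩
  rw [integral_const_mul, integral_sub j1 j2,
    integral_add i1 i2, integral_add (i3.const_mul 2) (i4.const_mul 2), integral_const_mul,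
    integral_const_mul, h1.four, h2.four, h.left.four, h.right.four]
  ring

theorem quad_var {ι : Type*} [Fintype ι] [IsProbabilityMeasure μ] (Y : ι → Ω → ℝ)
    (C : ι → ι → ℝ) (h : ∀ k l, GPair μ (Y k) (Y l) (C k k) (C k l) (C l l)) :
    Integrable (fun ω => (∑ k, Y k ω ^ 2 - ∑ k, C k k) ^ 2) μ ∧
      ∫ ω, (∑ k, Y k ω ^ 2 - ∑ k, C k k) ^ 2 ∂μ = 2 * ∑ k, ∑ l, C k l ^ 2 := by
  have e : (fun ω => (∑ k, Y k ω ^ 2 - ∑ k, C k k) ^ 2) = fun ω =>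
      ∑ k, ∑ l, (Y k ω ^ 2 * Y l ω ^ 2 - C l l * Y k ω ^ 2 - C k k * Y l ω ^ 2 + C k k * C l l) := by
    ext ω
    rw [sq, ← Finset.sum_sub_distrib, Finset.sum_mul_sum]
    refine Finset.sum_congr rfl fun k _ => Finset.sum_congr rfl fun l _ => ?_
    ring
  have i1 : ∀ k l, Integrable (fun ω => Y k ω ^ 2 * Y l ω ^ 2) μ := fun k l => (h k l).sq_mul_sq.1
  have i2 : ∀ k, Integrable (fun ω => Y k ω ^ 2) μ := fun k => (h k k).left.integrable_pow 2
  have i3 : ∀ k l, Integrable (fun ω => Y k ω ^ 2 * Y l ω ^ 2 - C l l * Y k ω ^ 2) μ :=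
    fun k l => (i1 k l).sub ((i2 k).const_mul _)
  have i4 : ∀ k l, Integrable
      (fun ω => Y k ω ^ 2 * Y l ω ^ 2 - C l l * Y k ω ^ 2 - C k k * Y l ω ^ 2) μ :=
    fun k l => (i3 k l).sub ((i2 l).const_mul _)
  have i5 : ∀ k l, Integrable (fun ω =>
      (Y k ω ^ 2 * Y l ω ^ 2 - C l l * Y k ω ^ 2 - C k k * Y l ω ^ 2 + C k k * C l l)) μ :=
    fun k l => (i4 k l).add (integrable_const _)
  rw [e]
  refine ⟨integrable_finsetSum _ fun k _ => integrable_finsetSum _ fun l _ => i5 k l, ?_⟩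
  rw [integral_finsetSum _ fun k _ => integrable_finsetSum _ fun l _ => i5 k l, Finset.mul_sum]
  refine Finset.sum_congr rfl fun k _ => ?_
  rw [integral_finsetSum _ fun l _ => i5 k l, Finset.mul_sum]
  refine Finset.sum_congr rfl fun l _ => ?_
  rw [integral_add (i4 k l) (integrable_const _), integral_sub (i3 k l) ((i2 l).const_mul _),
    integral_sub (i1 k l) ((i2 k).const_mul _), integral_const_mul, integral_const_mul,
    (h k l).sq_mul_sq.2, (h k l).left.sq, (h k l).right.sq]
  simp
  ring
end moments

theorem gp_vec {k : ℕ} (v w : Fin k → ℝ) :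
    GPair (stdGaussianVec k) (fun z => v ⬝ᵥ z) (fun z => w ⬝ᵥ z) (v ⬝ᵥ v) (v ⬝ᵥ w) (w ⬝ᵥ w) := by
  intro a b
  have := gl_vec (a • v + b • w)
  simp only [add_dotProduct, dotProduct_add, smul_dotProduct, dotProduct_smul, smul_eq_mul] at this
  refine this.congr_var ?_
  rw [dotProduct_comm w v]; ring

theorem gp_mat {n k : ℕ} (v w : Fin n → Fin k → ℝ) :
    GPair (stdGaussianMatrix n k) (fun W => ∑ i, v i ⬝ᵥ W i) (fun W => ∑ i, w i ⬝ᵥ W i)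
      (∑ i, v i ⬝ᵥ v i) (∑ i, v i ⬝ᵥ w i) (∑ i, w i ⬝ᵥ w i) := by
  intro a b
  have := gl_mat (a • v + b • w)
  simp only [Pi.add_apply, Pi.smul_apply, add_dotProduct, dotProduct_add, smul_dotProduct,
    dotProduct_smul, smul_eq_mul, Finset.sum_add_distrib, ← Finset.mul_sum] at this
  refine this.congr_var ?_
  have e : ∑ i, w i ⬝ᵥ v i = ∑ i, v i ⬝ᵥ w i :=
    Finset.sum_congr rfl fun i _ => dotProduct_comm _ _
  rw [e]; ring


/-! ### Resolvent algebra -/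

/-- `R` is the inverse of the symmetric matrix `M ≥ c`. -/
structure Res {p : ℕ} (c : ℝ) (M R : Matrix (Fin p) (Fin p) ℝ) : Prop where
  pos : 0 < c
  sym : Mᵀ = M
  mul : M * R = 1
  lb : ∀ x : Fin p → ℝ, c * (x ⬝ᵥ x) ≤ x ⬝ᵥ M *ᵥ x

namespace Res
variable {p : ℕ} {c : ℝ} {M R : Matrix (Fin p) (Fin p) ℝ}

theorem mul' (h : Res c M R) : R * M = 1 := mul_eq_one_comm.mp h.mul

theorem symR (h : Res c M R) : Rᵀ = R := by
  have h1 : Rᵀ * M = 1 := by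
    have := congrArg transpose h.mul
    rwa [transpose_mul, h.sym, transpose_one] at this
  calc Rᵀ = Rᵀ * (M * R) := by rw [h.mul, mul_one]
    _ = R := by rw [← Matrix.mul_assoc, h1, one_mul]

theorem MR (h : Res c M R) (x : Fin p → ℝ) : M *ᵥ (R *ᵥ x) = x := by
  rw [mulVec_mulVec, h.mul, one_mulVec]

theorem RM (h : Res c M R) (x : Fin p → ℝ) : R *ᵥ (M *ᵥ x) = x := by
  rw [mulVec_mulVec, h.mul', one_mulVec]

theorem dot_comm (h : Res c M R) (x y : Fin p → ℝ) : x ⬝ᵥ R *ᵥ y = (R *ᵥ x) ⬝ᵥ y := by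
  rw [dotProduct_mulVec, ← mulVec_transpose, h.symR]

theorem dot_swap (h : Res c M R) (x y : Fin p → ℝ) : x ⬝ᵥ R *ᵥ y = y ⬝ᵥ R *ᵥ x := by
  rw [h.dot_comm, dotProduct_comm]

theorem normR_le (h : Res c M R) (x : Fin p → ℝ) :
    c * ((R *ᵥ x) ⬝ᵥ (R *ᵥ x)) ≤ x ⬝ᵥ R *ᵥ x := by
  have := h.lb (R *ᵥ x)
  rwa [h.MR, dotProduct_comm _ x] at this

theorem dot_self_nonneg (x : Fin p → ℝ) : 0 ≤ x ⬝ᵥ x :=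
  Finset.sum_nonneg fun _ _ => mul_self_nonneg _

theorem q_nonneg (h : Res c M R) (x : Fin p → ℝ) : 0 ≤ x ⬝ᵥ R *ᵥ x :=
  le_trans (mul_nonneg h.pos.le (dot_self_nonneg _)) (h.normR_le x)

theorem cs (x y : Fin p → ℝ) : (x ⬝ᵥ y) ^ 2 ≤ (x ⬝ᵥ x) * (y ⬝ᵥ y) := by
  have := Finset.sum_mul_sq_le_sq_mul_sq Finset.univ x y
  simpa [dotProduct, sq] using this

theorem q_le (h : Res c M R) (x : Fin p → ℝ) : x ⬝ᵥ R *ᵥ x ≤ (x ⬝ᵥ x) / c := by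
  have h1 := h.normR_le x
  have h2 := cs x (R *ᵥ x)
  have h3 := h.q_nonneg x
  have h4 := dot_self_nonneg x
  have hc := h.pos
  rw [le_div_iff₀ hc]
  set q := x ⬝ᵥ R *ᵥ x
  rcases h3.eq_or_lt with h0 | h0
  · rw [← h0]; simpa using h4
  have : c * q * q ≤ (x ⬝ᵥ x) * q := by nlinarith
  nlinarith [le_of_mul_le_mul_right this h0]

theorem normR_le' (h : Res c M R) (x : Fin p → ℝ) :
    (R *ᵥ x) ⬝ᵥ (R *ᵥ x) ≤ (x ⬝ᵥ x) / c ^ 2 := by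
  have h1 := (h.normR_le x).trans (h.q_le x)
  have hc := h.pos
  rw [le_div_iff₀ hc] at h1
  rw [le_div_iff₀ (by positivity)]
  nlinarith

theorem trace_eq (A : Matrix (Fin p) (Fin p) ℝ) :
    A.trace = ∑ j, (Pi.single j 1 : Fin p → ℝ) ⬝ᵥ A *ᵥ (Pi.single j 1) := by
  simp [trace]

theorem trace_nonneg (h : Res c M R) : 0 ≤ R.trace := by
  rw [trace_eq]; exact Finset.sum_nonneg fun j _ => h.q_nonneg _

/-- Sherman–Morrison. -/
theorem sm {R' : Matrix (Fin p) (Fin p) ℝ} (h : Res c M R) (z : Fin p → ℝ)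
    (h' : Res c (M + vecMulVec z z) R') (x : Fin p → ℝ) :
    R' *ᵥ x = R *ᵥ x - ((z ⬝ᵥ R *ᵥ x) / (1 + z ⬝ᵥ R *ᵥ z)) • R *ᵥ z := by
  have hd : 1 + z ⬝ᵥ R *ᵥ z ≠ 0 := by have := h.q_nonneg z; positivity
  have key : (M + vecMulVec z z) *ᵥ (R *ᵥ x - ((z ⬝ᵥ R *ᵥ x) / (1 + z ⬝ᵥ R *ᵥ z)) • R *ᵥ z) = x := by
    rw [mulVec_sub, mulVec_smul, add_mulVec, add_mulVec, h.MR, h.MR, vecMulVec_mulVec,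
      vecMulVec_mulVec]
    ext i
    simp
    field_simp
    ring
  rw [← h'.RM (R *ᵥ x - ((z ⬝ᵥ R *ᵥ x) / (1 + z ⬝ᵥ R *ᵥ z)) • R *ᵥ z), key]

theorem sm_q {R' : Matrix (Fin p) (Fin p) ℝ} (h : Res c M R) (z : Fin p → ℝ)
    (h' : Res c (M + vecMulVec z z) R') (u : Fin p → ℝ) :
    u ⬝ᵥ R' *ᵥ u = u ⬝ᵥ R *ᵥ u - (u ⬝ᵥ R *ᵥ z) ^ 2 / (1 + z ⬝ᵥ R *ᵥ z) := by
  rw [h.sm z h', dotProduct_sub, dotProduct_smul, smul_eq_mul, h.dot_swap z u]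
  ring

theorem sm_z {R' : Matrix (Fin p) (Fin p) ℝ} (h : Res c M R) (z : Fin p → ℝ)
    (h' : Res c (M + vecMulVec z z) R') (u : Fin p → ℝ) :
    u ⬝ᵥ R' *ᵥ z = (u ⬝ᵥ R *ᵥ z) / (1 + z ⬝ᵥ R *ᵥ z) := by
  have hd : 1 + z ⬝ᵥ R *ᵥ z ≠ 0 := by have := h.q_nonneg z; positivity
  rw [h.sm z h', dotProduct_sub, dotProduct_smul, smul_eq_mul]
  field_simp
  ring

theorem sm_tr {R' : Matrix (Fin p) (Fin p) ℝ} (h : Res c M R) (z : Fin p → ℝ)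
    (h' : Res c (M + vecMulVec z z) R') :
    R'.trace = R.trace - ((R *ᵥ z) ⬝ᵥ (R *ᵥ z)) / (1 + z ⬝ᵥ R *ᵥ z) := by
  rw [trace_eq R', trace_eq R]
  simp_rw [h.sm_q z h']
  rw [Finset.sum_sub_distrib, ← Finset.sum_div]
  congr 2
  simp only [single_one_dotProduct]
  simp only [dotProduct, sq]

/-- trace of the square -/
theorem sum_sq_le (h : Res c M R) : ∑ i, ∑ j, R i j ^ 2 ≤ p / c ^ 2 := by
  have : ∀ i, ∑ j, R i j ^ 2 ≤ 1 / c ^ 2 := by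
    intro i
    have h1 := h.normR_le' (Pi.single i 1)
    simp only [mulVec_single_one, single_one_dotProduct, Pi.single_eq_same] at h1
    refine le_trans (le_of_eq ?_) h1
    simp only [dotProduct, col_apply]
    refine Finset.sum_congr rfl fun j _ => ?_
    rw [← congrFun (congrFun h.symR i) j, transpose_apply]; ring
  calc _ ≤ ∑ i : Fin p, 1 / c ^ 2 := Finset.sum_le_sum fun i _ => this i
    _ = _ := by simp [div_eq_mul_inv]

theorem posSemidef (h : Res c M R) : R.PosSemidef := by
  refine PosSemidef.of_dotProduct_mulVec_nonneg ?_ ?_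
  · rw [IsHermitian, conjTranspose_eq_transpose_of_trivial, h.symR]
  · intro x; simpa using h.q_nonneg x

open scoped MatrixOrder in
theorem exists_transpose_mul {A : Matrix (Fin p) (Fin p) ℝ} (h : A.PosSemidef) :
    ∃ B : Matrix (Fin p) (Fin p) ℝ, A = Bᵀ * B := by
  obtain ⟨B, hB⟩ := CStarAlgebra.nonneg_iff_eq_star_mul_self.mp h.nonneg
  exact ⟨B, by rw [hB, star_eq_conjTranspose, conjTranspose_eq_transpose_of_trivial]⟩

theorem quad (h : Res c M R) :
    Integrable (fun z => (z ⬝ᵥ R *ᵥ z - R.trace) ^ 2) (stdGaussianVec p) ∧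
    ∫ z, (z ⬝ᵥ R *ᵥ z - R.trace) ^ 2 ∂(stdGaussianVec p) ≤ 2 * (p / c ^ 2) := by
  obtain ⟨B, hB⟩ := exists_transpose_mul h.posSemidef
  have q := quad_var (μ := stdGaussianVec p) (fun k z => B k ⬝ᵥ z) (fun k l => B k ⬝ᵥ B l)
    (fun k l => gp_vec (B k) (B l))
  have e1 : ∀ z : Fin p → ℝ, ∑ k, (B k ⬝ᵥ z) ^ 2 = z ⬝ᵥ R *ᵥ z := by
    intro z
    rw [hB, ← mulVec_mulVec, dotProduct_mulVec, vecMul_transpose]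
    simp [dotProduct, mulVec, sq]
  have e2 : ∑ k, B k ⬝ᵥ B k = R.trace := by
    rw [hB, trace_mul_comm]; simp [trace, Matrix.mul_apply, dotProduct]
  have e3 : ∑ k, ∑ l, (B k ⬝ᵥ B l) ^ 2 = ∑ i, ∑ j, R i j ^ 2 := by
    have a1 : ∑ k, ∑ l, (B k ⬝ᵥ B l) ^ 2 = ((B * Bᵀ) * (B * Bᵀ)).trace := by
      simp only [trace, diag_apply]
      refine Finset.sum_congr rfl fun k _ => ?_
      rw [Matrix.mul_apply]
      refine Finset.sum_congr rfl fun l _ => ?_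
      simp only [Matrix.mul_apply, transpose_apply, dotProduct, sq]
      congr 1
      exact Finset.sum_congr rfl fun _ _ => mul_comm _ _
    have a2 : ∑ i, ∑ j, R i j ^ 2 = (R * R).trace := by
      simp only [trace, diag_apply]
      refine Finset.sum_congr rfl fun k _ => ?_
      rw [Matrix.mul_apply]
      refine Finset.sum_congr rfl fun l _ => ?_
      rw [sq]; congr 1
      exact (congrFun (congrFun h.symR l) k)
    rw [a1, a2, hB, Matrix.mul_assoc, trace_mul_comm]
    simp only [Matrix.mul_assoc]
  simp only [e1, e2, e3] at q
  refine ⟨q.1, q.2.le.trans ?_⟩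
  exact mul_le_mul_of_nonneg_left h.sum_sq_le (by norm_num)

end Res


/-! ### The leave-one-out estimate -/

theorem inv_diff_le {x y : ℝ} (hx : 0 ≤ x) (hy : 0 ≤ y) : |1 / (1 + x) - 1 / (1 + y)| ≤ |x - y| := by
  have h1 : 0 < 1 + x := by linarith
  have h2 : 0 < 1 + y := by linarith
  have e : 1 / (1 + x) - 1 / (1 + y) = (y - x) / ((1 + x) * (1 + y)) := by field_simp; ring
  rw [e, abs_div, abs_of_pos (mul_pos h1 h2), abs_sub_comm]
  exact div_le_self (abs_nonneg _) (by nlinarith [mul_nonneg hx hy])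

theorem loo_pointwise {c ν η q T d s t n2 q' T' : ℝ} (hc : 0 < c) (hν : 0 ≤ ν) (hη : 0 < η)
    (hq0 : 0 ≤ q) (hq : q ≤ 1 / c) (hT : 0 ≤ T) (hd : 0 ≤ d) (hn0 : 0 ≤ n2) (hn : c * n2 ≤ d)
    (hq'0 : 0 ≤ q') (hq'1 : q' ≤ 1 / c) (hT'0 : 0 ≤ T')
    (hq' : q' = q - s ^ 2 / (1 + d)) (hT' : T' = T - n2 / (1 + d)) :
    (c * q' - 1 + ν * q' / (1 + T')) * (q' / (1 + T') - s / (1 + d) * t) ≤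
      (c * q - 1 + ν * q / (1 + T)) / (1 + T) * (q - s * t) +
      ((c + ν) * s ^ 2 + ν / c ^ 2) * (1 / c + (c * s ^ 2 + t ^ 2 / c) / 2) +
      (1 + ν / c) * (s ^ 2 + 1 / c ^ 2 + (η * (s ^ 2 * t ^ 2) + (d - T) ^ 2 / η) / 2) := by
  have hd1 : 0 < 1 + d := by linarith
  have ha1 := inv_diff_le hT'0 hT
  have ha2 := inv_diff_le hd hT
  obtain ⟨a, ha⟩ : ∃ a, a = 1 / (1 + T) := ⟨_, rfl⟩
  obtain ⟨a', ha'⟩ : ∃ a', a' = 1 / (1 + T') := ⟨_, rfl⟩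
  obtain ⟨b, hb⟩ : ∃ b, b = 1 / (1 + d) := ⟨_, rfl⟩
  have a0 : 0 ≤ a := by rw [ha]; positivity
  have a'0 : 0 ≤ a' := by rw [ha']; positivity
  have a1 : a ≤ 1 := by rw [ha]; exact div_le_one_of_le₀ (by linarith) (by linarith)
  have a'1 : a' ≤ 1 := by rw [ha']; exact div_le_one_of_le₀ (by linarith) (by linarith)
  rw [← ha, ← ha'] at ha1
  rw [← ha, ← hb] at ha2
  have hTd : |T' - T| ≤ 1 / c := by
    rw [hT', show T - n2 / (1 + d) - T = -(n2 / (1 + d)) by ring, abs_neg, abs_of_nonneg (by positivity),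
      div_le_div_iff₀ hd1 hc]
    nlinarith
  have hA1 : |a' - a| ≤ 1 / c := ha1.trans hTd
  have hqd : |q' - q| ≤ s ^ 2 := by
    rw [hq', show q - s ^ 2 / (1 + d) - q = -(s ^ 2 / (1 + d)) by ring, abs_neg,
      abs_of_nonneg (by positivity)]
    exact div_le_self (by positivity) (by linarith)
  have hcq : c * q' ≤ 1 := by rw [le_div_iff₀ hc] at hq'1; linarith
  have e1 : c * q' - 1 + ν * q' / (1 + T') = c * q' - 1 + ν * q' * a' := by rw [ha']; ring
  have e2 : q' / (1 + T') - s / (1 + d) * t = q' * a' - s * t * b := by rw [ha', hb]; ring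
  have e3 : (c * q - 1 + ν * q / (1 + T)) / (1 + T) * (q - s * t) =
    (c * q - 1 + ν * q * a) * (q * a - s * t * a) := by rw [ha]; ring
  rw [e1, e2, e3]
  have B1 : |c * q' - 1 + ν * q' * a'| ≤ 1 + ν / c := by
    have x1 : 0 ≤ ν * q' * a' := by positivity
    have x2 : ν * q' * a' ≤ ν / c := by
      calc ν * q' * a' ≤ ν * q' * 1 := by gcongr
        _ ≤ ν * (1 / c) * 1 := by gcongr
        _ = ν / c := by ring
    have x3 : 0 ≤ c * q' := by positivity
    have x4 : 0 ≤ ν / c := by positivity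
    rw [abs_le]; constructor <;> linarith
  have B2 : |(c * q' - 1 + ν * q' * a') - (c * q - 1 + ν * q * a)| ≤ (c + ν) * s ^ 2 + ν / c ^ 2 := by
    have : (c * q' - 1 + ν * q' * a') - (c * q - 1 + ν * q * a) =
      (c + ν * a') * (q' - q) + ν * q * (a' - a) := by ring
    rw [this]
    refine (abs_add_le _ _).trans ?_
    rw [abs_mul, abs_mul, abs_of_nonneg (by positivity : 0 ≤ c + ν * a'),
      abs_of_nonneg (by positivity : 0 ≤ ν * q)]
    have x1 : (c + ν * a') * |q' - q| ≤ (c + ν * 1) * s ^ 2 := by gcongr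
    have x2 : ν * q * |a' - a| ≤ ν * (1 / c) * (1 / c) := by gcongr
    calc _ ≤ _ := add_le_add x1 x2
      _ = _ := by field_simp
  have st : |s * t| ≤ (c * s ^ 2 + t ^ 2 / c) / 2 := by
    have h1 : 0 ≤ (c * |s| - |t|) ^ 2 / c := by positivity
    have h2 : (c * |s| - |t|) ^ 2 / c = c * s ^ 2 + t ^ 2 / c - 2 * |s * t| := by
      rw [abs_mul, sub_sq, mul_pow, sq_abs, sq_abs]; field_simp; ring
    linarith
  have B3 : |q * a - s * t * a| ≤ 1 / c + (c * s ^ 2 + t ^ 2 / c) / 2 := by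
    rw [show q * a - s * t * a = (q - s * t) * a by ring, abs_mul, abs_of_nonneg a0]
    calc |q - s * t| * a ≤ |q - s * t| * 1 := by gcongr
      _ ≤ |q| + |s * t| := by rw [mul_one]; exact abs_sub _ _
      _ ≤ _ := by rw [abs_of_nonneg hq0]; gcongr
  have std : |s * t * (b - a)| ≤ (η * (s ^ 2 * t ^ 2) + (d - T) ^ 2 / η) / 2 := by
    rw [abs_mul]
    have h0 : |s * t| * |b - a| ≤ |s * t| * |d - T| := by gcongr
    have h1 : 0 ≤ (η * |s * t| - |d - T|) ^ 2 / η := by positivity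
    have h2 : (η * |s * t| - |d - T|) ^ 2 / η =
        η * (s ^ 2 * t ^ 2) + (d - T) ^ 2 / η - 2 * (|s * t| * |d - T|) := by
      rw [sub_sq, mul_pow, sq_abs, sq_abs]; field_simp; ring
    linarith
  have B4 : |(q' * a' - s * t * b) - (q * a - s * t * a)| ≤
      s ^ 2 + 1 / c ^ 2 + (η * (s ^ 2 * t ^ 2) + (d - T) ^ 2 / η) / 2 := by
    have : (q' * a' - s * t * b) - (q * a - s * t * a) =
      a' * (q' - q) + q * (a' - a) - s * t * (b - a) := by ring
    rw [this]
    refine (abs_sub _ _).trans (add_le_add ?_ std)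
    refine (abs_add_le _ _).trans ?_
    rw [abs_mul, abs_mul, abs_of_nonneg a'0, abs_of_nonneg hq0]
    have x1 : a' * |q' - q| ≤ 1 * s ^ 2 := by gcongr
    have x2 : q * |a' - a| ≤ (1 / c) * (1 / c) := by gcongr
    calc _ ≤ _ := add_le_add x1 x2
      _ = _ := by field_simp
  set P' := c * q' - 1 + ν * q' * a'
  set P := c * q - 1 + ν * q * a
  set Bv := q' * a' - s * t * b
  set Av := q * a - s * t * a
  have f : P' * Bv = P * Av + (P' - P) * Av + P' * (Bv - Av) := by ring
  rw [f]
  have g1 : (P' - P) * Av ≤ ((c + ν) * s ^ 2 + ν / c ^ 2) * (1 / c + (c * s ^ 2 + t ^ 2 / c) / 2) :=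
    (le_abs_self _).trans (by rw [abs_mul]; gcongr)
  have g2 : P' * (Bv - Av) ≤ (1 + ν / c) *
      (s ^ 2 + 1 / c ^ 2 + (η * (s ^ 2 * t ^ 2) + (d - T) ^ 2 / η) / 2) :=
    (le_abs_self _).trans (by rw [abs_mul]; gcongr)
  linarith

theorem Res.of {p : ℕ} {c : ℝ} {M : Matrix (Fin p) (Fin p) ℝ} (hc : 0 < c) (hs : Mᵀ = M)
    (h : ∀ x : Fin p → ℝ, c * (x ⬝ᵥ x) ≤ x ⬝ᵥ M *ᵥ x) : Res c M M⁻¹ := by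
  refine ⟨hc, hs, ?_, h⟩
  have hp : M.PosDef := by
    refine PosDef.of_dotProduct_mulVec_pos ?_ ?_
    · rw [IsHermitian, conjTranspose_eq_transpose_of_trivial, hs]
    · intro x hx
      have : 0 < x ⬝ᵥ x := lt_of_le_of_ne (Res.dot_self_nonneg x)
        (fun h0 => hx (dotProduct_self_eq_zero.mp h0.symm))
      have h2 := h x
      simp only [star_trivial]
      nlinarith
  exact mul_nonsing_inv _ ((isUnit_iff_isUnit_det _).mp hp.isUnit)

theorem Res.det_ne {p : ℕ} {c : ℝ} {M R : Matrix (Fin p) (Fin p) ℝ} (h : Res c M R) : M.det ≠ 0 := by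
  intro h0
  have := congrArg det h.mul
  rw [det_mul, h0] at this
  simp at this

theorem continuous_inv_of_res {p : ℕ} {c : ℝ} {X : Type*} [TopologicalSpace X]
    {M : X → Matrix (Fin p) (Fin p) ℝ} (hM : Continuous M) (h : ∀ x, Res c (M x) (M x)⁻¹) :
    Continuous fun x => (M x)⁻¹ := by
  simp only [inv_def, Ring.inverse_eq_inv']
  exact ((hM.matrix_det).inv₀ fun x => (h x).det_ne).smul hM.matrix_adjugate

theorem Res.add_vec {p : ℕ} {c : ℝ} {M R : Matrix (Fin p) (Fin p) ℝ} (h : Res c M R)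
    (z : Fin p → ℝ) : Res c (M + vecMulVec z z) (M + vecMulVec z z)⁻¹ := by
  apply Res.of h.pos
  · rw [transpose_add, h.sym, transpose_vecMulVec]
  · intro x
    rw [add_mulVec, dotProduct_add, vecMulVec_mulVec]
    have h1 := h.lb x
    have : x ⬝ᵥ MulOpposite.op (z ⬝ᵥ x) • z = (z ⬝ᵥ x) ^ 2 := by
      rw [op_smul_eq_smul, dotProduct_smul, dotProduct_comm x z, smul_eq_mul]; ring
    rw [this]
    nlinarith [sq_nonneg (z ⬝ᵥ x)]

/-- The self-consistency defect. -/
noncomputable def Psi {p : ℕ} (c ν : ℝ) (u : Fin p → ℝ) (R : Matrix (Fin p) (Fin p) ℝ) : ℝ :=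
  c * (u ⬝ᵥ R *ᵥ u) - 1 + ν * (u ⬝ᵥ R *ᵥ u) / (1 + R.trace)

noncomputable def looBound (c ν η p : ℝ) : ℝ :=
  ((c + ν) * 4 / c ^ 3 + 2 * ν / c ^ 3) + (1 + ν / c) * (2 / c ^ 2 + (3 * η / c ^ 2 + 2 * (p / c ^ 2) / η) / 2)

theorem loo_integral {p : ℕ} {c ν η : ℝ} {M R : Matrix (Fin p) (Fin p) ℝ} (h : Res c M R)
    (hν : 0 ≤ ν) (hη : 0 < η) (u : Fin p → ℝ) (hu : u ⬝ᵥ u = 1) 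
    (hint : Integrable (fun z => Psi c ν u (M + vecMulVec z z)⁻¹ *
      (u ⬝ᵥ (M + vecMulVec z z)⁻¹ *ᵥ u / (1 + (M + vecMulVec z z)⁻¹.trace) -
        (u ⬝ᵥ (M + vecMulVec z z)⁻¹ *ᵥ z) * (u ⬝ᵥ z))) (stdGaussianVec p)) :
    ∫ z, Psi c ν u (M + vecMulVec z z)⁻¹ *
      (u ⬝ᵥ (M + vecMulVec z z)⁻¹ *ᵥ u / (1 + (M + vecMulVec z z)⁻¹.trace) -
        (u ⬝ᵥ (M + vecMulVec z z)⁻¹ *ᵥ z) * (u ⬝ᵥ z)) ∂(stdGaussianVec p) ≤ looBound c ν η p := by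
  have hc := h.pos
  have hqu := h.q_le u
  have hqu0 := h.q_nonneg u
  rw [hu] at hqu
  have hT := h.trace_nonneg
  set q := u ⬝ᵥ R *ᵥ u with hq
  set T := R.trace with hTdef
  have gp := gp_vec (R *ᵥ u) u
  have hA : (R *ᵥ u) ⬝ᵥ (R *ᵥ u) ≤ 1 / c ^ 2 := by have := h.normR_le' u; rwa [hu] at this
  have hA0 := Res.dot_self_nonneg (R *ᵥ u)
  have hC : (R *ᵥ u) ⬝ᵥ u = q := by rw [hq, dotProduct_comm]
  rw [hC, hu] at gp
  set A := (R *ᵥ u) ⬝ᵥ (R *ᵥ u)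
  have I1 := gp.left.integrable_pow 2
  have I2 := gp.left.integrable_pow 4
  have I3 := gp.right.integrable_pow 2
  obtain ⟨I4, E4⟩ := gp.mul_eq
  obtain ⟨I5, E5⟩ := gp.sq_mul_sq
  obtain ⟨I6, E6⟩ := h.quad
  have E1 := gp.left.sq
  have E2 := gp.left.four
  have E3 := gp.right.sq
  set k0 : ℝ := (c * q - 1 + ν * q / (1 + T)) / (1 + T)
  have bd : ∀ z : Fin p → ℝ, Psi c ν u (M + vecMulVec z z)⁻¹ *
      (u ⬝ᵥ (M + vecMulVec z z)⁻¹ *ᵥ u / (1 + (M + vecMulVec z z)⁻¹.trace) -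
        (u ⬝ᵥ (M + vecMulVec z z)⁻¹ *ᵥ z) * (u ⬝ᵥ z)) ≤
      ((((((k0 * q + ν / c ^ 2 * (1 / c) + (1 + ν / c) * (1 / c ^ 2))
      + (-k0) * ((R *ᵥ u) ⬝ᵥ z * u ⬝ᵥ z))
      + ((c + ν) / c + ν / c ^ 2 * c / 2 + (1 + ν / c)) * ((R *ᵥ u) ⬝ᵥ z) ^ 2)
      + (ν / c ^ 2 / c / 2) * (u ⬝ᵥ z) ^ 2)
      + ((c + ν) * c / 2) * ((R *ᵥ u) ⬝ᵥ z) ^ 4)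
      + ((c + ν) / c / 2 + (1 + ν / c) * η / 2) * (((R *ᵥ u) ⬝ᵥ z) ^ 2 * (u ⬝ᵥ z) ^ 2))
      + ((1 + ν / c) / η / 2) * (z ⬝ᵥ R *ᵥ z - T) ^ 2 := by
    intro z
    have h' := h.add_vec z
    have hs : u ⬝ᵥ R *ᵥ z = (R *ᵥ u) ⬝ᵥ z := h.dot_comm u z
    rw [h.sm_z z h', hs]
    have hq' := h'.q_le u
    rw [hu] at hq'
    have e := h.sm_q z h' u
    rw [hs] at e
    refine (loo_pointwise (q := q) (T := T) (t := u ⬝ᵥ z) hc hν hη hqu0 hqu hT (h.q_nonneg z)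
      (Res.dot_self_nonneg (R *ᵥ z)) (h.normR_le z) (h'.q_nonneg u) hq' h'.trace_nonneg e
      (h.sm_tr z h')).trans (le_of_eq ?_)
    simp only [k0]
    ring
  have i0 : Integrable (fun _ : Fin p → ℝ => k0 * q + ν / c ^ 2 * (1 / c) + (1 + ν / c) * (1 / c ^ 2))
    (stdGaussianVec p) := integrable_const _
  have i1 := i0.add (I4.const_mul (-k0))
  have i2 := i1.add (I1.const_mul ((c + ν) / c + ν / c ^ 2 * c / 2 + (1 + ν / c)))
  have i3 := i2.add (I3.const_mul (ν / c ^ 2 / c / 2))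
  have i4 := i3.add (I2.const_mul ((c + ν) * c / 2))
  have i5 := i4.add (I5.const_mul ((c + ν) / c / 2 + (1 + ν / c) * η / 2))
  have i6 := i5.add (I6.const_mul ((1 + ν / c) / η / 2))
  refine (integral_mono hint i6 bd).trans ?_
  rw [integral_add' i5 (I6.const_mul _), integral_add' i4 (I5.const_mul _),
    integral_add' i3 (I2.const_mul _), integral_add' i2 (I3.const_mul _),
    integral_add' i1 (I1.const_mul _), integral_add' i0 (I4.const_mul _)]
  simp only [integral_const_mul, E1, E2, E3, E4, E5, integral_const, probReal_univ, one_smul]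
  have hA2 : A ^ 2 ≤ 1 / c ^ 4 := by
    calc A ^ 2 ≤ (1 / c ^ 2) ^ 2 := by gcongr
      _ = _ := by field_simp
  have hq2 : q ^ 2 ≤ 1 / c ^ 2 := by
    calc q ^ 2 ≤ (1 / c) ^ 2 := by gcongr
      _ = _ := by field_simp
  have b1 : ((c + ν) / c + ν / c ^ 2 * c / 2 + (1 + ν / c)) * A ≤
    ((c + ν) / c + ν / c ^ 2 * c / 2 + (1 + ν / c)) * (1 / c ^ 2) := by gcongr
  have b2 : ((c + ν) * c / 2) * (3 * A ^ 2) ≤ ((c + ν) * c / 2) * (3 * (1 / c ^ 4)) := by gcongr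
  have b3 : ((c + ν) / c / 2 + (1 + ν / c) * η / 2) * (A * 1 + 2 * q ^ 2) ≤
    ((c + ν) / c / 2 + (1 + ν / c) * η / 2) * (1 / c ^ 2 * 1 + 2 * (1 / c ^ 2)) := by gcongr
  have b4 : ((1 + ν / c) / η / 2) * ∫ z, (z ⬝ᵥ R *ᵥ z - T) ^ 2 ∂(stdGaussianVec p) ≤
    ((1 + ν / c) / η / 2) * (2 * (p / c ^ 2)) := by gcongr
  have fin : looBound c ν η p = k0 * q + ν / c ^ 2 * (1 / c) + (1 + ν / c) * (1 / c ^ 2) +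
      -k0 * q + ((c + ν) / c + ν / c ^ 2 * c / 2 + (1 + ν / c)) * (1 / c ^ 2) +
      ν / c ^ 2 / c / 2 * 1 + ((c + ν) * c / 2) * (3 * (1 / c ^ 4)) +
      ((c + ν) / c / 2 + (1 + ν / c) * η / 2) * (1 / c ^ 2 * 1 + 2 * (1 / c ^ 2)) +
      ((1 + ν / c) / η / 2) * (2 * (p / c ^ 2)) := by
    unfold looBound
    field_simp
    ring
  rw [fin]
  linarith


/-! ### Second moment of the defect -/

/-- `ZᵀZ + c I`. -/
noncomputable def Gm {m p : ℕ} (c : ℝ) (Z : Fin m → Fin p → ℝ) : Matrix (Fin p) (Fin p) ℝ :=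
  ∑ i, vecMulVec (Z i) (Z i) + c • 1

noncomputable def Rm {m p : ℕ} (c : ℝ) (Z : Fin m → Fin p → ℝ) : Matrix (Fin p) (Fin p) ℝ :=
  (Gm c Z)⁻¹

theorem Gm_mulVec {m p : ℕ} (c : ℝ) (Z : Fin m → Fin p → ℝ) (x : Fin p → ℝ) :
    Gm c Z *ᵥ x = ∑ i, (Z i ⬝ᵥ x) • Z i + c • x := by
  rw [Gm, add_mulVec, Matrix.sum_mulVec, smul_mulVec, one_mulVec]
  congr 1
  refine Finset.sum_congr rfl fun i _ => ?_
  rw [vecMulVec_mulVec, op_smul_eq_smul]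

theorem res_Gm {m p : ℕ} {c : ℝ} (hc : 0 < c) (Z : Fin m → Fin p → ℝ) : Res c (Gm c Z) (Rm c Z) := by
  apply Res.of hc
  · rw [Gm, transpose_add, transpose_sum, transpose_smul, transpose_one]
    simp [transpose_vecMulVec]
  · intro x
    rw [Gm_mulVec, dotProduct_add, dotProduct_smul, smul_eq_mul, dotProduct_sum]
    have : 0 ≤ ∑ i, x ⬝ᵥ (Z i ⬝ᵥ x) • Z i := Finset.sum_nonneg fun i _ => by
      rw [dotProduct_smul, dotProduct_comm, smul_eq_mul]; exact mul_self_nonneg _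
    linarith

theorem continuous_Rm {m p : ℕ} {c : ℝ} (hc : 0 < c) :
    Continuous fun Z : Fin m → Fin p → ℝ => Rm c Z := by
  refine continuous_inv_of_res (c := c) ?_ (res_Gm hc)
  unfold Gm
  refine (continuous_finsetSum _ fun i _ => ?_).add continuous_const
  exact (continuous_apply i).matrix_vecMulVec (continuous_apply i)

theorem Gm_quad {m p : ℕ} {c : ℝ} (hc : 0 < c) (Z : Fin m → Fin p → ℝ) (u : Fin p → ℝ) :
    c * (u ⬝ᵥ Rm c Z *ᵥ u) = u ⬝ᵥ u - ∑ i, (u ⬝ᵥ Rm c Z *ᵥ Z i) * (u ⬝ᵥ Z i) := by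
  have h := res_Gm hc Z
  have e := h.MR u
  rw [Gm_mulVec] at e
  have e2 := congrArg (fun v => u ⬝ᵥ v) e
  simp only [dotProduct_add, dotProduct_smul, smul_eq_mul, dotProduct_sum] at e2
  have : ∀ i, (u ⬝ᵥ Rm c Z *ᵥ Z i) * (u ⬝ᵥ Z i) = (Z i ⬝ᵥ Rm c Z *ᵥ u) * (u ⬝ᵥ Z i) := fun i => by
    rw [h.dot_swap]
  simp_rw [this]
  linarith

/-- one summand -/
noncomputable def Bi {m p : ℕ} (c : ℝ) (u : Fin p → ℝ) (i : Fin m) (Z : Fin m → Fin p → ℝ) : ℝ :=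
  u ⬝ᵥ Rm c Z *ᵥ u / (1 + (Rm c Z).trace) - (u ⬝ᵥ Rm c Z *ᵥ Z i) * (u ⬝ᵥ Z i)

theorem Psi_eq_sum {m p : ℕ} {c : ℝ} (hc : 0 < c) (Z : Fin m → Fin p → ℝ) (u : Fin p → ℝ)
    (hu : u ⬝ᵥ u = 1) : Psi c m u (Rm c Z) = ∑ i, Bi c u i Z := by
  have := Gm_quad hc Z u
  rw [hu] at this
  unfold Psi Bi
  rw [this, Finset.sum_sub_distrib, Finset.sum_const, Finset.card_univ, Fintype.card_fin, nsmul_eq_mul]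
  ring

theorem Psi_bound {p : ℕ} {c ν : ℝ} {M R : Matrix (Fin p) (Fin p) ℝ} (h : Res c M R) (hν : 0 ≤ ν)
    (u : Fin p → ℝ) (hu : u ⬝ᵥ u = 1) : |Psi c ν u R| ≤ 1 + ν / c := by
  have hq := h.q_le u
  have hq0 := h.q_nonneg u
  rw [hu] at hq
  have hT := h.trace_nonneg
  have hc := h.pos
  unfold Psi
  set q := u ⬝ᵥ R *ᵥ u
  have x0 : c * q ≤ 1 := by rw [le_div_iff₀ hc] at hq; linarith
  have x1 : 0 ≤ ν * q / (1 + R.trace) := by positivity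
  have x2 : ν * q / (1 + R.trace) ≤ ν / c := by
    calc ν * q / (1 + R.trace) ≤ ν * q := div_le_self (by positivity) (by linarith)
      _ ≤ ν * (1 / c) := by gcongr
      _ = ν / c := by ring
  have x3 : 0 ≤ c * q := by positivity
  have x4 : 0 ≤ ν / c := by positivity
  rw [abs_le]; constructor <;> linarith

theorem Bi_bound {m p : ℕ} {c : ℝ} (hc : 0 < c) (u : Fin p → ℝ) (hu : u ⬝ᵥ u = 1) (i : Fin m)
    (Z : Fin m → Fin p → ℝ) : |Bi c u i Z| ≤ 1 / c + (1 / c ^ 2 + 1) * (Z i ⬝ᵥ Z i) := by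
  have h := res_Gm hc Z
  have hq := h.q_le u
  have hq0 := h.q_nonneg u
  rw [hu] at hq
  have hT := h.trace_nonneg
  have h1 := Res.cs (Rm c Z *ᵥ u) (Z i)
  have h2 := Res.cs u (Z i)
  have h3 := h.normR_le' u
  rw [hu] at h2 h3
  have h4 := Res.dot_self_nonneg (Z i)
  rw [← h.dot_comm] at h1
  unfold Bi
  have x1 : 0 ≤ u ⬝ᵥ Rm c Z *ᵥ u / (1 + (Rm c Z).trace) := by positivity
  have x2 : u ⬝ᵥ Rm c Z *ᵥ u / (1 + (Rm c Z).trace) ≤ 1 / c :=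
    (div_le_self (by positivity) (by linarith)).trans hq
  have x3 : (u ⬝ᵥ Rm c Z *ᵥ Z i) ^ 2 ≤ 1 / c ^ 2 * (Z i ⬝ᵥ Z i) := h1.trans (by gcongr)
  have x4 : |(u ⬝ᵥ Rm c Z *ᵥ Z i) * (u ⬝ᵥ Z i)| ≤ (1 / c ^ 2 + 1) * (Z i ⬝ᵥ Z i) := by
    have := two_mul_le_add_sq |u ⬝ᵥ Rm c Z *ᵥ Z i| |u ⬝ᵥ Z i|
    rw [sq_abs, sq_abs] at this
    rw [abs_mul]
    have := mul_nonneg (abs_nonneg (u ⬝ᵥ Rm c Z *ᵥ Z i)) (abs_nonneg (u ⬝ᵥ Z i))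
    nlinarith
  refine (abs_sub _ _).trans (add_le_add ?_ x4)
  rwa [abs_of_nonneg x1]

theorem continuous_q {m p : ℕ} {c : ℝ} (hc : 0 < c) (u : Fin p → ℝ) :
    Continuous fun Z : Fin m → Fin p → ℝ => u ⬝ᵥ Rm c Z *ᵥ u :=
  Continuous.dotProduct continuous_const ((continuous_Rm hc).matrix_mulVec continuous_const)

theorem continuous_tr {m p : ℕ} {c : ℝ} (hc : 0 < c) :
    Continuous fun Z : Fin m → Fin p → ℝ => (Rm c Z).trace := (continuous_Rm hc).matrix_trace

theorem continuous_Psi {m p : ℕ} {c ν : ℝ} (hc : 0 < c) (u : Fin p → ℝ) :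
    Continuous fun Z : Fin m → Fin p → ℝ => Psi c ν u (Rm c Z) := by
  unfold Psi
  refine ((continuous_const.mul (continuous_q hc u)).sub continuous_const).add
    ((continuous_const.mul (continuous_q hc u)).div (continuous_const.add (continuous_tr hc)) ?_)
  intro Z
  have := (res_Gm hc Z).trace_nonneg
  positivity

theorem continuous_Bi {m p : ℕ} {c : ℝ} (hc : 0 < c) (u : Fin p → ℝ) (i : Fin m) :
    Continuous fun Z : Fin m → Fin p → ℝ => Bi c u i Z := by
  unfold Bi
  refine ((continuous_q hc u).div (continuous_const.add (continuous_tr hc)) ?_).sub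
    ((Continuous.dotProduct continuous_const ((continuous_Rm hc).matrix_mulVec (continuous_apply i))).mul
      (Continuous.dotProduct continuous_const (continuous_apply i)))
  intro Z
  have := (res_Gm hc Z).trace_nonneg
  show 1 + (Rm c Z).trace ≠ 0
  positivity

theorem integrable_row {m p : ℕ} (i : Fin m) :
    Integrable (fun Z : Fin m → Fin p → ℝ => Z i ⬝ᵥ Z i) (stdGaussianMatrix m p) := by
  unfold dotProduct
  refine integrable_finsetSum _ fun j _ => ?_
  have := (gl_mat (n := m) (k := p) (Pi.single i (Pi.single j 1))).integrable_pow 2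
  have e : ∀ W : Fin m → Fin p → ℝ, ∑ i', (Pi.single i (Pi.single j 1) : Fin m → Fin p → ℝ) i' ⬝ᵥ W i' = W i j := by
    intro W
    rw [Finset.sum_eq_single i]
    · simp
    · intro b _ hb; simp [Pi.single_eq_of_ne hb]
    · simp
  simp only [e] at this
  simpa [sq] using this

theorem integrable_PB {m p : ℕ} {c ν : ℝ} (hc : 0 < c) (hν : 0 ≤ ν) (u : Fin p → ℝ) (hu : u ⬝ᵥ u = 1)
    (i : Fin m) : Integrable (fun Z => Psi c ν u (Rm c Z) * Bi c u i Z) (stdGaussianMatrix m p) := by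
  refine Integrable.mono' (g := fun Z => (1 + ν / c) * (1 / c + (1 / c ^ 2 + 1) * (Z i ⬝ᵥ Z i)))
    (((integrable_const _).add ((integrable_row i).const_mul _)).const_mul _)
    ((continuous_Psi hc u).mul (continuous_Bi hc u i)).aestronglyMeasurable (ae_of_all _ fun Z => ?_)
  rw [Real.norm_eq_abs, abs_mul]
  have := Psi_bound (res_Gm hc Z) hν u hu
  have := Bi_bound hc u hu i Z
  gcongr

theorem Gm_insert {m p : ℕ} (c : ℝ) (i : Fin (m + 1)) (z : Fin p → ℝ) (Z : Fin m → Fin p → ℝ) :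
    Gm c (i.insertNth z Z : Fin (m + 1) → Fin p → ℝ) = Gm c Z + vecMulVec z z := by
  unfold Gm
  rw [Fin.sum_univ_succAbove _ i]
  simp only [Fin.insertNth_apply_same, Fin.insertNth_apply_succAbove]
  abel

theorem integral_PB {m p : ℕ} {c ν η : ℝ} (hc : 0 < c) (hν : 0 ≤ ν) (hη : 0 < η) (u : Fin p → ℝ)
    (hu : u ⬝ᵥ u = 1) (i : Fin m) :
    ∫ Z, Psi c ν u (Rm c Z) * Bi c u i Z ∂(stdGaussianMatrix m p) ≤ looBound c ν η p := by
  obtain ⟨m, rfl⟩ : ∃ k, m = k + 1 := ⟨m - 1, by have := i.pos; omega⟩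
  have mp := (measurePreserving_piFinSuccAbove (fun _ : Fin (m + 1) => stdGaussianVec p) i).symm
  have I := integrable_PB (ν := ν) hc hν u hu i
  set F := fun Z : Fin (m + 1) → Fin p → ℝ => Psi c ν u (Rm c Z) * Bi c u i Z with hF
  have e : ∫ Z, F Z ∂(stdGaussianMatrix (m + 1) p) =
      ∫ w, F (i.insertNth w.1 w.2) ∂((stdGaussianVec p).prod (stdGaussianMatrix m p)) :=
    (mp.integral_comp' F).symm
  have I2 : Integrable (fun w : (Fin p → ℝ) × (Fin m → Fin p → ℝ) => F (i.insertNth w.1 w.2))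
      ((stdGaussianVec p).prod (stdGaussianMatrix m p)) :=
    mp.integrable_comp_of_integrable I
  rw [e, integral_prod_symm _ I2]
  have ae := I2.prod_left_ae
  have : ∫ y, ∫ x, F (i.insertNth x y) ∂(stdGaussianVec p) ∂(stdGaussianMatrix m p) ≤
      ∫ y : Fin m → Fin p → ℝ, looBound c ν η p ∂(stdGaussianMatrix m p) := by
    refine integral_mono_ae I2.integral_prod_right (integrable_const _) ?_
    filter_upwards [ae] with Z hZ
    have := loo_integral (res_Gm hc Z) hν hη u hu (by
      refine hZ.congr (ae_of_all _ fun z => ?_)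
      simp only [hF, Bi, Rm, Gm_insert, Fin.insertNth_apply_same])
    refine le_trans (le_of_eq ?_) this
    refine integral_congr_ae (ae_of_all _ fun z => ?_)
    simp only [hF, Bi, Rm, Gm_insert, Fin.insertNth_apply_same]
  simpa using this

theorem Psi_sq {m p : ℕ} {c η : ℝ} (hc : 0 < c) (hη : 0 < η) (u : Fin p → ℝ)
    (hu : u ⬝ᵥ u = 1) :
    ∫ Z, Psi c m u (Rm c Z) ^ 2 ∂(stdGaussianMatrix m p) ≤ m * looBound c m η p := by
  have e : ∀ Z : Fin m → Fin p → ℝ, Psi c m u (Rm c Z) ^ 2 = ∑ i, Psi c m u (Rm c Z) * Bi c u i Z := by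
    intro Z
    rw [← Finset.mul_sum, ← Psi_eq_sum hc Z u hu, sq]
  simp_rw [e]
  rw [integral_finsetSum _ fun i _ => integrable_PB hc (Nat.cast_nonneg _) u hu i]
  calc _ ≤ ∑ i : Fin m, looBound c m η p :=
        Finset.sum_le_sum fun i _ => integral_PB hc (Nat.cast_nonneg _) hη u hu i
    _ = _ := by simp

theorem integrable_Psi_sq {m p : ℕ} {c ν : ℝ} (hc : 0 < c) (hν : 0 ≤ ν) (u : Fin p → ℝ)
    (hu : u ⬝ᵥ u = 1) :
    Integrable (fun Z => Psi c ν u (Rm c Z) ^ 2) (stdGaussianMatrix m p) := by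
  refine Integrable.mono' (g := fun Z => (1 + ν / c) ^ 2) (integrable_const _)
    ((continuous_Psi hc u).pow 2).aestronglyMeasurable (ae_of_all _ fun Z => ?_)
  rw [Real.norm_eq_abs, abs_pow]
  have := Psi_bound (res_Gm hc Z) hν u hu
  gcongr

theorem trPsi_sq {m p : ℕ} {c η : ℝ} (hc : 0 < c) (hη : 0 < η) (hp : 0 < p) :
    Integrable (fun Z => (c * ((Rm c Z).trace / p) - 1 + m * ((Rm c Z).trace / p) / (1 + (Rm c Z).trace)) ^ 2)
      (stdGaussianMatrix m p) ∧
    ∫ Z, (c * ((Rm c Z).trace / p) - 1 + m * ((Rm c Z).trace / p) / (1 + (Rm c Z).trace)) ^ 2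
      ∂(stdGaussianMatrix m p) ≤ m * looBound c m η p := by
  have hp' : (0 : ℝ) < p := Nat.cast_pos.mpr hp
  have hu : ∀ j : Fin p, (Pi.single j 1 : Fin p → ℝ) ⬝ᵥ Pi.single j 1 = 1 := by intro j; simp
  have e : ∀ Z : Fin m → Fin p → ℝ,
      c * ((Rm c Z).trace / p) - 1 + m * ((Rm c Z).trace / p) / (1 + (Rm c Z).trace) =
      (∑ j, Psi c m (Pi.single j 1) (Rm c Z)) / p := by
    intro Z
    unfold Psi
    rw [Finset.sum_add_distrib, Finset.sum_sub_distrib, ← Finset.mul_sum, ← Finset.sum_div,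
      ← Finset.mul_sum, ← Res.trace_eq]
    simp
    field_simp
  have b : ∀ Z : Fin m → Fin p → ℝ,
      (c * ((Rm c Z).trace / p) - 1 + m * ((Rm c Z).trace / p) / (1 + (Rm c Z).trace)) ^ 2 ≤
      (∑ j, Psi c m (Pi.single j 1) (Rm c Z) ^ 2) / p := by
    intro Z
    rw [e, div_pow, div_le_div_iff₀ (by positivity) hp']
    have := sq_sum_le_card_mul_sum_sq (s := Finset.univ) (f := fun j => Psi c m (Pi.single j 1) (Rm c Z))
    rw [Finset.card_univ, Fintype.card_fin] at this
    nlinarith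
  have I : Integrable (fun Z => (∑ j, Psi c m (Pi.single j 1) (Rm c Z) ^ 2) / (p : ℝ))
      (stdGaussianMatrix m p) :=
    (integrable_finsetSum _ fun j _ => integrable_Psi_sq hc (Nat.cast_nonneg _) _ (hu j)).div_const _
  have I2 : Integrable (fun Z => (c * ((Rm c Z).trace / p) - 1 +
      m * ((Rm c Z).trace / p) / (1 + (Rm c Z).trace)) ^ 2) (stdGaussianMatrix m p) := by
    refine I.mono' ?_ (ae_of_all _ fun Z => ?_)
    · refine Continuous.aestronglyMeasurable ?_
      simp_rw [e]
      exact ((continuous_finsetSum _ fun j _ => continuous_Psi hc _).div_const _).pow 2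
    · rw [Real.norm_eq_abs, abs_of_nonneg (sq_nonneg _)]; exact b Z
  refine ⟨I2, (integral_mono I2 I b).trans ?_⟩
  rw [integral_div, integral_finsetSum _ fun j _ => integrable_Psi_sq hc (Nat.cast_nonneg _) _ (hu j),
    div_le_iff₀ hp']
  calc _ ≤ ∑ j : Fin p, (m * looBound c m η p) := Finset.sum_le_sum fun j _ => Psi_sq hc hη _ (hu j)
    _ = _ := by simp; ring


/-! ### Convergence in probability as a filter -/

/-- Sets of asymptotically full probability. -/
def PF {Ω : ℕ → Type*} [∀ n, MeasurableSpace (Ω n)] (μ : ∀ n, Measure (Ω n)) : Filter (Σ n, Ω n) where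
  sets := {A | Tendsto (fun n => μ n {ω | (⟨n, ω⟩ : Σ n, Ω n) ∉ A}) atTop (𝓝 0)}
  univ_sets := by simp
  sets_of_superset := by
    intro A B hA hAB
    refine tendsto_of_tendsto_of_tendsto_of_le_of_le tendsto_const_nhds hA (fun _ => zero_le) ?_
    intro n
    exact measure_mono fun ω h h' => h (hAB h')
  inter_sets := by
    intro A B hA hB
    have := Tendsto.add hA hB
    rw [add_zero] at this
    refine tendsto_of_tendsto_of_tendsto_of_le_of_le tendsto_const_nhds this (fun _ => zero_le) ?_
    intro n
    refine (measure_mono ?_).trans (measure_union_le _ _)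
    intro ω h
    by_contra h2
    simp only [Set.mem_union, Set.mem_ofPred_eq, not_or, not_not] at h2
    exact h ⟨h2.1, h2.2⟩

section
variable {Ω : ℕ → Type*} [∀ n, MeasurableSpace (Ω n)] {μ : ∀ n, Measure (Ω n)}

theorem mem_PF {A : Set (Σ n, Ω n)} :
    A ∈ PF μ ↔ Tendsto (fun n => μ n {ω | (⟨n, ω⟩ : Σ n, Ω n) ∉ A}) atTop (𝓝 0) := Iff.rfl

theorem PF_fst : Tendsto (fun x : Σ n, Ω n => x.1) (PF μ) atTop := by
  rw [tendsto_atTop]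
  intro N
  show _ ∈ PF μ
  rw [mem_PF]
  refine tendsto_const_nhds.congr' ?_
  filter_upwards [eventually_ge_atTop N] with n hn
  simp [hn]

theorem PF_sq (X : ∀ n, Ω n → ℝ) (b : ℕ → ℝ) (hb : Tendsto b atTop (𝓝 0))
    (hi : ∀ᶠ n in atTop, Integrable (fun ω => X n ω ^ 2) (μ n) ∧ ∫ ω, X n ω ^ 2 ∂(μ n) ≤ b n) :
    Tendsto (fun x : Σ n, Ω n => X x.1 x.2) (PF μ) (𝓝 0) := by
  rw [Metric.tendsto_nhds]
  intro ε hε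
  show _ ∈ PF μ
  rw [mem_PF]
  have l : Tendsto (fun n => ENNReal.ofReal (b n / ε ^ 2)) atTop (𝓝 0) := by
    have := ENNReal.tendsto_ofReal (hb.div_const (ε ^ 2))
    simpa using this
  refine tendsto_of_tendsto_of_tendsto_of_le_of_le' tendsto_const_nhds l
    (Eventually.of_forall fun _ => zero_le) ?_
  filter_upwards [hi] with n hn
  obtain ⟨h1, h2⟩ := hn
  have m := meas_ge_le_lintegral_div (μ := μ n) (f := fun ω => ENNReal.ofReal (X n ω ^ 2))
    (h1.aemeasurable.ennreal_ofReal) (ε := ENNReal.ofReal (ε ^ 2)) (by simp; positivity) (by simp)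
  rw [← ofReal_integral_eq_lintegral_ofReal h1 (ae_of_all _ fun _ => sq_nonneg _),
    ← ENNReal.ofReal_div_of_pos (by positivity)] at m
  refine (measure_mono ?_).trans (m.trans (ENNReal.ofReal_le_ofReal (by gcongr)))
  intro ω h
  simp only [Set.mem_ofPred_eq, dist_zero_right, Real.norm_eq_abs, not_lt] at h ⊢
  apply ENNReal.ofReal_le_ofReal
  rw [← sq_abs (X n ω)]
  gcongr

theorem PF_integral [∀ n, IsProbabilityMeasure (μ n)] (Y : ∀ n, Ω n → ℝ) (K a : ℝ)
    (hm : ∀ᶠ n in atTop, Measurable (Y n)) (hK : ∀ n ω, |Y n ω| ≤ K)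
    (h : Tendsto (fun x : Σ n, Ω n => Y x.1 x.2) (PF μ) (𝓝 a)) :
    Tendsto (fun n => ∫ ω, Y n ω ∂(μ n)) atTop (𝓝 a) := by
  rw [Metric.tendsto_nhds] at h ⊢
  intro ε hε
  have h1 := h (ε / 2) (by linarith)
  change _ ∈ PF μ at h1
  rw [mem_PF] at h1
  have K0 : 0 ≤ K + |a| := by
    have := h1
    by_contra hneg
    have hKn : K < 0 := by have := abs_nonneg a; linarith
    have : ∀ n, IsEmpty (Ω n) := fun n => ⟨fun ω => by have := hK n ω; have := abs_nonneg (Y n ω); linarith⟩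
    have h2 : μ 0 Set.univ = 1 := measure_univ
    have := this 0
    simp [Set.univ_eq_empty_iff.mpr this] at h2
  have h2 : Tendsto (fun n => (K + |a|) * (μ n).real {ω | ¬ dist (Y n ω) a < ε / 2}) atTop (𝓝 0) := by
    have := ((ENNReal.tendsto_toReal ENNReal.zero_ne_top).comp h1).const_mul (K + |a|)
    simpa [Measure.real] using this
  have h3 := (tendsto_order.1 h2).2 (ε / 2) (by linarith)
  filter_upwards [h3, hm] with n hn hmn
  have I : Integrable (Y n) (μ n) := Integrable.mono' (integrable_const K) hmn.aestronglyMeasurable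
    (ae_of_all _ (hK n))
  have ms : MeasurableSet {ω | ¬ dist (Y n ω) a < ε / 2} :=
    (measurableSet_lt (hmn.dist measurable_const) measurable_const).compl
  have e : ∫ ω, Y n ω ∂(μ n) - a = ∫ ω, (Y n ω - a) ∂(μ n) := by
    rw [integral_sub I (integrable_const _)]; simp
  rw [Real.dist_eq, e]
  have J : Integrable (fun ω => ε / 2 + Set.indicator {ω | ¬ dist (Y n ω) a < ε / 2}
      (fun _ => K + |a|) ω) (μ n) := (integrable_const _).add ((integrable_const _).indicator ms)
  calc |∫ ω, (Y n ω - a) ∂(μ n)| ≤ ∫ ω, |Y n ω - a| ∂(μ n) := abs_integral_le_integral_abs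
    _ ≤ ∫ ω, (ε / 2 + Set.indicator {ω | ¬ dist (Y n ω) a < ε / 2} (fun _ => K + |a|) ω) ∂(μ n) := by
        refine integral_mono (I.sub (integrable_const _)).abs J fun ω => ?_
        by_cases hω : dist (Y n ω) a < ε / 2
        · have : ω ∉ {ω | ¬ dist (Y n ω) a < ε / 2} := fun h => h hω
          simp only [Set.indicator_of_notMem this]
          rw [Real.dist_eq] at hω
          linarith
        · have : ω ∈ {ω | ¬ dist (Y n ω) a < ε / 2} := hω
          simp only [Set.indicator_of_mem this]
          have := abs_sub (Y n ω) a
          have := hK n ω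
          linarith
    _ < ε := by
        rw [integral_add (integrable_const _) ((integrable_const _).indicator ms),
          integral_indicator_const _ ms]
        simp only [integral_const, probReal_univ, smul_eq_mul]
        linarith

theorem PF_prod {Ω' : ℕ → Type*} [∀ n, MeasurableSpace (Ω' n)] {ν : ∀ n, Measure (Ω' n)}
    [∀ n, IsProbabilityMeasure (ν n)] [∀ n, IsProbabilityMeasure (μ n)] :
    Tendsto (fun x : Σ n, Ω n × Ω' n => (⟨x.1, x.2.1⟩ : Σ n, Ω n)) (PF fun n => (μ n).prod (ν n)) (PF μ) := by
  intro A hA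
  rw [mem_map, mem_PF]
  rw [mem_PF] at hA
  refine hA.congr fun n => ?_
  have : {ω : Ω n × Ω' n | (⟨n, ω⟩ : Σ n, Ω n × Ω' n) ∉
      (fun x : Σ n, Ω n × Ω' n => (⟨x.1, x.2.1⟩ : Σ n, Ω n)) ⁻¹' A} = {ω | (⟨n, ω⟩ : Σ n, Ω n) ∉ A} ×ˢ Set.univ := by
    ext ω; simp
  rw [this, Measure.prod_prod, measure_univ, mul_one]
end


/-! ### Marchenko–Pastur algebra -/

theorem mp_disc {γ l : ℝ} (hγ : 0 < γ) (hl : 0 < l) : 0 < (1 - γ + l) ^ 2 + 4 * γ * l := by positivity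

theorem mp_sqrt {γ l : ℝ} (hγ : 0 < γ) (hl : 0 < l) :
    2 * γ * l * mpStieltjes γ l + (1 - γ + l) = Real.sqrt ((1 - γ + l) ^ 2 + 4 * γ * l) := by
  unfold mpStieltjes; field_simp; ring

theorem mp_quad {γ l : ℝ} (hγ : 0 < γ) (hl : 0 < l) :
    γ * l * mpStieltjes γ l ^ 2 + (1 - γ + l) * mpStieltjes γ l - 1 = 0 := by
  have h := mp_sqrt hγ hl
  have h2 := Real.sq_sqrt (mp_disc hγ hl).le
  rw [← h] at h2
  have : 4 * γ * l * (γ * l * mpStieltjes γ l ^ 2 + (1 - γ + l) * mpStieltjes γ l - 1) = 0 := by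
    linear_combination h2
  rcases mul_eq_zero.mp this with h3 | h3
  · exact absurd h3 (by positivity)
  · exact h3

theorem mp_pos {γ l : ℝ} (hγ : 0 < γ) (hl : 0 < l) : 0 < mpStieltjes γ l := by
  unfold mpStieltjes
  refine div_pos ?_ (by positivity)
  have : |1 - γ + l| < Real.sqrt ((1 - γ + l) ^ 2 + 4 * γ * l) := by
    rw [← Real.sqrt_sq_eq_abs]
    exact Real.sqrt_lt_sqrt (sq_nonneg _) (by nlinarith [mul_pos hγ hl])
  have := le_abs_self (1 - γ + l)
  linarith

theorem mp_fix {γ l : ℝ} (hγ : 0 < γ) (hl : 0 < l) :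
    mpStieltjes γ l * (l + 1 / (1 + γ * mpStieltjes γ l)) = 1 := by
  have h := mp_quad hγ hl
  have hg := mp_pos hγ hl
  have : 0 < 1 + γ * mpStieltjes γ l := by positivity
  field_simp
  linear_combination h

theorem mp_diff {γ l : ℝ} (hγ : 0 < γ) (hl : 0 < l) : DifferentiableAt ℝ (mpStieltjes γ) l := by
  have h := (mp_disc hγ hl).ne'
  have h2 : 2 * γ * l ≠ 0 := by positivity
  unfold mpStieltjes
  refine DifferentiableAt.div ?_ (by fun_prop) h2
  refine DifferentiableAt.add (by fun_prop) ?_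
  exact DifferentiableAt.sqrt (by fun_prop) h

theorem mp_deriv {γ l : ℝ} (hγ : 0 < γ) (hl : 0 < l) :
    -(deriv (mpStieltjes γ) l) * Real.sqrt ((1 - γ + l) ^ 2 + 4 * γ * l) =
      γ * mpStieltjes γ l ^ 2 + mpStieltjes γ l := by
  have hd := (mp_diff hγ hl).hasDerivAt
  have h1 : HasDerivAt (fun x => γ * x * mpStieltjes γ x ^ 2 + (1 - γ + x) * mpStieltjes γ x - 1)
      (γ * 1 * mpStieltjes γ l ^ 2 + γ * l * (((2 : ℕ) : ℝ) * mpStieltjes γ l ^ (2 - 1) * deriv (mpStieltjes γ) l) +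
        (1 * mpStieltjes γ l + (1 - γ + l) * deriv (mpStieltjes γ) l)) l :=
    ((((hasDerivAt_id l).const_mul γ).mul (hd.pow 2)).add
      (((hasDerivAt_id l).const_add (1 - γ)).mul hd)).sub_const 1
  have h2 : HasDerivAt (fun x => γ * x * mpStieltjes γ x ^ 2 + (1 - γ + x) * mpStieltjes γ x - 1) 0 l := by
    refine (hasDerivAt_const l (0 : ℝ)).congr_of_eventuallyEq ?_
    filter_upwards [lt_mem_nhds hl] with x hx
    exact mp_quad hγ hx
  have := h1.unique h2
  rw [← mp_sqrt hγ hl]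
  norm_num at this
  linear_combination -this

theorem mp_facts {γ l : ℝ} (hγ : 0 < γ) (hl : 0 < l) (g g' : ℝ) (hg : g = mpStieltjes γ l)
    (hg' : g' = -(deriv (mpStieltjes γ) l)) :
    0 < g ∧ 0 < g' ∧ g - l * g' = g' / (1 + g * γ) ^ 2 ∧ 0 ≤ 1 - 2 * l * g + l ^ 2 * g' := by
  have h0 := mp_pos hγ hl
  have h1 := mp_quad hγ hl
  have h2 := mp_deriv hγ hl
  rw [← mp_sqrt hγ hl] at h2
  have h3 := mp_sqrt hγ hl
  have h4 : 0 < Real.sqrt ((1 - γ + l) ^ 2 + 4 * γ * l) := Real.sqrt_pos.mpr (mp_disc hγ hl)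
  rw [← h3] at h4
  rw [← hg, ← hg'] at h2
  rw [← hg] at h0 h1 h4
  have p1 : 0 < g' := by
    by_contra hn
    have : g' * (2 * γ * l * g + (1 - γ + l)) ≤ 0 := mul_nonpos_of_nonpos_of_nonneg (not_lt.mp hn) h4.le
    have : 0 < γ * g ^ 2 + g := by positivity
    linarith
  have p0 : 0 < 1 + g * γ := by positivity
  have p2 : g - l * g' = g' / (1 + g * γ) ^ 2 := by
    rw [eq_div_iff (by positivity)]
    -- (1+γg)^2 (g - l g') = g'
    have key : g * ((g - l * g') * (1 + g * γ) ^ 2 - g') = 0 := by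
      have e1 : l * g * (1 + γ * g) = 1 + γ * g - g := by linear_combination h1
      have e2 : g' * ((1 + γ * g) ^ 2 - γ * g ^ 2) = g ^ 2 * (1 + γ * g) ^ 2 := by
        have := h2
        have e3 : (2 * γ * l * g + (1 - γ + l)) * g * (1 + γ * g) = (1 + γ * g) ^ 2 - γ * g ^ 2 := by
          linear_combination (2 * γ * g + 1) * e1
        rw [← e3]
        linear_combination (g * (1 + γ * g)) * h2
      linear_combination (-1 : ℝ) * e2 - g' * (1 + γ * g) * e1
    rcases mul_eq_zero.mp key with h | h
    · exact absurd h h0.ne'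
    · linarith
  refine ⟨h0, p1, p2, ?_⟩
  have e1 : l * g * (1 + γ * g) = 1 + γ * g - g := by linear_combination h1
  have e4 : g ^ 2 ≤ g' := by
    have e2 : g' * ((1 + γ * g) ^ 2 - γ * g ^ 2) = g ^ 2 * (1 + γ * g) ^ 2 := by
      have e3 : (2 * γ * l * g + (1 - γ + l)) * g * (1 + γ * g) = (1 + γ * g) ^ 2 - γ * g ^ 2 := by
        linear_combination (2 * γ * g + 1) * e1
      rw [← e3]
      linear_combination (g * (1 + γ * g)) * h2
    have : 0 ≤ γ * g ^ 2 * g' := by positivity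
    have p3 : 0 < (1 + γ * g) ^ 2 := by positivity
    nlinarith
  nlinarith [sq_nonneg (1 - l * g), sq_nonneg l, mul_nonneg (sq_nonneg l) (sub_nonneg.mpr e4)]

/-! ### Limits of the resolvent functionals -/

theorem looBound_tendsto {γ l : ℝ} (hl : 0 < l) (p : ℕ → ℕ)
    (hp : Tendsto (fun n => (p n : ℝ) / n) atTop (𝓝 γ)) :
    Tendsto (fun n : ℕ => (n : ℝ) * looBound (n * l) n (Real.sqrt n) (p n)) atTop (𝓝 0) := by
  have i1 : Tendsto (fun n : ℕ => (n : ℝ)⁻¹) atTop (𝓝 0) := tendsto_inv_atTop_nhds_zero_nat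
  have i2 : Tendsto (fun n : ℕ => (Real.sqrt n)⁻¹) atTop (𝓝 0) :=
    (Real.tendsto_sqrt_atTop.comp tendsto_natCast_atTop_atTop).inv_tendsto_atTop
  have lim : Tendsto (fun n : ℕ => ((l + 1) * 4 / l ^ 3 + 2 / l ^ 3) * (n : ℝ)⁻¹ + (1 + 1 / l) *
      (2 / l ^ 2 * (n : ℝ)⁻¹ + (3 / l ^ 2 * (Real.sqrt n)⁻¹ + 2 / l ^ 2 * ((p n : ℝ) / n) * (Real.sqrt n)⁻¹) / 2))
      atTop (𝓝 (((l + 1) * 4 / l ^ 3 + 2 / l ^ 3) * 0 + (1 + 1 / l) *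
      (2 / l ^ 2 * 0 + (3 / l ^ 2 * 0 + 2 / l ^ 2 * γ * 0) / 2))) :=
    (i1.const_mul _).add (((i1.const_mul _).add (((i2.const_mul _).add ((hp.const_mul _).mul i2)).div_const _)).const_mul _)
  simp only [mul_zero, add_zero, zero_div] at lim
  refine lim.congr' ?_
  filter_upwards [eventually_gt_atTop 0] with n hn
  have hn' : (0 : ℝ) < n := Nat.cast_pos.mpr hn
  obtain ⟨s, hs, e⟩ : ∃ s : ℝ, 0 < s ∧ (n : ℝ) = s ^ 2 :=
    ⟨Real.sqrt n, Real.sqrt_pos.mpr hn', (Real.sq_sqrt hn'.le).symm⟩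
  rw [e, Real.sqrt_sq hs.le]
  unfold looBound
  field_simp

noncomputable abbrev GM (p : ℕ → ℕ) : ∀ n : ℕ, Measure (Fin n → Fin (p n) → ℝ) := fun n => stdGaussianMatrix n (p n)

theorem trace_lim {γ l : ℝ} (hγ : 0 < γ) (hl : 0 < l) (p : ℕ → ℕ) (hpos : ∀ n, 0 < p n)
    (hp : Tendsto (fun n => (p n : ℝ) / n) atTop (𝓝 γ)) :
    Tendsto (fun x : Σ n : ℕ, Fin n → Fin (p n) → ℝ => (Rm (x.1 * l) x.2).trace) (PF (GM p))
      (𝓝 (γ * mpStieltjes γ l)) := by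
  have h1 := PF_sq (μ := GM p) (fun n Z => n * l * ((Rm (n * l) Z).trace / p n) - 1 +
    n * ((Rm (n * l) Z).trace / p n) / (1 + (Rm (n * l) Z).trace)) _ (looBound_tendsto hl p hp) (by
      filter_upwards [eventually_gt_atTop 0] with n hn
      have hn' : (0 : ℝ) < n := Nat.cast_pos.mpr hn
      exact trPsi_sq (by positivity) (Real.sqrt_pos.mpr hn') (hpos n))
  have h2 := h1.mul (hp.comp (PF_fst (μ := GM p)))
  rw [zero_mul] at h2
  have h3 := h2.add (hp.comp (PF_fst (μ := GM p)))
  rw [zero_add] at h3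
  have ev : ∀ᶠ x in PF (GM p), 0 < x.1 := PF_fst.eventually (eventually_gt_atTop 0)
  set g := mpStieltjes γ l
  have hg0 : 0 < g := mp_pos hγ hl
  have hfix : g * (l + 1 / (1 + γ * g)) = 1 := mp_fix hγ hl
  have h4 := (h3.sub_const γ).norm.div_const l
  simp only [sub_self, norm_zero, zero_div] at h4
  rw [tendsto_iff_norm_sub_tendsto_zero]
  refine tendsto_of_tendsto_of_tendsto_of_le_of_le' tendsto_const_nhds h4
    (Eventually.of_forall fun _ => norm_nonneg _) ?_
  filter_upwards [ev] with x hx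
  obtain ⟨n, Z⟩ := x
  have hn' : (0 : ℝ) < n := Nat.cast_pos.mpr hx
  have hp' : (0 : ℝ) < p n := Nat.cast_pos.mpr (hpos n)
  have hT := (res_Gm (by positivity : (0 : ℝ) < n * l) Z).trace_nonneg
  simp only [Function.comp]
  set T := (Rm (n * l) Z).trace
  have e : (n * l * (T / p n) - 1 + n * (T / p n) / (1 + T)) * ((p n : ℝ) / n) + (p n : ℝ) / n - γ =
     (l + 1 / ((1 + T) * (1 + γ * g))) * (T - γ * g) := by
    have e2 : γ = γ * (g * (l + 1 / (1 + γ * g))) := by rw [hfix, mul_one]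
    have e3 : (n * l * (T / p n) - 1 + n * (T / p n) / (1 + T)) * ((p n : ℝ) / n) + (p n : ℝ) / n =
      l * T + T / (1 + T) := by field_simp; ring
    have : 0 < 1 + γ * g := by positivity
    rw [e3]
    calc l * T + T / (1 + T) - γ = l * T + T / (1 + T) - γ * (g * (l + 1 / (1 + γ * g))) := by rw [← e2]
      _ = _ := by field_simp; ring
  rw [e, le_div_iff₀ hl, norm_mul, mul_comm]
  refine mul_le_mul_of_nonneg_right ?_ (norm_nonneg _)
  refine le_trans ?_ (le_abs_self _)
  have : 0 ≤ 1 / ((1 + T) * (1 + γ * g)) := by positivity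
  linarith

theorem q_lim {γ l : ℝ} (hγ : 0 < γ) (hl : 0 < l) (p : ℕ → ℕ) (hpos : ∀ n, 0 < p n)
    (hp : Tendsto (fun n => (p n : ℝ) / n) atTop (𝓝 γ)) (u : ∀ n, Fin (p n) → ℝ)
    (hu : ∀ᶠ n in atTop, u n ⬝ᵥ u n = 1) :
    Tendsto (fun x : Σ n : ℕ, Fin n → Fin (p n) → ℝ => x.1 * (u x.1 ⬝ᵥ Rm (x.1 * l) x.2 *ᵥ u x.1))
      (PF (GM p)) (𝓝 (mpStieltjes γ l)) := by
  have h1 := PF_sq (μ := GM p) (fun n Z => Psi (n * l) n (u n) (Rm (n * l) Z)) _ (looBound_tendsto hl p hp) (by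
      filter_upwards [eventually_gt_atTop 0, hu] with n hn hun
      have hn' : (0 : ℝ) < n := Nat.cast_pos.mpr hn
      exact ⟨integrable_Psi_sq (by positivity) hn'.le _ hun,
        Psi_sq (by positivity) (Real.sqrt_pos.mpr hn') _ hun⟩)
  have hT := trace_lim hγ hl p hpos hp
  set g := mpStieltjes γ l
  have hg0 : 0 < g := mp_pos hγ hl
  have hfix : g * (l + 1 / (1 + γ * g)) = 1 := mp_fix hγ hl
  have p1 : 0 < 1 + γ * g := by positivity
  have h2 := (h1.add_const 1).div (((hT.const_add 1).inv₀ p1.ne').const_add l) (by positivity)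
  have e : (0 + 1) / (l + (1 + γ * g)⁻¹) = g := by
    rw [← one_div (1 + γ * g), div_eq_iff (by positivity), hfix, zero_add]
  rw [e] at h2
  refine h2.congr' ?_
  filter_upwards [PF_fst.eventually (eventually_gt_atTop 0)] with x hx
  obtain ⟨n, Z⟩ := x
  have hn' : (0 : ℝ) < n := Nat.cast_pos.mpr hx
  have hT := (res_Gm (by positivity : (0 : ℝ) < n * l) Z).trace_nonneg
  simp only [Pi.div_apply, Psi]
  rw [div_eq_iff (by positivity)]
  field_simp
  ring

theorem resolvent_bound {p : ℕ} {c k : ℝ} {M M' R R' : Matrix (Fin p) (Fin p) ℝ} (h : Res c M R)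
    (h' : Res c M' R') (hM : M' = M + k • 1) (hk : 0 < k) (u : Fin p → ℝ) (hu : u ⬝ᵥ u = 1) :
    |(R *ᵥ u) ⬝ᵥ (R *ᵥ u) - (u ⬝ᵥ R *ᵥ u - u ⬝ᵥ R' *ᵥ u) / k| ≤ k / c ^ 3 := by
  have hc := h.pos
  have e1 : R *ᵥ u = R' *ᵥ u + k • R *ᵥ (R' *ᵥ u) := by
    have := congrArg (fun v => R *ᵥ v) (h'.MR u)
    simp only [hM] at this
    rw [add_mulVec, smul_mulVec, one_mulVec, mulVec_add, h.RM, mulVec_smul] at this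
    exact this.symm
  have e2 : (u ⬝ᵥ R *ᵥ u - u ⬝ᵥ R' *ᵥ u) / k = (R *ᵥ u) ⬝ᵥ (R' *ᵥ u) := by
    have : u ⬝ᵥ R *ᵥ u = u ⬝ᵥ R' *ᵥ u + k * ((R *ᵥ u) ⬝ᵥ (R' *ᵥ u)) := by
      conv_lhs => rw [e1]
      rw [dotProduct_add, dotProduct_smul, h.dot_comm, smul_eq_mul]
    rw [this]; field_simp; ring
  have e3 : (R *ᵥ u) ⬝ᵥ (R *ᵥ u) - (R *ᵥ u) ⬝ᵥ (R' *ᵥ u) = k * ((R *ᵥ u) ⬝ᵥ (R *ᵥ (R' *ᵥ u))) := by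
    conv_lhs => rw [show (R *ᵥ u) ⬝ᵥ (R *ᵥ u) = (R *ᵥ u) ⬝ᵥ (R' *ᵥ u + k • R *ᵥ (R' *ᵥ u)) by rw [← e1]]
    rw [dotProduct_add, dotProduct_smul, smul_eq_mul]; ring
  rw [e2, e3, abs_mul, abs_of_pos hk, div_eq_mul_one_div]
  refine mul_le_mul_of_nonneg_left ?_ hk.le
  apply abs_le_of_sq_le_sq _ (by positivity)
  have b1 := h.normR_le' u
  have b2 := h'.normR_le' u
  have b3 := h.normR_le' (R' *ᵥ u)
  have b4 := Res.cs (R *ᵥ u) (R *ᵥ (R' *ᵥ u))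
  rw [hu] at b1 b2
  calc _ ≤ _ := b4
    _ ≤ (1 / c ^ 2) * ((1 / c ^ 2) / c ^ 2) := by
      refine mul_le_mul b1 (b3.trans (by gcongr)) (Res.dot_self_nonneg _) (by positivity)
    _ = _ := by field_simp

theorem q2_lim {γ l : ℝ} (hγ : 0 < γ) (hl : 0 < l) (p : ℕ → ℕ) (hpos : ∀ n, 0 < p n)
    (hp : Tendsto (fun n => (p n : ℝ) / n) atTop (𝓝 γ)) (u : ∀ n, Fin (p n) → ℝ)
    (hu : ∀ᶠ n in atTop, u n ⬝ᵥ u n = 1) :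
    Tendsto (fun x : Σ n : ℕ, Fin n → Fin (p n) → ℝ =>
      (x.1 : ℝ) ^ 2 * ((Rm (x.1 * l) x.2 *ᵥ u x.1) ⬝ᵥ (Rm (x.1 * l) x.2 *ᵥ u x.1)))
      (PF (GM p)) (𝓝 (-(deriv (mpStieltjes γ) l))) := by
  rw [Metric.tendsto_nhds]
  intro ε hε
  have hd := (mp_diff hγ hl).hasDerivAt.tendsto_slope_zero_right
  rw [Metric.tendsto_nhds] at hd
  have hd1 := hd (ε / 3) (by linarith)
  have hd2 : ∀ᶠ t : ℝ in 𝓝[>] 0, t / l ^ 3 < ε / 3 := by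
    have : Tendsto (fun t : ℝ => t / l ^ 3) (𝓝[>] 0) (𝓝 (0 / l ^ 3)) :=
      (tendsto_id.div_const _).mono_left nhdsWithin_le_nhds
    rw [zero_div] at this
    exact (tendsto_order.1 this).2 _ (by linarith)
  obtain ⟨h, ⟨h1, h2⟩, h0⟩ := ((hd1.and hd2).and self_mem_nhdsWithin).exists
  have h0 : 0 < h := h0
  have t1 := q_lim hγ hl p hpos hp u hu
  have t2 := q_lim (l := l + h) hγ (by linarith) p hpos hp u hu
  have t3 := (t1.sub t2).div_const h
  rw [Metric.tendsto_nhds] at t3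
  filter_upwards [t3 (ε / 3) (by linarith), PF_fst.eventually (eventually_gt_atTop 0),
    PF_fst.eventually hu] with x hx hx0 hux
  obtain ⟨n, Z⟩ := x
  have hn' : (0 : ℝ) < n := Nat.cast_pos.mpr hx0
  have r1 := res_Gm (by positivity : (0 : ℝ) < n * l) Z
  have r2 := res_Gm (by positivity : (0 : ℝ) < n * (l + h)) Z
  have r3 : Res (n * l) (Gm (n * (l + h)) Z) (Rm (n * (l + h)) Z) := by
    refine ⟨r1.pos, r2.sym, r2.mul, fun y => le_trans ?_ (r2.lb y)⟩
    refine mul_le_mul_of_nonneg_right ?_ (Res.dot_self_nonneg _)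
    nlinarith
  have b := resolvent_bound r1 r3 (k := n * h) (by
    unfold Gm; rw [add_assoc, ← add_smul]; ring_nf) (by positivity) (u n) hux
  simp only [Real.dist_eq] at hx h1 ⊢ hux
  set Q := (Rm (n * l) Z *ᵥ u n) ⬝ᵥ (Rm (n * l) Z *ᵥ u n)
  set q1 := u n ⬝ᵥ Rm (n * l) Z *ᵥ u n
  set q2 := u n ⬝ᵥ Rm (n * (l + h)) Z *ᵥ u n
  have b' : |(n : ℝ) ^ 2 * Q - (n * q1 - n * q2) / h| ≤ h / l ^ 3 := by
    have e : (n : ℝ) ^ 2 * Q - (n * q1 - n * q2) / h = n ^ 2 * (Q - (q1 - q2) / (n * h)) := by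
      field_simp
    rw [e, abs_mul, abs_of_nonneg (by positivity : (0 : ℝ) ≤ (n : ℝ) ^ 2)]
    calc (n : ℝ) ^ 2 * |Q - (q1 - q2) / (n * h)| ≤ n ^ 2 * (n * h / (n * l) ^ 3) := by gcongr
      _ = _ := by field_simp
  rw [smul_eq_mul] at h1
  have f : (n : ℝ) ^ 2 * Q - -(deriv (mpStieltjes γ) l) = ((n : ℝ) ^ 2 * Q - (n * q1 - n * q2) / h) +
     ((n * q1 - n * q2) / h - (mpStieltjes γ l - mpStieltjes γ (l + h)) / h) -
     (h⁻¹ * (mpStieltjes γ (l + h) - mpStieltjes γ l) - deriv (mpStieltjes γ) l) := by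
    field_simp; ring
  rw [f]
  have c1 := abs_sub (((n : ℝ) ^ 2 * Q - (n * q1 - n * q2) / h) +
     ((n * q1 - n * q2) / h - (mpStieltjes γ l - mpStieltjes γ (l + h)) / h))
     (h⁻¹ * (mpStieltjes γ (l + h) - mpStieltjes γ l) - deriv (mpStieltjes γ) l)
  have c2 := abs_add_le ((n : ℝ) ^ 2 * Q - (n * q1 - n * q2) / h)
     ((n * q1 - n * q2) / h - (mpStieltjes γ l - mpStieltjes γ (l + h)) / h)
  linarith


/-! ### Conditional Gaussianity of the prediction -/

/-- The dual coefficient vector `a = Z R x`. -/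
noncomputable def av {n p : ℕ} (c : ℝ) (x : Fin p → ℝ) (Z : Fin n → Fin p → ℝ) : Fin n → ℝ :=
  fun i => Z i ⬝ᵥ Rm c Z *ᵥ x

theorem av_sq {n p : ℕ} {c : ℝ} (hc : 0 < c) (x : Fin p → ℝ) (Z : Fin n → Fin p → ℝ) :
    av c x Z ⬝ᵥ av c x Z = x ⬝ᵥ Rm c Z *ᵥ x - c * ((Rm c Z *ᵥ x) ⬝ᵥ (Rm c Z *ᵥ x)) := by
  have h := res_Gm hc Z
  have e := congrArg (fun v => (Rm c Z *ᵥ x) ⬝ᵥ v) (h.MR x)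
  simp only [Gm_mulVec, dotProduct_add, dotProduct_smul, smul_eq_mul, dotProduct_sum] at e
  rw [dotProduct_comm _ x] at e
  rw [← e]
  simp only [dotProduct_comm (Rm c Z *ᵥ x) (Z _), add_sub_cancel_right]
  rfl

theorem av_back {n p : ℕ} {c : ℝ} (hc : 0 < c) (x : Fin p → ℝ) (Z : Fin n → Fin p → ℝ) :
    ∑ j, (∑ i, av c x Z i * Z i j) ^ 2 =
      x ⬝ᵥ x - 2 * c * (x ⬝ᵥ Rm c Z *ᵥ x) + c ^ 2 * ((Rm c Z *ᵥ x) ⬝ᵥ (Rm c Z *ᵥ x)) := by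
  have h := res_Gm hc Z
  have e := h.MR x
  rw [Gm_mulVec] at e
  have e2 : ∀ j, ∑ i, av c x Z i * Z i j = (x - c • Rm c Z *ᵥ x) j := by
    intro j
    have := congrFun e j
    simp only [Pi.add_apply, Finset.sum_apply, Pi.smul_apply, smul_eq_mul] at this
    simp only [av, Pi.sub_apply, Pi.smul_apply, smul_eq_mul]
    linarith
  simp only [e2]
  have : ∑ j, (x - c • Rm c Z *ᵥ x) j ^ 2 = (x - c • Rm c Z *ᵥ x) ⬝ᵥ (x - c • Rm c Z *ᵥ x) := by
    simp [dotProduct, sq]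
  rw [this]
  simp only [sub_dotProduct, dotProduct_sub, smul_dotProduct, dotProduct_smul, smul_eq_mul]
  rw [dotProduct_comm (Rm c Z *ᵥ x) x]
  ring

theorem continuous_av {n p : ℕ} {c : ℝ} (hc : 0 < c) (x : Fin p → ℝ) :
    Continuous fun Z : Fin n → Fin p → ℝ => av c x Z := by
  unfold av
  refine continuous_pi fun i => ?_
  exact Continuous.dotProduct (continuous_apply i) ((continuous_Rm hc).matrix_mulVec continuous_const)

/-- `Z`-part of `X`. -/
def Zof {n p D : ℕ} (hpD : p ≤ D) (X : Fin n → Fin D → ℝ) : Fin n → Fin p → ℝ :=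
  fun i j => X i (Fin.castLE hpD j)

theorem firstCols_gram {n p D : ℕ} (hpD : p ≤ D) (X : Fin n → Fin D → ℝ) (c : ℝ) :
    (firstCols n p D hpD X)ᵀ * firstCols n p D hpD X + c • 1 = Gm c (Zof hpD X) := by
  unfold Gm
  congr 1
  ext j k
  simp [firstCols, Zof, mul_apply, Matrix.sum_apply, vecMulVec_apply]

theorem pred_eq {n p D : ℕ} (hpD : p ≤ D) (σ lam : ℝ) (hc : 0 < (n : ℝ) * lam) (x₀ : Fin D → ℝ)
    (X : Fin n → Fin D → ℝ) (b : Fin D → ℝ) (e : Fin n → ℝ) (x : Fin p → ℝ)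
    (hx : ∀ j, x j = x₀ (Fin.castLE hpD j)) :
    ridgePrediction σ lam n p D hpD x₀ (X, b, e) =
      (fun jd => (∑ i, av (n * lam) x (Zof hpD X) i * X i jd) / √D) ⬝ᵥ b +
      (σ • av (n * lam) x (Zof hpD X)) ⬝ᵥ e := by
  have h := res_Gm hc (Zof hpD X)
  unfold ridgePrediction
  simp only [firstCols_gram, ← hx]
  change x ⬝ᵥ Rm (n * lam) (Zof hpD X) *ᵥ _ = _
  rw [h.dot_comm]
  have e1 : ∀ y : Fin n → ℝ, (Rm (n * lam) (Zof hpD X) *ᵥ x) ⬝ᵥ ((firstCols n p D hpD X)ᵀ *ᵥ y) =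
      ∑ i, av (n * lam) x (Zof hpD X) i * y i := by
    intro y
    rw [dotProduct_mulVec, vecMul_transpose]
    rfl
  rw [e1]
  simp only [mul_add, Finset.sum_add_distrib]
  congr 1
  · simp only [Finset.mul_sum, dotProduct, coeffs, Finset.sum_div, Finset.sum_mul]
    rw [Finset.sum_comm]
    refine Finset.sum_congr rfl fun j _ => Finset.sum_congr rfl fun i _ => ?_
    ring
  · simp only [dotProduct, Pi.smul_apply, smul_eq_mul]
    refine Finset.sum_congr rfl fun i _ => ?_
    ring

/-- Gaussian smoothing `t ↦ E f(tξ)`. -/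
noncomputable def Hf (f : BoundedContinuousFunction ℝ ℝ) (t : ℝ) : ℝ := ∫ x, f (t * x) ∂(gaussianReal 0 1)

theorem Hf_bound (f : BoundedContinuousFunction ℝ ℝ) (t : ℝ) : |Hf f t| ≤ ‖f‖ := by
  have := norm_integral_le_of_norm_le_const (μ := gaussianReal 0 1) (f := fun x => f (t * x)) (C := ‖f‖)
    (ae_of_all _ fun x => f.norm_coe_le_norm _)
  simpa [Hf] using this

theorem Hf_cont (f : BoundedContinuousFunction ℝ ℝ) : Continuous (Hf f) := by
  unfold Hf
  refine continuous_of_dominated (bound := fun _ => ‖f‖) ?_ ?_ (integrable_const _) ?_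
  · intro t
    exact (f.continuous.comp (continuous_const.mul continuous_id)).aestronglyMeasurable
  · intro t
    exact ae_of_all _ fun x => f.norm_coe_le_norm _
  · refine ae_of_all _ fun x => ?_
    exact f.continuous.comp (continuous_id.mul continuous_const)

/-- Conditional variance given `X`. -/
noncomputable def VX {n p D : ℕ} (hpD : p ≤ D) (σ c : ℝ) (x : Fin p → ℝ) (X : Fin n → Fin D → ℝ) : ℝ :=
  (∑ jd, (∑ i, av c x (Zof hpD X) i * X i jd) ^ 2) / D + σ ^ 2 * (av c x (Zof hpD X) ⬝ᵥ av c x (Zof hpD X))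

theorem continuous_Zof {n p D : ℕ} (hpD : p ≤ D) : Continuous fun X : Fin n → Fin D → ℝ => Zof hpD X := by
  unfold Zof; fun_prop

theorem reduce_X {n p D : ℕ} (hpD : p ≤ D) (σ lam : ℝ) (hc : 0 < (n : ℝ) * lam) (x₀ : Fin D → ℝ)
    (x : Fin p → ℝ) (hx : ∀ j, x j = x₀ (Fin.castLE hpD j)) (f : BoundedContinuousFunction ℝ ℝ) (s : ℝ) :
    Continuous (fun X : Fin n → Fin D → ℝ => Hf f (√(VX hpD σ (n * lam) x X) / s)) ∧
    ∫ ω, f (ridgePrediction σ lam n p D hpD x₀ ω / s)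
      ∂((stdGaussianMatrix n D).prod ((stdGaussianVec D).prod (stdGaussianVec n))) =
    ∫ X, Hf f (√(VX hpD σ (n * lam) x X) / s) ∂(stdGaussianMatrix n D) := by
  have ca := (continuous_av hc x).comp (continuous_Zof (n := n) hpD)
  have cai : ∀ i, Continuous fun X : Fin n → Fin D → ℝ => av (n * lam) x (Zof hpD X) i :=
    fun i => (continuous_apply i).comp ca
  have cX : ∀ i j, Continuous fun X : Fin n → Fin D → ℝ => X i j := fun i j => by fun_prop
  have cs : ∀ j, Continuous fun X : Fin n → Fin D → ℝ => ∑ i, av (n * lam) x (Zof hpD X) i * X i j :=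
    fun j => continuous_finsetSum _ fun i _ => (cai i).mul (cX i j)
  have cV : Continuous fun X : Fin n → Fin D → ℝ => VX hpD σ (n * lam) x X := by
    unfold VX
    refine ((continuous_finsetSum _ fun j _ => (cs j).pow 2).div_const _).add (continuous_const.mul ?_)
    exact Continuous.dotProduct ca ca
  refine ⟨(Hf_cont f).comp (cV.sqrt.div_const s), ?_⟩
  have cP : Continuous fun ω : (Fin n → Fin D → ℝ) × (Fin D → ℝ) × (Fin n → ℝ) =>
      ridgePrediction σ lam n p D hpD x₀ ω := by
    have : (fun ω : (Fin n → Fin D → ℝ) × (Fin D → ℝ) × (Fin n → ℝ) =>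
      ridgePrediction σ lam n p D hpD x₀ ω) = fun ω =>
      (fun jd => (∑ i, av (n * lam) x (Zof hpD ω.1) i * ω.1 i jd) / √D) ⬝ᵥ ω.2.1 +
      (σ • av (n * lam) x (Zof hpD ω.1)) ⬝ᵥ ω.2.2 := by
      ext ω
      exact pred_eq hpD σ lam hc x₀ ω.1 ω.2.1 ω.2.2 x hx
    rw [this]
    refine (Continuous.dotProduct ?_ (by fun_prop)).add (Continuous.dotProduct ?_ (by fun_prop))
    · exact continuous_pi fun j => ((cs j).comp continuous_fst).div_const _
    · exact (ca.comp continuous_fst).const_smul σ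
  have I : Integrable (fun ω => f (ridgePrediction σ lam n p D hpD x₀ ω / s))
      ((stdGaussianMatrix n D).prod ((stdGaussianVec D).prod (stdGaussianVec n))) := by
    refine Integrable.mono' (integrable_const ‖f‖) ?_ (ae_of_all _ fun _ => f.norm_coe_le_norm _)
    exact (f.continuous.comp (cP.div_const s)).aestronglyMeasurable
  rw [integral_prod _ I]
  refine integral_congr_ae (ae_of_all _ fun X => ?_)
  simp only [pred_eq hpD σ lam hc x₀ X _ _ x hx]
  have G := (gl_vec (fun jd => (∑ i, av (n * lam) x (Zof hpD X) i * X i jd) / √D)).add_prod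
    (gl_vec (σ • av (n * lam) x (Zof hpD X)))
  have G2 := G.integral_comp (f := fun t => f (t / s))
    (f.continuous.comp (continuous_id.div_const s)).measurable
  refine G2.trans ?_
  unfold Hf
  have eV : (fun jd => (∑ i, av (n * lam) x (Zof hpD X) i * X i jd) / √D) ⬝ᵥ
      (fun jd => (∑ i, av (n * lam) x (Zof hpD X) i * X i jd) / √D) +
      (σ • av (n * lam) x (Zof hpD X)) ⬝ᵥ (σ • av (n * lam) x (Zof hpD X)) = VX hpD σ (n * lam) x X := by
    unfold VX
    rw [smul_dotProduct, dotProduct_smul, smul_eq_mul, smul_eq_mul, ← mul_assoc, ← sq, dotProduct, Finset.sum_div]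
    congr 1
    refine Finset.sum_congr rfl fun j _ => ?_
    rw [← sq, div_pow, Real.sq_sqrt (Nat.cast_nonneg _)]
  rw [eV]
  refine integral_congr_ae (ae_of_all _ fun t => ?_)
  simp only
  congr 1
  ring

theorem vec_append (p q : ℕ) : MeasurePreserving (fun w : (Fin p → ℝ) × (Fin q → ℝ) => Fin.append w.1 w.2)
    ((stdGaussianVec p).prod (stdGaussianVec q)) (stdGaussianVec (p + q)) := by
  have m : Measurable (fun w : (Fin p → ℝ) × (Fin q → ℝ) => Fin.append w.1 w.2) := by
    refine measurable_pi_iff.mpr fun j => ?_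
    refine Fin.addCases (fun j => ?_) (fun j => ?_) j
    · simp only [Fin.append_left]; fun_prop
    · simp only [Fin.append_right]; fun_prop
  refine ⟨m, ?_⟩
  unfold stdGaussianVec
  refine (Measure.pi_eq fun s hs => ?_).symm
  rw [Measure.map_apply m (MeasurableSet.univ_pi hs)]
  have : (fun w : (Fin p → ℝ) × (Fin q → ℝ) => Fin.append w.1 w.2) ⁻¹' Set.univ.pi s =
      (Set.univ.pi fun j => s (Fin.castAdd q j)) ×ˢ (Set.univ.pi fun j => s (Fin.natAdd p j)) := by
    ext w
    simp only [Set.mem_preimage, Set.mem_pi, Set.mem_univ, true_implies, Set.mem_prod]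
    constructor
    · intro h
      exact ⟨fun j => by simpa using h (Fin.castAdd q j), fun j => by simpa using h (Fin.natAdd p j)⟩
    · rintro ⟨h1, h2⟩ j
      refine Fin.addCases (fun j => ?_) (fun j => ?_) j
      · simpa using h1 j
      · simpa using h2 j
  rw [this, Measure.prod_prod, Measure.pi_pi, Measure.pi_pi, Fin.prod_univ_add]

theorem mat_append (n p q : ℕ) : MeasurePreserving
    (fun w : (Fin n → Fin p → ℝ) × (Fin n → Fin q → ℝ) => fun i => Fin.append (w.1 i) (w.2 i))
    ((stdGaussianMatrix n p).prod (stdGaussianMatrix n q)) (stdGaussianMatrix n (p + q)) := by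
  have h1 := (measurePreserving_arrowProdEquivProdArrow (Fin p → ℝ) (Fin q → ℝ) (Fin n)
    (fun _ => stdGaussianVec p) (fun _ => stdGaussianVec q)).symm
  have h2 := measurePreserving_pi (fun _ : Fin n => (stdGaussianVec p).prod (stdGaussianVec q))
    (fun _ : Fin n => stdGaussianVec (p + q)) (fun _ => vec_append p q)
  exact h2.comp h1

/-- Conditional variance in terms of the two blocks. -/
noncomputable def VV {n p q : ℕ} (σ c D : ℝ) (x : Fin p → ℝ) (w : (Fin n → Fin p → ℝ) × (Fin n → Fin q → ℝ)) : ℝ :=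
  ((∑ j, (∑ i, av c x w.1 i * w.1 i j) ^ 2) + ∑ k, (∑ i, av c x w.1 i * w.2 i k) ^ 2) / D +
    σ ^ 2 * (av c x w.1 ⬝ᵥ av c x w.1)

theorem reduce_ZW {n p q D : ℕ} (hpD : p ≤ D) (hD : D = p + q) (σ lam : ℝ) (hc : 0 < (n : ℝ) * lam)
    (x₀ : Fin D → ℝ)
    (x : Fin p → ℝ) (hx : ∀ j, x j = x₀ (Fin.castLE hpD j)) (f : BoundedContinuousFunction ℝ ℝ) (s : ℝ) :
    Measurable (fun w : (Fin n → Fin p → ℝ) × (Fin n → Fin q → ℝ) =>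
      Hf f (√(VV σ (n * lam) D x w) / s)) ∧
    ∫ ω, f (ridgePrediction σ lam n p D hpD x₀ ω / s)
      ∂((stdGaussianMatrix n D).prod ((stdGaussianVec D).prod (stdGaussianVec n))) =
    ∫ w, Hf f (√(VV σ (n * lam) D x w) / s) ∂((stdGaussianMatrix n p).prod (stdGaussianMatrix n q)) := by
  subst hD
  obtain ⟨h1, h2⟩ := reduce_X hpD σ lam hc x₀ x hx f s
  have mp := mat_append n p q
  have e : ∀ w : (Fin n → Fin p → ℝ) × (Fin n → Fin q → ℝ),
      VX hpD σ (n * lam) x (fun i => Fin.append (w.1 i) (w.2 i)) = VV σ (n * lam) ((p + q : ℕ) : ℝ) x w := by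
    intro w
    have : Zof hpD (fun i => Fin.append (w.1 i) (w.2 i)) = w.1 := by
      ext i j
      exact Fin.append_left _ _ j
    unfold VX VV
    rw [this, Fin.sum_univ_add]
    simp
  constructor
  · have := h1.measurable.comp mp.measurable
    simpa only [Function.comp_def, e] using this
  · rw [h2, ← mp.map_eq, integral_map mp.measurable.aemeasurable h1.aestronglyMeasurable]
    simp only [e]

theorem W_quad {n q : ℕ} (a : Fin n → ℝ) :
    Integrable (fun W : Fin n → Fin q → ℝ => (∑ k, (∑ i, a i * W i k) ^ 2 - q * (a ⬝ᵥ a)) ^ 2)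
      (stdGaussianMatrix n q) ∧
    ∫ W, (∑ k, (∑ i, a i * W i k) ^ 2 - q * (a ⬝ᵥ a)) ^ 2 ∂(stdGaussianMatrix n q) =
      2 * (q * (a ⬝ᵥ a) ^ 2) := by
  have := quad_var (μ := stdGaussianMatrix n q)
    (fun (k : Fin q) (W : Fin n → Fin q → ℝ) => ∑ i, (Pi.single k (a i) : Fin q → ℝ) ⬝ᵥ W i)
    (fun k l => ∑ i, (Pi.single k (a i) : Fin q → ℝ) ⬝ᵥ (Pi.single l (a i))) 
    (fun k l => gp_mat _ _)
  have e : ∀ k l : Fin q, ∑ i, (Pi.single k (a i) : Fin q → ℝ) ⬝ᵥ (Pi.single l (a i)) =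
    if k = l then a ⬝ᵥ a else 0 := by
    intro k l
    by_cases h : k = l
    · subst h; simp only [single_dotProduct, Pi.single_eq_same, if_true]; rfl
    · simp [h]
  simp only [e] at this
  simp only [single_dotProduct] at this
  simpa using this

theorem W_part {n p q : ℕ} {c D K : ℝ} (hc : 0 < c) (hD : 0 < D) (x : Fin p → ℝ)
    (hK : x ⬝ᵥ x / c ≤ K) :
    Integrable (fun w : (Fin n → Fin p → ℝ) × (Fin n → Fin q → ℝ) =>
      ((∑ k, (∑ i, av c x w.1 i * w.2 i k) ^ 2) / D - q / D * (av c x w.1 ⬝ᵥ av c x w.1)) ^ 2)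
      ((stdGaussianMatrix n p).prod (stdGaussianMatrix n q)) ∧
    ∫ w, ((∑ k, (∑ i, av c x w.1 i * w.2 i k) ^ 2) / D - q / D * (av c x w.1 ⬝ᵥ av c x w.1)) ^ 2
      ∂((stdGaussianMatrix n p).prod (stdGaussianMatrix n q)) ≤ 2 * q * K ^ 2 / D ^ 2 := by
  have e0 : ∀ (a : Fin n → ℝ) (W : Fin n → Fin q → ℝ),
     ((∑ k, (∑ i, a i * W i k) ^ 2) / D - q / D * (a ⬝ᵥ a)) ^ 2 =
      1 / D ^ 2 * (∑ k, (∑ i, a i * W i k) ^ 2 - q * (a ⬝ᵥ a)) ^ 2 := by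
    intro a W; field_simp
  have bd : ∀ Z : Fin n → Fin p → ℝ, av c x Z ⬝ᵥ av c x Z ≤ K := by
    intro Z
    have h := res_Gm hc Z
    rw [av_sq hc]
    have := h.q_le x
    have := mul_nonneg hc.le (Res.dot_self_nonneg (Rm c Z *ᵥ x))
    linarith
  have e1 : ∀ Z : Fin n → Fin p → ℝ, ∫ W : Fin n → Fin q → ℝ, ((∑ k, (∑ i, av c x Z i * W i k) ^ 2) / D -
      q / D * (av c x Z ⬝ᵥ av c x Z)) ^ 2 ∂(stdGaussianMatrix n q) =
      1 / D ^ 2 * (2 * (q * (av c x Z ⬝ᵥ av c x Z) ^ 2)) := by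
    intro Z
    simp_rw [e0]
    rw [integral_const_mul, (W_quad _).2]
  have b1 : ∀ Z : Fin n → Fin p → ℝ, 1 / D ^ 2 * (2 * (q * (av c x Z ⬝ᵥ av c x Z) ^ 2)) ≤
      2 * q * K ^ 2 / D ^ 2 := by
    intro Z
    have := Res.dot_self_nonneg (av c x Z)
    calc _ ≤ 1 / D ^ 2 * (2 * (q * K ^ 2)) := by gcongr; exact bd Z
      _ = _ := by ring
  have ca := continuous_av (n := n) hc x
  have ca1 : Continuous fun w : (Fin n → Fin p → ℝ) × (Fin n → Fin q → ℝ) => av c x w.1 :=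
    ca.comp continuous_fst
  have cI : Continuous fun Z : Fin n → Fin p → ℝ => 1 / D ^ 2 * (2 * (q * (av c x Z ⬝ᵥ av c x Z) ^ 2)) := by
    have := Continuous.dotProduct ca ca
    fun_prop
  have I1 : Integrable (fun Z : Fin n → Fin p → ℝ => 1 / D ^ 2 * (2 * (q * (av c x Z ⬝ᵥ av c x Z) ^ 2)))
      (stdGaussianMatrix n p) := by
    refine Integrable.mono' (integrable_const (2 * q * K ^ 2 / D ^ 2)) cI.aestronglyMeasurable
      (ae_of_all _ fun Z => ?_)
    rw [Real.norm_eq_abs, abs_of_nonneg (by positivity)]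
    exact b1 Z
  have I : Integrable (fun w : (Fin n → Fin p → ℝ) × (Fin n → Fin q → ℝ) =>
      ((∑ k, (∑ i, av c x w.1 i * w.2 i k) ^ 2) / D - q / D * (av c x w.1 ⬝ᵥ av c x w.1)) ^ 2)
      ((stdGaussianMatrix n p).prod (stdGaussianMatrix n q)) := by
    rw [integrable_prod_iff]
    · refine ⟨ae_of_all _ fun Z => ?_, ?_⟩
      · simp only [e0]
        exact (W_quad _).1.const_mul _
      · refine I1.congr (ae_of_all _ fun Z => ?_)
        simp only [Real.norm_eq_abs, abs_pow, sq_abs]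
        exact (e1 Z).symm
    · refine Continuous.aestronglyMeasurable ?_
      have c2 := Continuous.dotProduct ca1 ca1
      have c3 : ∀ i, Continuous fun w : (Fin n → Fin p → ℝ) × (Fin n → Fin q → ℝ) => av c x w.1 i :=
        fun i => (continuous_apply i).comp ca1
      have c4 : ∀ i k, Continuous fun w : (Fin n → Fin p → ℝ) × (Fin n → Fin q → ℝ) => w.2 i k :=
        fun i k => by fun_prop
      exact (((continuous_finsetSum _ fun k _ => (continuous_finsetSum _ fun i _ =>
        (c3 i).mul (c4 i k)).pow 2).div_const _).sub (continuous_const.mul c2)).pow 2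
  refine ⟨I, ?_⟩
  rw [integral_prod _ I]
  simp only [e1]
  calc _ ≤ ∫ Z : Fin n → Fin p → ℝ, 2 * q * K ^ 2 / D ^ 2 ∂(stdGaussianMatrix n p) :=
        integral_mono I1 (integrable_const _) b1
    _ = _ := by simp


/-! ### Main theorem -/

theorem var_lim (σ lam : ℝ) (hσ : 0 < σ) (hlam : 0 < lam) (γ : ℝ) (hγ : 1 < γ)
    (p q D : ℕ → ℕ) (hnp : ∀ n, n + 1 < p n) (hD : ∀ n, D n = p n + q n)
    (hγlim : Tendsto (fun n => (p n : ℝ) / n) atTop (𝓝 γ))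
    (x : (n : ℕ) → Fin (p n) → ℝ) (r : ℝ) (hr : 0 < r)
    (hx : Tendsto (fun n => (x n ⬝ᵥ x n) / p n) atTop (𝓝 r))
    (g g' : ℝ) (hg : g = mpStieltjes γ lam) (hg' : g' = -(deriv (mpStieltjes γ) lam))
    (S : ℕ → ℝ)
    (hS : ∀ n, S n = g' * γ / (1 + g * γ) ^ 2 * (σ ^ 2 + 1 - (p n : ℝ) / D n) * ((x n ⬝ᵥ x n) / p n) +
      (1 - 2 * lam * g + lam ^ 2 * g') * ((x n ⬝ᵥ x n) / D n)) :
    Tendsto (fun w : Σ n : ℕ, (Fin n → Fin (p n) → ℝ) × (Fin n → Fin (q n) → ℝ) =>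
      √(VV σ (w.1 * lam) (D w.1) (x w.1) w.2) / √(S w.1))
      (PF fun n => (stdGaussianMatrix n (p n)).prod (stdGaussianMatrix n (q n))) (𝓝 1) := by
  have hγ0 : 0 < γ := by linarith
  obtain ⟨g0, g'0, ha, hb⟩ := mp_facts hγ0 hlam g g' hg hg'
  have hpos : ∀ n, 0 < p n := fun n => by have := hnp n; omega
  set L := PF fun n => (stdGaussianMatrix n (p n)).prod (stdGaussianMatrix n (q n)) with hL
  have Lfst : Tendsto (fun w : Σ n : ℕ, (Fin n → Fin (p n) → ℝ) × (Fin n → Fin (q n) → ℝ) => w.1) L atTop :=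
    PF_fst
  have Lp : Tendsto (fun w : Σ n : ℕ, (Fin n → Fin (p n) → ℝ) × (Fin n → Fin (q n) → ℝ) =>
      (⟨w.1, w.2.1⟩ : Σ n : ℕ, Fin n → Fin (p n) → ℝ)) L (PF (GM p)) := PF_prod
  have hNr : ∀ᶠ n in atTop, r / 2 < (x n ⬝ᵥ x n) / p n := (tendsto_order.1 hx).1 _ (by linarith)
  have hNu : ∀ᶠ n in atTop, (x n ⬝ᵥ x n) / p n < r + 1 := (tendsto_order.1 hx).2 _ (by linarith)
  have hγu : ∀ᶠ n in atTop, (p n : ℝ) / n < γ + 1 := (tendsto_order.1 hγlim).2 _ (by linarith)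
  -- unit vector
  have hu : ∀ᶠ n in atTop, ((√(x n ⬝ᵥ x n))⁻¹ • x n) ⬝ᵥ ((√(x n ⬝ᵥ x n))⁻¹ • x n) = 1 := by
    filter_upwards [hNr] with n hn
    have hp' : (0 : ℝ) < p n := Nat.cast_pos.mpr (hpos n)
    have hN : 0 < x n ⬝ᵥ x n := by
      by_contra h
      have := div_nonpos_of_nonpos_of_nonneg (not_lt.mp h) hp'.le
      linarith
    have h2 := Real.sq_sqrt hN.le
    have h3 := Real.sqrt_pos.mpr hN
    rw [smul_dotProduct, dotProduct_smul, smul_eq_mul, smul_eq_mul]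
    generalize √(x n ⬝ᵥ x n) = s at *
    rw [← h2]
    field_simp
  have t1 := (q_lim hγ0 hlam p hpos hγlim _ hu).comp Lp
  have t2 := (q2_lim hγ0 hlam p hpos hγlim _ hu).comp Lp
  rw [← hg] at t1
  rw [← hg'] at t2
  -- W part
  have t3 := PF_sq (μ := fun n => (stdGaussianMatrix n (p n)).prod (stdGaussianMatrix n (q n)))
    (fun n w => (∑ k, (∑ i, av (n * lam) (x n) w.1 i * w.2 i k) ^ 2) / (D n : ℝ) -
      q n / (D n : ℝ) * (av (n * lam) (x n) w.1 ⬝ᵥ av (n * lam) (x n) w.1))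
    (fun n => 2 * ((r + 1) * (γ + 1) / lam) ^ 2 * (n : ℝ)⁻¹)
    (by simpa using (tendsto_inv_atTop_nhds_zero_nat (𝕜 := ℝ)).const_mul (2 * ((r + 1) * (γ + 1) / lam) ^ 2)) (by
      filter_upwards [hNu, hγu, eventually_gt_atTop 0] with n h1 h2 h3
      have hn' : (0 : ℝ) < n := Nat.cast_pos.mpr h3
      have hp' : (0 : ℝ) < p n := Nat.cast_pos.mpr (hpos n)
      have hDp : (D n : ℝ) = p n + q n := by rw [hD n]; push_cast; ring
      have hq' : (0 : ℝ) ≤ q n := Nat.cast_nonneg _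
      have hnp' : (n : ℝ) ≤ p n := by have := hnp n; exact_mod_cast (by omega : n ≤ p n)
      have hD' : (0 : ℝ) < D n := by rw [hDp]; positivity
      have hN0 := Res.dot_self_nonneg (x n)
      have w := W_part (n := n) (q := q n) (c := n * lam) (D := D n) (K := (r + 1) * (γ + 1) / lam)
        (by positivity) hD' (x n) (by
          calc x n ⬝ᵥ x n / (n * lam) = (x n ⬝ᵥ x n / p n) * (p n / n) / lam := by field_simp
            _ ≤ _ := by gcongr)
      refine ⟨w.1, w.2.trans ?_⟩
      have : (q n : ℝ) / (D n) ^ 2 ≤ (n : ℝ)⁻¹ := by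
        rw [inv_eq_one_div, div_le_div_iff₀ (by positivity) hn', hDp]
        nlinarith [mul_nonneg hq' hp'.le, mul_nonneg hq' (sub_nonneg.mpr hnp'), sq_nonneg (p n : ℝ), sq_nonneg (q n : ℝ)]
      calc 2 * (q n : ℝ) * ((r + 1) * (γ + 1) / lam) ^ 2 / (D n) ^ 2
          = 2 * ((r + 1) * (γ + 1) / lam) ^ 2 * ((q n : ℝ) / (D n) ^ 2) := by ring
        _ ≤ _ := by gcongr)
  -- limits
  have tα := t1.sub (t2.const_mul lam)
  rw [ha] at tα
  have tA := ((hγlim.comp Lfst).mul tα).sub_const (γ * (g' / (1 + g * γ) ^ 2))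
  rw [sub_self] at tA
  have tβ := (t1.const_mul (-(2 * lam))).add (t2.const_mul (lam ^ 2))
  have tB := tβ.sub_const (-(2 * lam) * g + lam ^ 2 * g')
  rw [sub_self] at tB
  have κ : ∀ n, 0 ≤ (p n : ℝ) / D n ∧ (p n : ℝ) / D n ≤ 1 := by
    intro n
    refine ⟨by positivity, div_le_one_of_le₀ ?_ (by positivity)⟩
    exact_mod_cast (by have := hD n; omega : p n ≤ D n)
  have u1 := bdd_le_mul_tendsto_zero' (f := fun w : Σ n : ℕ, (Fin n → Fin (p n) → ℝ) × (Fin n → Fin (q n) → ℝ) =>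
    (σ ^ 2 + 1 - (p w.1 : ℝ) / D w.1) * ((x w.1 ⬝ᵥ x w.1) / p w.1)) ((σ ^ 2 + 1) * (r + 1)) (by
      filter_upwards [Lfst.eventually hNu] with w hw
      have hN0 := Res.dot_self_nonneg (x w.1)
      have k := κ w.1
      have k2 : 0 ≤ σ ^ 2 + 1 - (p w.1 : ℝ) / D w.1 := by nlinarith [sq_nonneg σ]
      rw [abs_of_nonneg (mul_nonneg k2 (by positivity))]
      gcongr
      linarith) tA
  have u2 := bdd_le_mul_tendsto_zero' (f := fun w : Σ n : ℕ, (Fin n → Fin (p n) → ℝ) × (Fin n → Fin (q n) → ℝ) =>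
    ((x w.1 ⬝ᵥ x w.1) / p w.1) * ((p w.1 : ℝ) / D w.1)) ((r + 1) * 1) (by
      filter_upwards [Lfst.eventually hNu] with w hw
      have hN0 := Res.dot_self_nonneg (x w.1)
      have k := κ w.1
      rw [abs_of_nonneg (by positivity)]
      gcongr
      exact k.2) tB
  have u3 := (u1.add u2).add t3
  simp only [add_zero] at u3
  set s0 : ℝ := g' * γ / (1 + g * γ) ^ 2 * σ ^ 2 * (r / 2) with hs0
  have s0pos : 0 < s0 := by positivity
  have hSlb : ∀ᶠ n in atTop, s0 ≤ S n := by
    filter_upwards [hNr] with n hn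
    have hN0 := Res.dot_self_nonneg (x n)
    have k := κ n
    rw [hS, hs0]
    have : 0 ≤ (1 - 2 * lam * g + lam ^ 2 * g') * ((x n ⬝ᵥ x n) / D n) := by positivity
    have : g' * γ / (1 + g * γ) ^ 2 * σ ^ 2 * (r / 2) ≤
        g' * γ / (1 + g * γ) ^ 2 * (σ ^ 2 + 1 - (p n : ℝ) / D n) * ((x n ⬝ᵥ x n) / p n) := by
      have k2 : 0 ≤ σ ^ 2 + 1 - (p n : ℝ) / D n := by nlinarith [sq_nonneg σ, k.2]
      have k3 : σ ^ 2 ≤ σ ^ 2 + 1 - (p n : ℝ) / D n := by linarith [k.2]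
      exact mul_le_mul (mul_le_mul_of_nonneg_left k3 (by positivity)) hn.le (by positivity)
        (mul_nonneg (by positivity) k2)
    linarith
  have u4 := bdd_le_mul_tendsto_zero' (f := fun w : Σ n : ℕ, (Fin n → Fin (p n) → ℝ) × (Fin n → Fin (q n) → ℝ) =>
    (S w.1)⁻¹) s0⁻¹ (by
      filter_upwards [Lfst.eventually hSlb] with w hw
      rw [abs_of_nonneg (by have := s0pos.trans_le hw; positivity)]
      exact inv_anti₀ s0pos hw) u3
  have u5 := (u4.add_const 1).sqrt
  rw [zero_add, Real.sqrt_one] at u5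
  refine u5.congr' ?_
  filter_upwards [Lfst.eventually hSlb, Lfst.eventually (eventually_gt_atTop 0), Lfst.eventually hNr] with w h1 h2 h3
  obtain ⟨n, Z, W⟩ := w
  have hn' : (0 : ℝ) < n := Nat.cast_pos.mpr h2
  have hp' : (0 : ℝ) < p n := Nat.cast_pos.mpr (hpos n)
  have hDp : (D n : ℝ) = p n + q n := by rw [hD n]; push_cast; ring
  have hD' : (0 : ℝ) < D n := by rw [hDp]; positivity
  have hS0 : 0 < S n := s0pos.trans_le h1
  have hN : 0 < x n ⬝ᵥ x n := by
    by_contra h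
    have := div_nonpos_of_nonpos_of_nonneg (not_lt.mp h) hp'.le
    simp only at h3
    linarith
  have hc : (0 : ℝ) < n * lam := by positivity
  rw [← Real.sqrt_div' _ hS0.le]
  congr 1
  simp only [Function.comp]
  have sN := Real.sq_sqrt hN.le
  have sN0 := Real.sqrt_pos.mpr hN
  simp only [mulVec_smul, smul_dotProduct, dotProduct_smul, smul_eq_mul]
  rw [VV, av_back hc, av_sq hc]
  simp only
  set Q1 := x n ⬝ᵥ Rm (n * lam) Z *ᵥ x n
  set Q2 := (Rm (n * lam) Z *ᵥ x n) ⬝ᵥ (Rm (n * lam) Z *ᵥ x n)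
  have eS := hS n
  set N := x n ⬝ᵥ x n
  set Wq := ∑ k, (∑ i, av (n * lam) (x n) Z i * W i k) ^ 2
  have i1 : (√N)⁻¹ * ((√N)⁻¹ * Q1) = Q1 / N := by
    rw [← mul_assoc, ← mul_inv, ← sq, sN]; ring
  have i2 : (√N)⁻¹ * ((√N)⁻¹ * Q2) = Q2 / N := by
    rw [← mul_assoc, ← mul_inv, ← sq, sN]; ring
  rw [i1, i2, eq_div_iff hS0.ne', add_mul, mul_comm (S n)⁻¹, mul_assoc, inv_mul_cancel₀ hS0.ne', mul_one, one_mul, eS]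
  have hq' : (q n : ℝ) = D n - p n := by rw [hDp]; ring
  rw [hq']
  have : 0 < 1 + g * γ := by positivity
  field_simp
  ring


/-- **Asymptotic Gaussianity of the ridge-regularized non-member prediction
(m = 0).**  In the Gaussian linear regression setting with `n + 1 < p ≤ D`,
`p/n → γ ∈ (1, ∞)`, `λ > 0`, and deterministic test points `x₀` with `‖x₀,ₚ‖²/p`
converging to a positive limit, the ridge prediction `ŷ₀` at a fresh (non-member)
test point satisfies: the law of `ŷ₀/σ₀,λ` converges weakly to `N(0,1)`, where
`σ₀,λ² = g′(−λ)γ/(1 + g(−λ)γ)²·(σ² + 1 − p/D)·(‖x₀,ₚ‖²/p)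
        + (1 − 2λg(−λ) + λ²g′(−λ))·(‖x₀,ₚ‖²/D)`
and `g` is the Marchenko–Pastur Stieltjes transform with ratio `γ`,
`g′(−λ) = −(d/dλ)g(−λ)`. -/
theorem ridge_nonmember_prediction_asymptotically_gaussian
    (σ lam : ℝ) (hσ : 0 < σ) (hlam : 0 < lam) (γ : ℝ) (hγ : 1 < γ)
    (p D : ℕ → ℕ) (hnp : ∀ n, n + 1 < p n) (hpD : ∀ n, p n ≤ D n)
    (hγlim : Filter.Tendsto (fun n => (p n : ℝ) / n) Filter.atTop (nhds γ))
    (x₀ : (n : ℕ) → Fin (D n) → ℝ) (r : ℝ) (hr : 0 < r)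
    (hx₀ : Filter.Tendsto
      (fun n => (∑ j : Fin (p n), x₀ n (Fin.castLE (hpD n) j) ^ 2) / p n)
      Filter.atTop (nhds r))
    (g g' : ℝ) (hg : g = mpStieltjes γ lam) (hg' : g' = -(deriv (mpStieltjes γ) lam))
    (σ₀ : ℕ → ℝ)
    (hσ₀ : ∀ n, σ₀ n = Real.sqrt (
      g' * γ / (1 + g * γ) ^ 2 * (σ ^ 2 + 1 - (p n : ℝ) / D n) *
        ((∑ j : Fin (p n), x₀ n (Fin.castLE (hpD n) j) ^ 2) / p n) +
      (1 - 2 * lam * g + lam ^ 2 * g') *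
        ((∑ j : Fin (p n), x₀ n (Fin.castLE (hpD n) j) ^ 2) / D n))) :
    ∀ f : BoundedContinuousFunction ℝ ℝ,
      Filter.Tendsto
        (fun n => ∫ ω : (Fin n → Fin (D n) → ℝ) × (Fin (D n) → ℝ) × (Fin n → ℝ),
          f (ridgePrediction σ lam n (p n) (D n) (hpD n) (x₀ n) ω / σ₀ n)
          ∂((stdGaussianMatrix n (D n)).prod
              ((stdGaussianVec (D n)).prod (stdGaussianVec n))))
        Filter.atTop (nhds (∫ t, f t ∂(gaussianReal 0 1))) := by
  intro f
  have hD : ∀ n, D n = p n + (D n - p n) := fun n => by have := hpD n; omega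
  set x : (n : ℕ) → Fin (p n) → ℝ := fun n j => x₀ n (Fin.castLE (hpD n) j) with hxdef
  have hxx : ∀ n, ∑ j : Fin (p n), x₀ n (Fin.castLE (hpD n) j) ^ 2 = x n ⬝ᵥ x n := fun n => by
    simp [dotProduct, sq, hxdef]
  simp only [hxx] at hx₀ hσ₀
  have hV := var_lim σ lam hσ hlam γ hγ p (fun n => D n - p n) D hnp hD hγlim x r hr hx₀ g g' hg hg'
    _ (fun n => rfl)
  simp only [← hσ₀] at hV
  have hR := fun n (hn : 0 < n) => reduce_ZW (n := n) (hpD n) (hD n) σ lam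
    (mul_pos (Nat.cast_pos.mpr hn) hlam) (x₀ n) (x n) (fun j => rfl) f (σ₀ n)
  have h1 : Hf f 1 = ∫ t, f t ∂(gaussianReal 0 1) := by simp [Hf]
  rw [← h1]
  have hI := PF_integral (μ := fun n => (stdGaussianMatrix n (p n)).prod (stdGaussianMatrix n (D n - p n)))
    (fun n w => Hf f (√(VV σ (n * lam) (D n) (x n) w) / σ₀ n)) ‖f‖ (Hf f 1)
    (by
      filter_upwards [eventually_gt_atTop 0] with n hn
      exact (hR n hn).1)
    (fun n w => Hf_bound f _)
    (((Hf_cont f).tendsto 1).comp hV)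
  refine hI.congr' ?_
  filter_upwards [eventually_gt_atTop 0] with n hn
  exact (hR n hn).2.symm
end

section
/- In the Gaussian linear regression setting with n + 1 < p ≤ D, let β̂ = Xₚ† y be the minimum-norm least squares estimator, and let (x₀, y₀) be a fresh test point with x₀ ∼ N(0, I_D) and y₀ = x₀ᵀβ + ε₀, ε₀ ∼ N(0, σ²), independent of the training data. Then the generalization error satisfies exactly E[(y₀ − β̂ᵀ x₀,ₚ)²] = 1 + σ² + n·( (1 + σ² − p/D)/(p − n − 1) − 1/D ), where the expectation is over the joint randomness of β, X, the training noise, x₀, and ε₀. -/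
open MeasureTheory ProbabilityTheory Matrix Filter Topology
open scoped NNReal ENNReal

/-- the explicit right inverse -/
noncomputable def rinv {n p : ℕ} (A : Matrix (Fin n) (Fin p) ℝ) : Matrix (Fin p) (Fin n) ℝ :=
  Aᵀ * (A * Aᵀ)⁻¹

lemma mul_rinv {n p : ℕ} {A : Matrix (Fin n) (Fin p) ℝ} (h : (A * Aᵀ).det ≠ 0) :
    A * rinv A = 1 := by
  rw [rinv, ← Matrix.mul_assoc, Matrix.mul_nonsing_inv _ (Ne.isUnit h)]

lemma rinv_mul_symm {n p : ℕ} (A : Matrix (Fin n) (Fin p) ℝ) :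
    (rinv A * A)ᵀ = rinv A * A := by
  simp only [rinv, Matrix.transpose_mul, Matrix.transpose_transpose, Matrix.transpose_nonsing_inv,
    Matrix.mul_assoc]

lemma pinv_eq_rinv {n p : ℕ} {A : Matrix (Fin n) (Fin p) ℝ} (h : (A * Aᵀ).det ≠ 0) :
    pinv A = rinv A := by
  have h1 := mul_rinv h
  have hex : ∃ B : Matrix (Fin p) (Fin n) ℝ,
      A * B * A = A ∧ B * A * B = B ∧ (A * B)ᵀ = A * B ∧ (B * A)ᵀ = B * A :=
    ⟨rinv A, by rw [h1, Matrix.one_mul], by rw [Matrix.mul_assoc, h1, Matrix.mul_one],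
      by rw [h1, Matrix.transpose_one], rinv_mul_symm A⟩
  rw [pinv, dif_pos hex]
  obtain ⟨e1, e2, e3, e4⟩ := hex.choose_spec
  set B := hex.choose
  calc B = B * (A * rinv A) := by rw [h1, Matrix.mul_one]
    _ = (B * A)ᵀ * rinv A := by rw [e4, Matrix.mul_assoc]
    _ = (A * B * A)ᵀ * (A * Aᵀ)⁻¹ := by
      simp only [rinv, Matrix.transpose_mul, Matrix.mul_assoc]
    _ = rinv A := by rw [e1, rinv]

/-- squared Frobenius norm -/
def frob {n p : ℕ} (A : Matrix (Fin n) (Fin p) ℝ) : ℝ := ∑ i, ∑ j, A i j ^ 2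

lemma frob_eq_trace {n p : ℕ} (A : Matrix (Fin n) (Fin p) ℝ) : frob A = (Aᵀ * A).trace := by
  simp only [frob, Matrix.trace, Matrix.diag, Matrix.mul_apply, Matrix.transpose_apply]
  rw [Finset.sum_comm]
  simp only [sq]

lemma frob_proj {n p : ℕ} {A : Matrix (Fin n) (Fin p) ℝ} (h : (A * Aᵀ).det ≠ 0) :
    frob (1 - rinv A * A) = (p : ℝ) - n := by
  rw [frob_eq_trace, Matrix.transpose_sub, rinv_mul_symm, Matrix.transpose_one]
  have : (1 - rinv A * A) * (1 - rinv A * A) = 1 - rinv A * A := by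
    have : rinv A * A * (rinv A * A) = rinv A * A := by
      rw [Matrix.mul_assoc, ← Matrix.mul_assoc A, mul_rinv h, Matrix.one_mul]
    rw [Matrix.sub_mul, Matrix.mul_sub, Matrix.mul_sub, this]; simp
  rw [this, Matrix.trace_sub, Matrix.trace_mul_comm, mul_rinv h]
  simp

/-- rows as Euclidean vectors -/
noncomputable def rowE {n p : ℕ} (A : Fin n → Fin p → ℝ) (i : Fin n) : EuclideanSpace ℝ (Fin p) :=
  WithLp.toLp 2 (A i)

lemma li_iff {n p : ℕ} (A : Matrix (Fin n) (Fin p) ℝ) :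
    (A * Aᵀ).det ≠ 0 ↔ LinearIndependent ℝ (rowE A) := by
  have h0 : LinearIndependent ℝ (rowE A) ↔ LinearIndependent ℝ A.row := by
    simp only [Fintype.linearIndependent_iff]
    have (g : Fin n → ℝ) : ∑ i, g i • rowE A i = 0 ↔ ∑ i, g i • A.row i = 0 := by
      constructor
      · intro h
        ext k
        have := congrArg (fun v : EuclideanSpace ℝ (Fin p) => v k) h
        simpa [rowE] using this
      · intro h
        ext k
        have := congrFun h k
        simpa [rowE] using this
    simp only [this]
  rw [h0, ← isUnit_iff_ne_zero, ← Matrix.isUnit_iff_isUnit_det, ← Matrix.vecMul_injective_iff]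
  rw [← Matrix.vecMul_injective_iff_isUnit]
  constructor
  · intro h x y hxy
    apply h
    simp only [← Matrix.vecMul_vecMul] at *
    rw [hxy]
  · intro h
    refine (injective_iff_map_eq_zero (Matrix.vecMulLinear (A * Aᵀ))).2 ?_
    intro x hx
    have hx' : x ᵥ* A = 0 := by
      have : (x ᵥ* A) ⬝ᵥ (x ᵥ* A) = 0 := by
        have h2 : x ᵥ* (A * Aᵀ) = 0 := hx
        rw [← Matrix.vecMul_vecMul, Matrix.vecMul_transpose] at h2
        rw [← Matrix.dotProduct_mulVec, h2, dotProduct_zero]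
      exact dotProduct_self_eq_zero.1 this
    exact h (by simpa using hx')

lemma col_norm {n p : ℕ} {A : Matrix (Fin n) (Fin p) ℝ} (h : (A * Aᵀ).det ≠ 0) (i : Fin n)
    (V : Submodule ℝ (EuclideanSpace ℝ (Fin p)))
    (hV : V = Submodule.span ℝ (rowE A '' {i}ᶜ)) :
    (∑ k, rinv A k i ^ 2) * ‖Vᗮ.starProjection (rowE A i)‖ ^ 2 = 1 := by
  set u : EuclideanSpace ℝ (Fin p) := WithLp.toLp 2 (fun k => rinv A k i) with hu
  set g : Fin n → ℝ := fun j => (A * Aᵀ)⁻¹ j i with hg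
  have hug : u = ∑ j, g j • rowE A j := by
    ext k
    simp [hu, hg, rinv, Matrix.mul_apply, rowE, mul_comm]
  have hin : ∀ j, inner ℝ (rowE A j) u = if j = i then (1:ℝ) else 0 := by
    intro j
    have := congrFun (congrFun (mul_rinv h) j) i
    rw [Matrix.mul_apply, Matrix.one_apply] at this
    rw [← this]
    simp [hu, rowE, PiLp.inner_apply, mul_comm]
  have huV : u ∈ Vᗮ := by
    rw [hV, Submodule.mem_orthogonal]
    intro v hv
    induction hv using Submodule.span_induction with
    | mem x hx =>
      obtain ⟨j, hj, rfl⟩ := hx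
      rw [hin, if_neg (by simpa using hj)]
    | zero => simp
    | add x y _ _ hx hy => rw [inner_add_left, hx, hy, add_zero]
    | smul a x _ hx => rw [inner_smul_left, hx, mul_zero]
  set w := Vᗮ.starProjection (rowE A i) with hw
  have hPu : Vᗮ.starProjection u = u := Submodule.starProjection_eq_self_iff.2 huV
  have huw : u = g i • w := by
    rw [← hPu, hug, map_sum, Finset.sum_eq_single i]
    · rw [map_smul]
    · intro j _ hj
      rw [map_smul]
      have : rowE A j ∈ Vᗮᗮ := by
        apply Submodule.le_orthogonal_orthogonal
        rw [hV]
        exact Submodule.subset_span ⟨j, hj, rfl⟩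
      rw [(Submodule.starProjection_apply_eq_zero_iff _).2 this, smul_zero]
    · simp
  have h1 : inner ℝ w u = (1:ℝ) := by
    rw [hw, Submodule.inner_starProjection_left_eq_right, hPu, hin, if_pos rfl]
  have h2 : g i * ‖w‖ ^ 2 = 1 := by
    rw [← h1, huw, inner_smul_right, real_inner_self_eq_norm_sq]
  have h3 : ∑ k, rinv A k i ^ 2 = ‖u‖ ^ 2 := by
    rw [EuclideanSpace.norm_sq_eq]; simp [hu]
  rw [h3, huw, norm_smul, mul_pow, Real.norm_eq_abs, sq_abs]
  linear_combination (g i * ‖w‖^2 + 1) * h2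

lemma integrable_bdd_exp {α : Type*} [MeasurableSpace α] (μ : Measure α) [IsFiniteMeasure μ]
    (f : α → ℝ) (hf : Measurable f) (h0 : ∀ x, f x ≤ 0) :
    Integrable (fun x => Real.exp (f x)) μ := by
  refine Integrable.of_bound (C := 1) (by fun_prop) (ae_of_all _ fun x => ?_)
  rw [Real.norm_eq_abs, abs_of_pos (Real.exp_pos _)]
  exact Real.exp_le_one_iff.2 (h0 x)

lemma gauss_exp (t : ℝ) (ht : 0 ≤ t) :
    ∫ z, Real.exp (-(t * z ^ 2)) ∂(gaussianReal 0 1) = (1 + 2 * t) ^ (-(1 / 2) : ℝ) := by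
  rw [integral_gaussianReal_eq_integral_smul (by norm_num)]
  have h : ∀ x : ℝ, gaussianPDFReal 0 1 x • Real.exp (-(t * x ^ 2))
      = (√(2 * Real.pi))⁻¹ * Real.exp (-(1 / 2 + t) * x ^ 2) := by
    intro x
    rw [gaussianPDFReal, smul_eq_mul, mul_assoc, ← Real.exp_add]
    congr 2
    · simp
    · simp; ring
  simp_rw [h]
  rw [integral_const_mul, integral_gaussian, ← Real.sqrt_inv, ← Real.sqrt_mul (by positivity),
    Real.rpow_neg (by positivity), ← Real.sqrt_eq_rpow, ← Real.sqrt_inv]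
  congr 1
  have := Real.pi_pos
  field_simp
  

lemma gauss_exp_pi {p : ℕ} (s : Finset (Fin p)) (t : ℝ) (ht : 0 ≤ t) :
    ∫⁻ x, ENNReal.ofReal (Real.exp (-(t * ∑ i ∈ s, x i ^ 2))) ∂(stdGaussianVec p)
      = ENNReal.ofReal ((1 + 2 * t) ^ (-(s.card / 2) : ℝ)) := by
  classical
  unfold stdGaussianVec
  rw [← ofReal_integral_eq_lintegral_ofReal]
  · congr 1
    have h : ∀ x : Fin p → ℝ, Real.exp (-(t * ∑ i ∈ s, x i ^ 2))
        = ∏ i, (fun i (z : ℝ) => if i ∈ s then Real.exp (-(t * z ^ 2)) else 1) i (x i) := by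
      intro x
      rw [Finset.prod_ite_mem, Finset.univ_inter, ← Real.exp_sum, Finset.sum_neg_distrib,
        Finset.mul_sum]
    simp_rw [h]
    rw [integral_fintype_prod_eq_prod (fun i (z : ℝ) => if i ∈ s then Real.exp (-(t * z ^ 2)) else 1)]
    have h2 : ∀ i : Fin p, ∫ z, (if i ∈ s then Real.exp (-(t * z ^ 2)) else 1) ∂(gaussianReal 0 1)
        = if i ∈ s then (1 + 2 * t) ^ (-(1 / 2) : ℝ) else 1 := by
      intro i
      split_ifs
      · exact gauss_exp t ht
      · simp
    simp_rw [h2]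
    rw [Finset.prod_ite_mem, Finset.univ_inter, Finset.prod_const, ← Real.rpow_natCast,
      ← Real.rpow_mul (by positivity)]
    congr 1
    ring
  · refine integrable_bdd_exp _ _ (by fun_prop) fun x => ?_
    have : 0 ≤ t * ∑ i ∈ s, x i ^ 2 := by positivity
    linarith
  · exact ae_of_all _ fun x => (Real.exp_pos _).le

lemma lint_pow (k : ℝ) (hk : 2 < k) :
    ∫⁻ t in Set.Ioi (0:ℝ), ENNReal.ofReal ((1 + 2 * t) ^ (-(k / 2) : ℝ))
      = ENNReal.ofReal (1 / (k - 2)) := by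
  have hd : ∀ x ∈ Set.Ici (0:ℝ), HasDerivAt (fun t : ℝ => -(1 / (k - 2)) * (1 + 2 * t) ^ (1 - k / 2))
      ((1 + 2 * x) ^ (-(k / 2) : ℝ)) x := by
    intro x hx
    have hx' : (0:ℝ) ≤ x := hx
    have h1 : HasDerivAt (fun t : ℝ => 1 + 2 * t) 2 x := by
      simpa using ((hasDerivAt_id x).const_mul 2).const_add 1
    have h2 := (h1.rpow_const (p := 1 - k / 2) (Or.inl (by positivity))).const_mul (-(1 / (k - 2)))
    refine h2.congr_deriv ?_
    have : k - 2 ≠ 0 := by linarith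
    rw [show 1 - k / 2 - 1 = -(k / 2) by ring]
    field_simp
    ring
  have hpos : ∀ x ∈ Set.Ioi (0:ℝ), 0 ≤ (1 + 2 * x) ^ (-(k / 2) : ℝ) := by
    intro x hx
    have hx' : (0:ℝ) < x := hx
    positivity
  have hlim : Tendsto (fun t : ℝ => -(1 / (k - 2)) * (1 + 2 * t) ^ (1 - k / 2)) atTop (𝓝 0) := by
    have h1 : Tendsto (fun t : ℝ => 1 + 2 * t) atTop atTop :=
      tendsto_atTop_add_const_left _ _ (tendsto_id.const_mul_atTop (by norm_num))
    have h2 := (tendsto_rpow_neg_atTop (y := k / 2 - 1) (by linarith)).comp h1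
    have h3 := h2.const_mul (-(1 / (k - 2)))
    rw [mul_zero] at h3
    refine h3.congr fun t => ?_
    simp [Function.comp]
  have hint := integrableOn_Ioi_deriv_of_nonneg' hd hpos hlim
  have hval := integral_Ioi_of_hasDerivAt_of_nonneg' hd hpos hlim
  rw [← ofReal_integral_eq_lintegral_ofReal hint, hval]
  · simp
  · exact (ae_restrict_iff' measurableSet_Ioi).2 (ae_of_all _ hpos)

lemma lint_exp (s : ℝ) (hs : 0 ≤ s) :
    ∫⁻ t in Set.Ioi (0:ℝ), ENNReal.ofReal (Real.exp (-(t * s))) = (ENNReal.ofReal s)⁻¹ := by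
  rcases hs.eq_or_lt with rfl | hs
  · simp
  have h1 : ∀ t : ℝ, Real.exp (-(t * s)) = Real.exp (-s * t) := fun t => by congr 1; ring
  simp_rw [h1]
  rw [← ofReal_integral_eq_lintegral_ofReal]
  · rw [integral_exp_mul_Ioi (by linarith), ← ENNReal.ofReal_inv_of_pos hs]
    congr 1
    simp [neg_div_neg_eq]
  · exact integrableOn_exp_mul_Ioi (by linarith) 0
  · exact ae_of_all _ fun x => (Real.exp_pos _).le

instance (k : ℕ) : IsProbabilityMeasure (stdGaussianVec k) := by
  unfold stdGaussianVec; infer_instance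

instance (n k : ℕ) : IsProbabilityMeasure (stdGaussianMatrix n k) := by
  unfold stdGaussianMatrix; infer_instance

lemma lint_inv_chi {p : ℕ} (s : Finset (Fin p)) (hs : 2 < s.card) :
    ∫⁻ x, (ENNReal.ofReal (∑ i ∈ s, x i ^ 2))⁻¹ ∂(stdGaussianVec p)
      = ENNReal.ofReal (1 / ((s.card : ℝ) - 2)) := by
  have h1 : ∀ x : Fin p → ℝ, (ENNReal.ofReal (∑ i ∈ s, x i ^ 2))⁻¹
      = ∫⁻ t in Set.Ioi (0:ℝ), ENNReal.ofReal (Real.exp (-(t * ∑ i ∈ s, x i ^ 2))) := by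
    intro x
    rw [lint_exp]
    positivity
  simp_rw [h1]
  rw [lintegral_lintegral_swap (by unfold Function.uncurry; fun_prop)]
  rw [← lint_pow _ (by exact_mod_cast hs)]
  refine setLIntegral_congr_fun measurableSet_Ioi fun t ht => ?_
  exact gauss_exp_pi s t (le_of_lt ht)

lemma lint_inv_proj {p : ℕ} (V : Submodule ℝ (EuclideanSpace ℝ (Fin p)))
    (hV : Module.finrank ℝ V + 2 < p) :
    ∫⁻ x, (ENNReal.ofReal (‖Vᗮ.starProjection (WithLp.toLp 2 x)‖ ^ 2))⁻¹ ∂(stdGaussianVec p)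
      = ENNReal.ofReal (1 / ((p : ℝ) - Module.finrank ℝ V - 2)) := by
  classical
  set m := Module.finrank ℝ V with hm
  have hk : Module.finrank ℝ Vᗮ = p - m := by
    have := V.finrank_add_finrank_orthogonal
    rw [finrank_euclideanSpace_fin] at this
    omega
  let c := stdOrthonormalBasis ℝ Vᗮ
  let s : Finset (Fin p) := Finset.univ.filter fun i => (i : ℕ) < p - m
  have hcard : s.card = p - m := by
    have : s = Finset.univ.filter fun i : Fin p => (i : ℕ) < p - m := rfl
    rw [this, Fin.card_filter_val_lt]
    omega
  let v : Fin p → EuclideanSpace ℝ (Fin p) := fun i =>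
    if h : (i : ℕ) < Module.finrank ℝ Vᗮ then (c ⟨i, h⟩ : EuclideanSpace ℝ (Fin p)) else 0
  have hmem : ∀ i, i ∈ s ↔ (i : ℕ) < Module.finrank ℝ Vᗮ := by
    intro i; simp [s, hk]
  have hv : Orthonormal ℝ (Set.domRestrict (s : Set (Fin p)) v) := by
    have h1 : Orthonormal ℝ (fun i => (c i : EuclideanSpace ℝ (Fin p))) :=
      c.orthonormal.comp_linearIsometry Vᗮ.subtypeₗᵢ
    have h2 := h1.comp (fun i : (s : Set (Fin p)) => (⟨i.1, (hmem _).1 i.2⟩ : Fin _))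
      (by
        intro a b hab
        apply Subtype.ext
        apply Fin.ext
        simpa using hab)
    convert h2 using 1
    ext1 i
    have := (hmem _).1 i.2
    simp [v, this, Set.domRestrict]
  obtain ⟨b, hb⟩ := hv.exists_orthonormalBasis_extension_of_card_eq (by simp)
  have hbV : ∀ i ∈ s, b i ∈ Vᗮ := by
    intro i hi
    rw [hb i hi]
    have := (hmem _).1 hi
    simp [v, this]
  have hspan : Submodule.span ℝ (b '' s) = Vᗮ := by
    apply Submodule.eq_of_le_of_finrank_eq
    · rw [Submodule.span_le]
      rintro _ ⟨i, hi, rfl⟩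
      exact hbV i hi
    · have hli := b.orthonormal.linearIndependent.comp (fun i : (s : Set (Fin p)) => i.1) Subtype.val_injective
      have := finrank_span_eq_card hli
      rw [Set.range_comp, Subtype.range_coe] at this
      rw [this, hk]
      simpa using hcard
  have hbV' : ∀ i ∉ s, b i ∈ Vᗮᗮ := by
    intro i hi
    rw [← hspan, Submodule.mem_orthogonal]
    intro u hu
    induction hu using Submodule.span_induction with
    | mem x hx =>
      obtain ⟨j, hj, rfl⟩ := hx
      exact b.orthonormal.2 (by rintro rfl; exact hi hj)
    | zero => simp
    | add x y _ _ hx hy => rw [inner_add_left, hx, hy, add_zero]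
    | smul a x _ hx => rw [inner_smul_left, hx, mul_zero]
  have hnorm : ∀ x : Fin p → ℝ, ‖Vᗮ.starProjection (∑ i, x i • b i)‖ ^ 2 = ∑ i ∈ s, x i ^ 2 := by
    intro x
    have : Vᗮ.starProjection (∑ i, x i • b i) = ∑ i ∈ s, x i • b i := by
      rw [map_sum, ← Finset.sum_subset (Finset.subset_univ s)]
      · refine Finset.sum_congr rfl fun i hi => ?_
        rw [map_smul, Submodule.starProjection_eq_self_iff.2 (hbV i hi)]
      · intro i _ hi
        rw [map_smul, (Submodule.starProjection_apply_eq_zero_iff _).2 (hbV' i hi), smul_zero]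
    rw [this, ← real_inner_self_eq_norm_sq, b.orthonormal.inner_sum]
    simp [sq]
  have hcast : ((s.card : ℕ) : ℝ) = (p : ℝ) - m := by
    rw [hcard, Nat.cast_sub (by omega)]
  rw [← hcast, ← lint_inv_chi s (by omega)]
  simp_rw [← hnorm]
  let F : EuclideanSpace ℝ (Fin p) → ℝ≥0∞ := fun y => (ENNReal.ofReal (‖Vᗮ.starProjection y‖ ^ 2))⁻¹
  have hF : Measurable F := by
    have : Measurable fun y => Vᗮ.starProjection y := (Vᗮ.starProjection).continuous.measurable
    fun_prop
  have e1 : ∫⁻ y, F y ∂(stdGaussian (EuclideanSpace ℝ (Fin p)))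
      = ∫⁻ x, F (WithLp.toLp 2 x) ∂(stdGaussianVec p) := by
    rw [← map_pi_eq_stdGaussian, lintegral_map hF (by fun_prop)]
    rfl
  have e2 : ∫⁻ y, F y ∂(stdGaussian (EuclideanSpace ℝ (Fin p)))
      = ∫⁻ x, F (∑ i, x i • b i) ∂(stdGaussianVec p) := by
    rw [stdGaussian_eq_map_pi_orthonormalBasis b, lintegral_map hF (by fun_prop)]
    rfl
  exact e1.symm.trans e2

lemma measurable_gramdet (n p : ℕ) :
    Measurable fun A : Fin n → Fin p → ℝ => (Matrix.of A * (Matrix.of A)ᵀ).det := by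
  apply Continuous.measurable
  refine Continuous.matrix_det ?_
  refine Continuous.matrix_mul ?_ (Continuous.matrix_transpose ?_) <;> exact continuous_id

lemma measurable_gram_inv (n p : ℕ) (a b : Fin n) :
    Measurable fun A : Fin n → Fin p → ℝ => (Matrix.of A * (Matrix.of A)ᵀ)⁻¹ a b := by
  have hc : Continuous fun A : Fin n → Fin p → ℝ => Matrix.of A * (Matrix.of A)ᵀ := by
    refine Continuous.matrix_mul ?_ (Continuous.matrix_transpose ?_) <;> exact continuous_id
  have h1 : Measurable fun A : Fin n → Fin p → ℝ =>
      (Matrix.of A * (Matrix.of A)ᵀ).adjugate a b :=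
    (hc.matrix_adjugate.matrix_elem a b).measurable
  have h2 : (fun A : Fin n → Fin p → ℝ => (Matrix.of A * (Matrix.of A)ᵀ)⁻¹ a b) =
    fun A => ((Matrix.of A * (Matrix.of A)ᵀ).det)⁻¹ * (Matrix.of A * (Matrix.of A)ᵀ).adjugate a b := by
    funext A
    rw [Matrix.inv_def, Ring.inverse_eq_inv', Matrix.smul_apply, smul_eq_mul]
  rw [h2]
  exact (measurable_gramdet n p).inv.mul h1

lemma measurable_rinv (n p : ℕ) (k : Fin p) (i : Fin n) :
    Measurable fun A : Fin n → Fin p → ℝ => rinv (Matrix.of A) k i := by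
  have h2 : (fun A : Fin n → Fin p → ℝ => rinv (Matrix.of A) k i) =
      fun A => ∑ j, A j k * (Matrix.of A * (Matrix.of A)ᵀ)⁻¹ j i := by
    funext A
    rw [rinv, Matrix.mul_apply]
    rfl
  rw [h2]
  refine Finset.measurable_sum _ fun j _ => ?_
  have h3 : Measurable fun A : Fin n → Fin p → ℝ => A j k := by fun_prop
  exact h3.mul (measurable_gram_inv n p j i)

lemma symm_zero_eq (n p : ℕ) (z : (Fin p → ℝ) × (Fin n → Fin p → ℝ)) :
    (MeasurableEquiv.piFinSuccAbove (fun _ : Fin (n+1) => Fin p → ℝ) 0).symm z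
      = (Fin.cons z.1 z.2 : Fin (n+1) → Fin p → ℝ) := by
  ext1 j
  refine Fin.cases ?_ (fun j => ?_) j <;> simp [MeasurableEquiv.piFinSuccAbove]

lemma ae_li (n p : ℕ) (h : n + 1 < p) :
    ∀ᵐ A ∂(stdGaussianMatrix n p), (Matrix.of A * (Matrix.of A)ᵀ).det ≠ 0 := by
  induction n with
  | zero => simp
  | succ n ih =>
    have ih := ih (by omega)
    have hmp := measurePreserving_piFinSuccAbove (fun _ : Fin (n + 1) => stdGaussianVec p) 0
    have hset : MeasurableSet {A : Fin (n+1) → Fin p → ℝ |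
        (Matrix.of A * (Matrix.of A)ᵀ).det ≠ 0} :=
      (measurable_gramdet (n+1) p) (measurableSet_singleton 0).compl
    have key : ∀ᵐ B ∂(stdGaussianMatrix n p), ∀ᵐ x ∂(stdGaussianVec p),
        (Matrix.of (Fin.cons x B : Fin (n+1) → Fin p → ℝ) *
          (Matrix.of (Fin.cons x B : Fin (n+1) → Fin p → ℝ))ᵀ).det ≠ 0 := by
      filter_upwards [ih] with B hB
      rw [li_iff] at hB
      set V := Submodule.span ℝ (Set.range (rowE (Matrix.of B))) with hV
      have hfr : Module.finrank ℝ V = n := by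
        rw [hV, finrank_span_eq_card hB]; simp
      have hint := lint_inv_proj V (by omega)
      have hm : Measurable fun x : Fin p → ℝ =>
          (ENNReal.ofReal (‖Vᗮ.starProjection (WithLp.toLp 2 x)‖ ^ 2))⁻¹ := by
        have : Measurable fun y => Vᗮ.starProjection y := (Vᗮ.starProjection).continuous.measurable
        fun_prop
      have := ae_lt_top hm (by rw [hint]; exact ENNReal.ofReal_ne_top)
      filter_upwards [this] with x hx
      rw [li_iff]
      have hr : rowE (Matrix.of (Fin.cons x B : Fin (n+1) → Fin p → ℝ)) =
          (Fin.cons (WithLp.toLp 2 x) (rowE (Matrix.of B)) : Fin (n+1) → EuclideanSpace ℝ (Fin p)) := by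
        ext1 j
        refine Fin.cases ?_ (fun j => ?_) j <;> rfl
      rw [hr, linearIndependent_finCons]
      refine ⟨hB, fun hmem => ?_⟩
      have h0 : Vᗮ.starProjection (WithLp.toLp 2 x) = 0 :=
        (Submodule.starProjection_apply_eq_zero_iff _).2 (Submodule.le_orthogonal_orthogonal _ hmem)
      rw [h0] at hx
      simp at hx
    have h2 : ∀ᵐ z ∂((stdGaussianVec p).prod (stdGaussianMatrix n p)),
        (Matrix.of (Fin.cons z.1 z.2 : Fin (n+1) → Fin p → ℝ) *
          (Matrix.of (Fin.cons z.1 z.2 : Fin (n+1) → Fin p → ℝ))ᵀ).det ≠ 0 := by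
      have hms : MeasurableSet {z : (Fin p → ℝ) × (Fin n → Fin p → ℝ) |
        (Matrix.of (Fin.cons z.1 z.2 : Fin (n+1) → Fin p → ℝ) *
          (Matrix.of (Fin.cons z.1 z.2 : Fin (n+1) → Fin p → ℝ))ᵀ).det ≠ 0} := by
        have := (MeasurableEquiv.piFinSuccAbove (fun _ : Fin (n+1) => Fin p → ℝ) 0).symm.measurable hset
        convert this using 1
        ext z
        simp only [Set.mem_ofPred_eq, Set.mem_preimage]
        rw [symm_zero_eq]
      rw [Measure.ae_prod_iff_ae_ae hms]
      exact (Measure.ae_ae_comm hms).2 key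
    have h3 := hmp.quasiMeasurePreserving.ae h2
    unfold stdGaussianMatrix
    filter_upwards [h3] with A hA
    convert hA using 5 <;>
    · ext j
      refine Fin.cases ?_ (fun j => ?_) j <;> rfl

lemma lint_col (n p : ℕ) (h : n + 1 < p) (i : Fin n) :
    ∫⁻ A, ENNReal.ofReal (∑ k, rinv (Matrix.of A) k i ^ 2) ∂(stdGaussianMatrix n p)
      = ENNReal.ofReal (1 / ((p : ℝ) - n - 1)) := by
  obtain ⟨n, rfl⟩ : ∃ m, n = m + 1 := ⟨n - 1, by have := i.2; omega⟩
  have hmp := (measurePreserving_piFinSuccAbove (fun _ : Fin (n + 1) => stdGaussianVec p) i).symm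
  have hmeas : Measurable fun A : Fin (n+1) → Fin p → ℝ =>
      ENNReal.ofReal (∑ k, rinv (Matrix.of A) k i ^ 2) := by
    refine ENNReal.measurable_ofReal.comp (Finset.measurable_sum _ fun k _ => ?_)
    exact (measurable_rinv (n+1) p k i).pow_const 2
  have hae := hmp.quasiMeasurePreserving.ae (ae_li (n+1) p h)
  have hae2 := Measure.ae_ae_of_ae_prod (Measure.measurePreserving_swap.quasiMeasurePreserving.ae hae)
  unfold stdGaussianMatrix
  rw [← hmp.lintegral_comp hmeas]
  refine (lintegral_prod_symm' _ (hmeas.comp hmp.measurable)).trans ?_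
  have key : ∀ᵐ B ∂(Measure.pi fun _ : Fin n => stdGaussianVec p),
      ∫⁻ x, ENNReal.ofReal (∑ k, rinv (Matrix.of
        ((MeasurableEquiv.piFinSuccAbove (fun _ : Fin (n+1) => Fin p → ℝ) i).symm (x, B))) k i ^ 2)
        ∂(stdGaussianVec p) = ENNReal.ofReal (1 / ((p : ℝ) - (n + 1 : ℕ) - 1)) := by
    filter_upwards [hae2] with B hB
    set V := Submodule.span ℝ (Set.range (rowE (Matrix.of B))) with hV
    have hrow : ∀ x j, rowE (Matrix.of
        ((MeasurableEquiv.piFinSuccAbove (fun _ : Fin (n+1) => Fin p → ℝ) i).symm (x, B)))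
          (i.succAbove j) = rowE (Matrix.of B) j := by
      intro x j
      exact congrArg (WithLp.toLp 2)
        (Fin.insertNth_apply_succAbove (α := fun _ => Fin p → ℝ) i x B j)
    have hrowi : ∀ x, rowE (Matrix.of
        ((MeasurableEquiv.piFinSuccAbove (fun _ : Fin (n+1) => Fin p → ℝ) i).symm (x, B))) i
          = WithLp.toLp 2 x := by
      intro x
      exact congrArg (WithLp.toLp 2)
        (Fin.insertNth_apply_same (α := fun _ => Fin p → ℝ) i x B)
    have hfr : Module.finrank ℝ V = n := by
      obtain ⟨x, hx⟩ := hB.exists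
      have hx := (li_iff _).1 hx
      have h2 := hx.comp i.succAbove Fin.succAbove_right_injective
      have : (rowE (Matrix.of
        ((MeasurableEquiv.piFinSuccAbove (fun _ : Fin (n+1) => Fin p → ℝ) i).symm (x, B))))
          ∘ i.succAbove = rowE (Matrix.of B) := funext (hrow x)
      rw [Prod.swap_prod_mk, this] at h2
      rw [hV, finrank_span_eq_card h2]; simp
    have hint := lint_inv_proj V (by omega)
    rw [hfr] at hint
    have hc : (p : ℝ) - (n + 1 : ℕ) - 1 = p - n - 2 := by push_cast; ring
    rw [hc, ← hint]
    refine lintegral_congr_ae ?_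
    filter_upwards [hB] with x hx
    have hspan : V = Submodule.span ℝ (rowE (Matrix.of
        ((MeasurableEquiv.piFinSuccAbove (fun _ : Fin (n+1) => Fin p → ℝ) i).symm (x, B)))
          '' {i}ᶜ) := by
      rw [hV, ← Fin.range_succAbove, ← Set.range_comp]
      congr 2
      exact (funext (hrow x)).symm
    have h3 := col_norm hx i V hspan
    simp only [Prod.swap_prod_mk] at h3
    rw [hrowi] at h3
    have hw : 0 < ‖Vᗮ.starProjection (WithLp.toLp 2 x)‖ ^ 2 := by
      rcases (sq_nonneg ‖Vᗮ.starProjection (WithLp.toLp 2 x)‖).eq_or_lt with h0 | h0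
      · rw [← h0] at h3; simp at h3
      · exact h0
    rw [← ENNReal.ofReal_inv_of_pos hw, eq_inv_of_mul_eq_one_left h3]
  exact (lintegral_congr_ae key).trans (by simp)

lemma lint_frob (n p : ℕ) (h : n + 1 < p) :
    ∫⁻ A, ENNReal.ofReal (frob (rinv (Matrix.of A))) ∂(stdGaussianMatrix n p)
      = ENNReal.ofReal (n / ((p : ℝ) - n - 1)) := by
  have h1 : ∀ A : Fin n → Fin p → ℝ, ENNReal.ofReal (frob (rinv (Matrix.of A)))
      = ∑ i, ENNReal.ofReal (∑ k, rinv (Matrix.of A) k i ^ 2) := by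
    intro A
    rw [frob, Finset.sum_comm, ENNReal.ofReal_sum_of_nonneg]
    intro i _
    positivity
  simp_rw [h1]
  rw [lintegral_finsetSum]
  · simp_rw [lint_col n p h]
    have : (0:ℝ) ≤ 1 / ((p : ℝ) - n - 1) := by
      have : ((n + 1 : ℕ) : ℝ) < p := by exact_mod_cast h
      push_cast at this
      apply one_div_nonneg.2; linarith
    rw [← ENNReal.ofReal_sum_of_nonneg (fun _ _ => this)]
    simp [div_eq_mul_inv]
  · intro i _
    refine ENNReal.measurable_ofReal.comp (Finset.measurable_sum _ fun k _ => ?_)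
    exact (measurable_rinv n p k i).pow_const 2

lemma sq1 (a c : ℝ) :
    ∫⁻ z, ENNReal.ofReal ((a + c * z) ^ 2) ∂(gaussianReal 0 1) = ENNReal.ofReal (a ^ 2 + c ^ 2) := by
  have hm : MemLp (fun x : ℝ => x) 2 (gaussianReal 0 1) := memLp_id_gaussianReal 2
  have i1 : Integrable (fun z : ℝ => z) (gaussianReal 0 1) := hm.integrable (by norm_num)
  have i2 : Integrable (fun z : ℝ => z ^ 2) (gaussianReal 0 1) := hm.integrable_sq
  have v : ∫ z, z ^ 2 ∂(gaussianReal 0 1) = 1 := by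
    have h1 : Var[fun x : ℝ => x; gaussianReal 0 1] = ((1 : ℝ≥0) : ℝ) := variance_fun_id_gaussianReal
    rw [variance_of_integral_eq_zero (by fun_prop) (by simp)] at h1
    simpa using h1
  have hexp : ∀ z : ℝ, (a + c * z) ^ 2 = a ^ 2 + (2 * a * c) * z + c ^ 2 * z ^ 2 := fun z => by ring
  simp_rw [hexp]
  have j1 : Integrable (fun z : ℝ => a ^ 2 + (2 * a * c) * z) (gaussianReal 0 1) :=
    (integrable_const _).add (i1.const_mul _)
  have j2 : Integrable (fun z : ℝ => a ^ 2 + (2 * a * c) * z + c ^ 2 * z ^ 2) (gaussianReal 0 1) :=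
    j1.add (i2.const_mul _)
  rw [← ofReal_integral_eq_lintegral_ofReal j2]
  · congr 1
    rw [integral_add j1 (i2.const_mul _), integral_add (integrable_const _) (i1.const_mul _),
      integral_const_mul, integral_const_mul, v]
    simp
  · exact ae_of_all _ fun z => by
      change 0 ≤ _
      simp only [← hexp]
      positivity

lemma sqv (k : ℕ) (a : ℝ) (c : Fin k → ℝ) :
    ∫⁻ z, ENNReal.ofReal ((a + ∑ j, c j * z j) ^ 2) ∂(stdGaussianVec k)
      = ENNReal.ofReal (a ^ 2 + ∑ j, c j ^ 2) := by
  induction k generalizing a with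
  | zero => simp
  | succ k ih =>
    have hmp := (measurePreserving_piFinSuccAbove (fun _ : Fin (k + 1) => gaussianReal 0 1) 0).symm
    have hmeas : Measurable fun z : Fin (k+1) → ℝ => ENNReal.ofReal ((a + ∑ j, c j * z j) ^ 2) := by
      fun_prop
    unfold stdGaussianVec
    rw [← hmp.lintegral_comp hmeas]
    refine (lintegral_prod_symm' _ (hmeas.comp hmp.measurable)).trans ?_
    have h1 : ∀ y : Fin k → ℝ, ∫⁻ x, ENNReal.ofReal ((a + ∑ j, c j *
        ((MeasurableEquiv.piFinSuccAbove (fun _ : Fin (k+1) => ℝ) 0).symm (x, y)) j) ^ 2)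
          ∂(gaussianReal 0 1) = ENNReal.ofReal ((a + ∑ j, c (Fin.succ j) * y j) ^ 2)
            + ENNReal.ofReal (c 0 ^ 2) := by
      intro y
      rw [← ENNReal.ofReal_add (by positivity) (by positivity), ← sq1]
      refine lintegral_congr fun x => ?_
      rw [Fin.sum_univ_succ]
      simp [MeasurableEquiv.piFinSuccAbove]
      congr 2
      ring
    refine (lintegral_congr h1).trans ?_
    rw [lintegral_add_right _ (by fun_prop)]
    have := ih a (fun j => c j.succ)
    unfold stdGaussianVec at this
    rw [this, Fin.sum_univ_succ]
    simp only [lintegral_const, measure_univ, mul_one]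
    rw [← ENNReal.ofReal_add (by positivity) (by positivity)]
    congr 1
    ring

lemma sqsum {m k : ℕ} (a : Fin m → ℝ) (M : Matrix (Fin m) (Fin k) ℝ) (s : ℝ) (hs : 0 ≤ s) :
    ∫⁻ z, ENNReal.ofReal (∑ j, (a j + ∑ i, M j i * z i) ^ 2 + s) ∂(stdGaussianVec k)
      = ENNReal.ofReal (∑ j, a j ^ 2 + frob M + s) := by
  have h : ∀ z : Fin k → ℝ, ENNReal.ofReal (∑ j, (a j + ∑ i, M j i * z i) ^ 2 + s)
      = ∑ j, ENNReal.ofReal ((a j + ∑ i, M j i * z i) ^ 2) + ENNReal.ofReal s := by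
    intro z
    rw [ENNReal.ofReal_add (by positivity) hs, ENNReal.ofReal_sum_of_nonneg (by intros; positivity)]
  simp_rw [h]
  rw [lintegral_add_right _ (by fun_prop), lintegral_finsetSum _ (by intros; fun_prop)]
  simp_rw [sqv]
  simp only [lintegral_const, measure_univ, mul_one]
  rw [← ENNReal.ofReal_sum_of_nonneg (by intros; positivity), ← ENNReal.ofReal_add (by positivity) hs,
    Finset.sum_add_distrib]
  rfl

lemma lemA {n D : ℕ} (σ : ℝ) (C : Matrix (Fin D) (Fin n) ℝ) (X : Matrix (Fin n) (Fin D) ℝ) :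
    ∫⁻ w : (Fin D → ℝ) × (Fin n → ℝ) × (Fin D → ℝ) × ℝ,
      ENNReal.ofReal ((∑ j, w.2.2.1 j * (coeffs D w.1 j -
        ∑ i, C j i * ((∑ l, X i l * coeffs D w.1 l) + σ * w.2.1 i)) + σ * w.2.2.2) ^ 2)
      ∂((stdGaussianVec D).prod ((stdGaussianVec n).prod
          ((stdGaussianVec D).prod (gaussianReal 0 1))))
    = ENNReal.ofReal (frob (1 - C * X) / D + (σ ^ 2 * frob C + σ ^ 2)) := by
  have hfr : 0 ≤ frob C := by unfold frob; positivity
  have hfC : σ ^ 2 * frob C = frob ((-σ) • C) := by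
    simp only [frob, Matrix.smul_apply, smul_eq_mul, Finset.mul_sum]
    refine Finset.sum_congr rfl fun i _ => Finset.sum_congr rfl fun j _ => by ring
  rw [lintegral_prod _ (by unfold coeffs; fun_prop)]
  have hb : ∀ b : Fin D → ℝ, ∫⁻ w : (Fin n → ℝ) × (Fin D → ℝ) × ℝ,
      ENNReal.ofReal ((∑ j, w.2.1 j * (coeffs D b j -
        ∑ i, C j i * ((∑ l, X i l * coeffs D b l) + σ * w.1 i)) + σ * w.2.2) ^ 2)
      ∂((stdGaussianVec n).prod ((stdGaussianVec D).prod (gaussianReal 0 1)))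
      = ENNReal.ofReal (∑ j, (0 + ∑ l, ((√(D:ℝ))⁻¹ • (1 - C * X) : Matrix (Fin D) (Fin D) ℝ) j l * b l) ^ 2
          + (σ ^ 2 * frob C + σ ^ 2)) := by
    intro b
    rw [lintegral_prod _ (by fun_prop)]
    have he : ∀ e : Fin n → ℝ, ∫⁻ w : (Fin D → ℝ) × ℝ,
      ENNReal.ofReal ((∑ j, w.1 j * (coeffs D b j -
        ∑ i, C j i * ((∑ l, X i l * coeffs D b l) + σ * e i)) + σ * w.2) ^ 2)
      ∂((stdGaussianVec D).prod (gaussianReal 0 1))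
      = ENNReal.ofReal (∑ j, ((∑ l, ((√(D:ℝ))⁻¹ • (1 - C * X) : Matrix (Fin D) (Fin D) ℝ) j l * b l)
          + ∑ i, ((-σ) • C) j i * e i) ^ 2 + σ ^ 2) := by
      intro e
      set d : Fin D → ℝ := fun j => coeffs D b j -
        ∑ i, C j i * ((∑ l, X i l * coeffs D b l) + σ * e i) with hd
      have hd2 : ∀ j, d j = (∑ l, ((√(D:ℝ))⁻¹ • (1 - C * X) : Matrix (Fin D) (Fin D) ℝ) j l * b l)
          + ∑ i, ((-σ) • C) j i * e i := by
        intro j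
        simp only [hd, coeffs, Matrix.smul_apply, Matrix.sub_apply, Matrix.mul_apply, smul_eq_mul,
          Matrix.one_apply]
        simp only [mul_sub, sub_mul, Finset.sum_sub_distrib, mul_add, Finset.sum_add_distrib]
        have e1 : ∑ l, (√(D:ℝ))⁻¹ * (if j = l then 1 else 0) * b l = b j / √(D:ℝ) := by
          simp [div_eq_inv_mul]
        have e2 : ∑ l, (√(D:ℝ))⁻¹ * (∑ i, C j i * X i l) * b l
            = ∑ i, C j i * ∑ l, X i l * (b l / √(D:ℝ)) := by
          simp only [Finset.mul_sum, Finset.sum_mul]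
          rw [Finset.sum_comm]
          refine Finset.sum_congr rfl fun i _ => Finset.sum_congr rfl fun l _ => by
            rw [div_eq_inv_mul]; ring
        have e3 : ∑ i, -σ * C j i * e i = - ∑ i, C j i * (σ * e i) := by
          rw [← Finset.sum_neg_distrib]
          refine Finset.sum_congr rfl fun i _ => by ring
        rw [e1, e2, e3]
        ring
      simp_rw [← hd2]
      change ∫⁻ w : (Fin D → ℝ) × ℝ, ENNReal.ofReal ((∑ j, w.1 j * d j + σ * w.2) ^ 2)
        ∂((stdGaussianVec D).prod (gaussianReal 0 1)) = _
      clear_value d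
      rw [lintegral_prod _ (by fun_prop)]
      simp_rw [sq1]
      have h5 : ∀ x : Fin D → ℝ, ENNReal.ofReal ((∑ j, x j * d j) ^ 2 + σ ^ 2)
          = ENNReal.ofReal ((0 + ∑ j, d j * x j) ^ 2) + ENNReal.ofReal (σ ^ 2) := by
        intro x
        rw [ENNReal.ofReal_add (by positivity) (by positivity), zero_add]
        simp_rw [mul_comm]
      simp_rw [h5]
      rw [lintegral_add_right _ (by fun_prop), sqv]
      simp only [lintegral_const, measure_univ, mul_one]
      rw [← ENNReal.ofReal_add (by positivity) (by positivity)]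
      simp
    refine (lintegral_congr he).trans ?_
    rw [sqsum _ _ _ (by positivity), hfC]
    simp only [zero_add, add_assoc]
  refine (lintegral_congr hb).trans ?_
  rw [sqsum _ _ _ (by positivity)]
  congr 2
  simp only [frob, Matrix.smul_apply, smul_eq_mul, mul_pow, ← Finset.mul_sum, inv_pow]
  rw [Real.sq_sqrt (by positivity)]
  simp [div_eq_inv_mul]

/-- extension of a matrix by zero rows -/
def extRows {p n : ℕ} (q : ℕ) (B : Matrix (Fin p) (Fin n) ℝ) : Matrix (Fin (p + q)) (Fin n) ℝ :=
  Matrix.of fun j i => Fin.addCases (fun k => B k i) (fun _ => 0) j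

/-- left columns -/
def leftC {n p q : ℕ} (X : Fin n → Fin (p + q) → ℝ) : Fin n → Fin p → ℝ :=
  fun i j => X i (Fin.castAdd q j)

/-- right columns -/
def rightC {n p q : ℕ} (X : Fin n → Fin (p + q) → ℝ) : Fin n → Fin q → ℝ :=
  fun i j => X i (Fin.natAdd p j)

lemma extRows_left {p n q : ℕ} (B : Matrix (Fin p) (Fin n) ℝ) (k : Fin p) (i : Fin n) :
    extRows q B (Fin.castAdd q k) i = B k i := by simp [extRows]

lemma extRows_right {p n q : ℕ} (B : Matrix (Fin p) (Fin n) ℝ) (k : Fin q) (i : Fin n) :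
    extRows q B (Fin.natAdd p k) i = 0 := by simp [extRows]

lemma frob_extRows {p n q : ℕ} (B : Matrix (Fin p) (Fin n) ℝ) : frob (extRows q B) = frob B := by
  simp [frob, Fin.sum_univ_add, extRows_left, extRows_right]

lemma frob_block {n p q : ℕ} (X : Fin n → Fin (p + q) → ℝ) (B : Matrix (Fin p) (Fin n) ℝ) :
    frob (1 - extRows q B * Matrix.of X) = frob (1 - B * Matrix.of (leftC X)) +
      frob (B * Matrix.of (rightC X)) + q := by
  have hne : ∀ (a : Fin p) (b : Fin q), Fin.castAdd q a ≠ Fin.natAdd p b := by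
    intro a b h
    have := congrArg Fin.val h
    simp at this
    omega
  simp only [frob, Fin.sum_univ_add, Matrix.sub_apply, Matrix.mul_apply, extRows_left,
    extRows_right, Matrix.of_apply, leftC, rightC, Matrix.one_apply, Fin.castAdd_inj,
    Fin.natAdd_inj, hne, (hne _ _).symm, if_false, zero_mul, Finset.sum_const_zero, sub_zero,
    zero_sub, neg_sq, Finset.sum_add_distrib]
  simp
  ring

lemma mp_row (p q : ℕ) : MeasurePreserving
    (fun x : Fin (p + q) → ℝ => ((fun j => x (Fin.castAdd q j) : Fin p → ℝ),
      (fun j => x (Fin.natAdd p j) : Fin q → ℝ)))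
    (stdGaussianVec (p + q)) ((stdGaussianVec p).prod (stdGaussianVec q)) := by
  have h1 := (measurePreserving_piCongrLeft (fun _ : Fin (p + q) => gaussianReal 0 1)
    (finSumFinEquiv (m := p) (n := q))).symm
  have h2 := measurePreserving_sumPiEquivProdPi (fun _ : Fin p ⊕ Fin q => gaussianReal 0 1)
  exact h2.comp h1

lemma mp_mat (n p q : ℕ) : MeasurePreserving
    (fun X : Fin n → Fin (p + q) → ℝ => (leftC X, rightC X))
    (stdGaussianMatrix n (p + q)) ((stdGaussianMatrix n p).prod (stdGaussianMatrix n q)) := by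
  have h1 := measurePreserving_pi (fun _ : Fin n => stdGaussianVec (p + q))
    (fun _ : Fin n => (stdGaussianVec p).prod (stdGaussianVec q)) (fun _ => mp_row p q)
  have h2 := measurePreserving_arrowProdEquivProdArrow (Fin p → ℝ) (Fin q → ℝ) (Fin n)
    (fun _ => stdGaussianVec p) (fun _ => stdGaussianVec q)
  exact h2.comp h1

lemma lint_right {n p q : ℕ} (B : Matrix (Fin p) (Fin n) ℝ) :
    ∫⁻ Y, ENNReal.ofReal (frob (B * Matrix.of Y)) ∂(stdGaussianMatrix n q)
      = ENNReal.ofReal (q * frob B) := by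
  have h : ∀ Y : Fin n → Fin q → ℝ, ENNReal.ofReal (frob (B * Matrix.of Y))
      = ∑ k, ∑ j, ENNReal.ofReal ((∑ i, B k i * Y i j) ^ 2) := by
    intro Y
    rw [frob, ENNReal.ofReal_sum_of_nonneg (by intros; positivity)]
    refine Finset.sum_congr rfl fun k _ => ?_
    rw [ENNReal.ofReal_sum_of_nonneg (by intros; positivity)]
    simp [Matrix.mul_apply]
  simp_rw [h]
  have h2 : ∀ k j, ∫⁻ Y : Fin n → Fin q → ℝ, ENNReal.ofReal ((∑ i, B k i * Y i j) ^ 2)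
      ∂(stdGaussianMatrix n q) = ENNReal.ofReal (∑ i, B k i ^ 2) := by
    intro k j
    have hmp := measurePreserving_pi (fun _ : Fin n => stdGaussianVec q)
      (fun _ : Fin n => gaussianReal 0 1)
      (fun _ => measurePreserving_eval (fun _ : Fin q => gaussianReal 0 1) j)
    have h3 := sqv n 0 (fun i => B k i)
    have hm : Measurable fun z : Fin n → ℝ => ENNReal.ofReal ((0 + ∑ i, B k i * z i) ^ 2) := by
      fun_prop
    have h4 := hmp.lintegral_comp hm
    unfold stdGaussianMatrix
    unfold stdGaussianVec at h3
    rw [h3] at h4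
    simpa [Function.eval] using h4
  rw [lintegral_finsetSum _ (by intros; fun_prop)]
  have h5 : ∀ k, ∫⁻ Y : Fin n → Fin q → ℝ, ∑ j, ENNReal.ofReal ((∑ i, B k i * Y i j) ^ 2)
      ∂(stdGaussianMatrix n q) = ENNReal.ofReal (q * ∑ i, B k i ^ 2) := by
    intro k
    rw [lintegral_finsetSum _ (by intros; fun_prop)]
    simp_rw [h2]
    rw [← ENNReal.ofReal_sum_of_nonneg (by intros; positivity)]
    simp
  simp_rw [h5]
  rw [← ENNReal.ofReal_sum_of_nonneg (by intros; positivity), frob, Finset.mul_sum]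

lemma frob_nonneg {n p : ℕ} (A : Matrix (Fin n) (Fin p) ℝ) : 0 ≤ frob A := by
  unfold frob; positivity

lemma measurable_frob_rinv (n p : ℕ) :
    Measurable fun A : Fin n → Fin p → ℝ => frob (rinv (Matrix.of A)) :=
  Finset.measurable_sum _ fun k _ => Finset.measurable_sum _ fun i _ =>
    (measurable_rinv n p k i).pow_const 2

lemma measurable_frob_mul (n p q : ℕ) :
    Measurable fun z : (Fin n → Fin p → ℝ) × (Fin n → Fin q → ℝ) =>
      frob (rinv (Matrix.of z.1) * Matrix.of z.2) := by
  refine Finset.measurable_sum _ fun k _ => Finset.measurable_sum _ fun j _ =>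
    Measurable.pow_const ?_ 2
  have : (fun z : (Fin n → Fin p → ℝ) × (Fin n → Fin q → ℝ) =>
      (rinv (Matrix.of z.1) * Matrix.of z.2) k j) =
      fun z => ∑ i, rinv (Matrix.of z.1) k i * z.2 i j := by
    funext z; rw [Matrix.mul_apply]; rfl
  rw [this]
  refine Finset.measurable_sum _ fun i _ => ?_
  have h1 : Measurable fun z : (Fin n → Fin p → ℝ) × (Fin n → Fin q → ℝ) => z.2 i j := by fun_prop
  exact ((measurable_rinv n p k i).comp measurable_fst).mul h1

lemma lint_X (n p q : ℕ) (h : n + 1 < p) (σ : ℝ) :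
    ∫⁻ X : Fin n → Fin (p + q) → ℝ, ENNReal.ofReal
      ((((p : ℝ) - n) + frob (rinv (Matrix.of (leftC X)) * Matrix.of (rightC X)) + q)
        / ((p + q : ℕ) : ℝ) + (σ ^ 2 * frob (rinv (Matrix.of (leftC X))) + σ ^ 2))
      ∂(stdGaussianMatrix n (p + q))
    = ENNReal.ofReal (((p : ℝ) - n + q) / ((p + q : ℕ) : ℝ) + σ ^ 2 +
        (σ ^ 2 + q / ((p + q : ℕ) : ℝ)) * (n / ((p : ℝ) - n - 1))) := by
  have hnp : (n : ℝ) + 1 < p := by exact_mod_cast h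
  set c : ℝ := ((p + q : ℕ) : ℝ) with hc
  have hc0 : 0 ≤ c := by positivity
  have hk : 0 ≤ ((p : ℝ) - n + q) / c + σ ^ 2 := by
    have : 0 ≤ (p : ℝ) - n + q := by have : (0:ℝ) ≤ q := by positivity
                                     linarith
    positivity
  have hm1 : Measurable fun z : (Fin n → Fin p → ℝ) × (Fin n → Fin q → ℝ) =>
    (ENNReal.ofReal (((p : ℝ) - n + q) / c + σ ^ 2) +
      ENNReal.ofReal (σ ^ 2) * ENNReal.ofReal (frob (rinv (Matrix.of z.1)))) +
      ENNReal.ofReal (1 / c) * ENNReal.ofReal (frob (rinv (Matrix.of z.1) * Matrix.of z.2)) := by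
    have h1 : Measurable fun z : (Fin n → Fin p → ℝ) × (Fin n → Fin q → ℝ) =>
        frob (rinv (Matrix.of z.1)) := (measurable_frob_rinv n p).comp measurable_fst
    have h2 := measurable_frob_mul n p q
    exact ((ENNReal.measurable_ofReal.comp h1).const_mul _).const_add _ |>.add
      ((ENNReal.measurable_ofReal.comp h2).const_mul _)
  have heq : ∀ X : Fin n → Fin (p + q) → ℝ, ENNReal.ofReal
      ((((p : ℝ) - n) + frob (rinv (Matrix.of (leftC X)) * Matrix.of (rightC X)) + q)
        / c + (σ ^ 2 * frob (rinv (Matrix.of (leftC X))) + σ ^ 2))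
      = (ENNReal.ofReal (((p : ℝ) - n + q) / c + σ ^ 2) +
      ENNReal.ofReal (σ ^ 2) * ENNReal.ofReal (frob (rinv (Matrix.of (leftC X))))) +
      ENNReal.ofReal (1 / c) *
        ENNReal.ofReal (frob (rinv (Matrix.of (leftC X)) * Matrix.of (rightC X))) := by
    intro X
    have f1 := frob_nonneg (rinv (Matrix.of (leftC X)))
    have f2 := frob_nonneg (rinv (Matrix.of (leftC X)) * Matrix.of (rightC X))
    rw [← ENNReal.ofReal_mul (by positivity), ← ENNReal.ofReal_mul (by positivity),
      ← ENNReal.ofReal_add hk (by positivity), ← ENNReal.ofReal_add (by positivity) (by positivity)]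
    congr 1
    ring
  rw [lintegral_congr heq]
  refine ((mp_mat n p q).lintegral_comp hm1).trans ?_
  rw [lintegral_prod _ hm1.aemeasurable]
  have hin : ∀ A : Fin n → Fin p → ℝ, ∫⁻ Y : Fin n → Fin q → ℝ,
      ((ENNReal.ofReal (((p : ℝ) - n + q) / c + σ ^ 2) +
      ENNReal.ofReal (σ ^ 2) * ENNReal.ofReal (frob (rinv (Matrix.of A)))) +
      ENNReal.ofReal (1 / c) * ENNReal.ofReal (frob (rinv (Matrix.of A) * Matrix.of Y)))
        ∂(stdGaussianMatrix n q)
      = ENNReal.ofReal (((p : ℝ) - n + q) / c + σ ^ 2) +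
        ENNReal.ofReal (σ ^ 2 + q / c) * ENNReal.ofReal (frob (rinv (Matrix.of A))) := by
    intro A
    have f1 := frob_nonneg (rinv (Matrix.of A))
    rw [lintegral_add_left measurable_const, lintegral_const_mul' _ _ ENNReal.ofReal_ne_top,
      lint_right]
    simp only [lintegral_const, measure_univ, mul_one]
    rw [← ENNReal.ofReal_mul (by positivity), ← ENNReal.ofReal_mul (by positivity),
      ← ENNReal.ofReal_mul (by positivity),
      ← ENNReal.ofReal_add hk (by positivity), ← ENNReal.ofReal_add (by positivity) (by positivity),
      ← ENNReal.ofReal_add hk (by positivity)]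
    congr 1
    ring
  refine (lintegral_congr hin).trans ?_
  rw [lintegral_add_left measurable_const, lintegral_const_mul' _ _ ENNReal.ofReal_ne_top,
    lint_frob n p h]
  simp only [lintegral_const, measure_univ, mul_one]
  have : 0 ≤ (n : ℝ) / ((p : ℝ) - n - 1) := div_nonneg (by positivity) (by linarith)
  rw [← ENNReal.ofReal_mul (by positivity), ← ENNReal.ofReal_add hk (by positivity)]

lemma gen_aux (n p q : ℕ) (hnp : n + 1 < p) (σ : ℝ) :
    ∫⁻ ω : (Fin n → Fin (p + q) → ℝ) × (Fin (p + q) → ℝ) × (Fin n → ℝ) × (Fin (p + q) → ℝ) × ℝ,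
      ENNReal.ofReal ((∑ j, ω.2.2.2.1 j * (coeffs (p + q) ω.2.1 j -
        ∑ i, extRows q (rinv (Matrix.of (leftC ω.1))) j i *
          ((∑ l, ω.1 i l * coeffs (p + q) ω.2.1 l) + σ * ω.2.2.1 i)) + σ * ω.2.2.2.2) ^ 2)
      ∂((stdGaussianMatrix n (p + q)).prod ((stdGaussianVec (p + q)).prod ((stdGaussianVec n).prod
          ((stdGaussianVec (p + q)).prod (gaussianReal 0 1)))))
    = ENNReal.ofReal (((p : ℝ) - n + q) / ((p + q : ℕ) : ℝ) + σ ^ 2 +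
        (σ ^ 2 + q / ((p + q : ℕ) : ℝ)) * (n / ((p : ℝ) - n - 1))) ∧
    Measurable fun ω : (Fin n → Fin (p + q) → ℝ) × (Fin (p + q) → ℝ) × (Fin n → ℝ) ×
        (Fin (p + q) → ℝ) × ℝ =>
      (∑ j, ω.2.2.2.1 j * (coeffs (p + q) ω.2.1 j -
        ∑ i, extRows q (rinv (Matrix.of (leftC ω.1))) j i *
          ((∑ l, ω.1 i l * coeffs (p + q) ω.2.1 l) + σ * ω.2.2.1 i)) + σ * ω.2.2.2.2) ^ 2 := by
  have hext : ∀ j i, Measurable fun X : Fin n → Fin (p + q) → ℝ =>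
      extRows q (rinv (Matrix.of (leftC X))) j i := by
    intro j i
    refine Fin.addCases (fun k => ?_) (fun k => ?_) j
    · simp only [extRows_left]
      exact (measurable_rinv n p k i).comp (measurable_fst.comp (mp_mat n p q).measurable)
    · simp only [extRows_right]
      exact measurable_const
  have hmeas : Measurable fun ω : (Fin n → Fin (p + q) → ℝ) × (Fin (p + q) → ℝ) × (Fin n → ℝ) ×
        (Fin (p + q) → ℝ) × ℝ =>
      (∑ j, ω.2.2.2.1 j * (coeffs (p + q) ω.2.1 j -
        ∑ i, extRows q (rinv (Matrix.of (leftC ω.1))) j i *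
          ((∑ l, ω.1 i l * coeffs (p + q) ω.2.1 l) + σ * ω.2.2.1 i)) + σ * ω.2.2.2.2) ^ 2 := by
    unfold coeffs
    refine Measurable.pow_const (Measurable.add (Finset.measurable_sum _ fun j _ =>
      Measurable.mul (by fun_prop) (Measurable.sub (by fun_prop) (Finset.measurable_sum _ fun i _ =>
        Measurable.mul ?_ (by fun_prop)))) (by fun_prop)) 2
    exact (hext j i).comp measurable_fst
  refine ⟨?_, hmeas⟩
  refine (lintegral_prod _ (ENNReal.measurable_ofReal.comp hmeas).aemeasurable).trans ?_
  rw [← lint_X n p q hnp σ]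
  have hae := (mp_mat n p q).quasiMeasurePreserving.ae
    (Measure.quasiMeasurePreserving_fst.ae (ae_li n p hnp))
  refine lintegral_congr_ae ?_
  filter_upwards [hae] with X hX
  refine (lemA σ (extRows q (rinv (Matrix.of (leftC X)))) (Matrix.of X)).trans ?_
  rw [frob_block, frob_extRows, frob_proj hX]

/-- **Generalization error of overparameterized min-norm least squares
(Corollary 2.2 of Belkin–Hsu–Xu).**  In the Gaussian data setting with
`n + 1 < p ≤ D`, for `β̂ = Xₚ†y` and a fresh test point `(x₀, y₀)`, the expected
squared prediction error is exactly
`E[(y₀ − β̂ᵀx₀,ₚ)²] = 1 + σ² + n((1 + σ² − p/D)/(p − n − 1) − 1/D)`.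
The sample space is `(X entries, b, e, x₀, e₀)` with all coordinates i.i.d.
standard Gaussian; `β = b/√D`, training noise `ε = σe`, test noise `ε₀ = σe₀`,
`yᵢ = xᵢᵀβ + εᵢ` and `y₀ = x₀ᵀβ + ε₀`. -/
theorem generalization_error_minnorm (n p D : ℕ) (hnp : n + 1 < p) (hpD : p ≤ D)
    (σ : ℝ) (hσ : 0 < σ) :
    ∫ ω : (Fin n → Fin D → ℝ) × (Fin D → ℝ) × (Fin n → ℝ) × (Fin D → ℝ) × ℝ,
      (((∑ j, ω.2.2.2.1 j * coeffs D ω.2.1 j) + σ * ω.2.2.2.2) -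
        ∑ j : Fin p, ω.2.2.2.1 (Fin.castLE hpD j) *
          (pinv (firstCols n p D hpD ω.1) *ᵥ
            (fun i => (∑ jd, ω.1 i jd * coeffs D ω.2.1 jd) + σ * ω.2.2.1 i)) j) ^ 2
      ∂((stdGaussianMatrix n D).prod ((stdGaussianVec D).prod ((stdGaussianVec n).prod
          ((stdGaussianVec D).prod (gaussianReal 0 1)))))
    = 1 + σ ^ 2 + n * ((1 + σ ^ 2 - (p : ℝ) / D) / ((p : ℝ) - n - 1) - 1 / (D : ℝ)) := by
  obtain ⟨q, rfl⟩ := Nat.exists_eq_add_of_le hpD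
  obtain ⟨hl, hmeas⟩ := gen_aux n p q hnp σ
  have hae := (Measure.quasiMeasurePreserving_fst (μ := stdGaussianMatrix n (p + q))
    (ν := (stdGaussianVec (p + q)).prod ((stdGaussianVec n).prod
          ((stdGaussianVec (p + q)).prod (gaussianReal 0 1))))).ae
    ((mp_mat n p q).quasiMeasurePreserving.ae
    (Measure.quasiMeasurePreserving_fst.ae (ae_li n p hnp)))
  have hnp' : (n : ℝ) + 1 < p := by exact_mod_cast hnp
  refine (integral_congr_ae (g := fun ω => (∑ j, ω.2.2.2.1 j * (coeffs (p + q) ω.2.1 j -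
        ∑ i, extRows q (rinv (Matrix.of (leftC ω.1))) j i *
          ((∑ l, ω.1 i l * coeffs (p + q) ω.2.1 l) + σ * ω.2.2.1 i)) + σ * ω.2.2.2.2) ^ 2) ?_).trans ?_
  · filter_upwards [hae] with ω hω
    have h1 : pinv (firstCols n p (p + q) hpD ω.1) = rinv (Matrix.of (leftC ω.1)) :=
      pinv_eq_rinv hω
    rw [h1]
    congr 1
    simp only [mul_sub, Finset.sum_sub_distrib]
    have h2 : ∑ j, ω.2.2.2.1 j * ∑ i, extRows q (rinv (Matrix.of (leftC ω.1))) j i *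
          ((∑ l, ω.1 i l * coeffs (p + q) ω.2.1 l) + σ * ω.2.2.1 i)
        = ∑ j : Fin p, ω.2.2.2.1 (Fin.castLE hpD j) *
          (rinv (Matrix.of (leftC ω.1)) *ᵥ
            (fun i => (∑ jd, ω.1 i jd * coeffs (p + q) ω.2.1 jd) + σ * ω.2.2.1 i)) j := by
      rw [Fin.sum_univ_add]
      simp only [extRows_left, extRows_right, zero_mul, Finset.sum_const_zero, mul_zero, add_zero]
      rfl
    rw [h2]
    ring
  · rw [integral_eq_lintegral_of_nonneg_ae (ae_of_all _ fun ω => sq_nonneg _)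
      hmeas.aestronglyMeasurable, hl, ENNReal.toReal_ofReal]
    · have h3 : ((p + q : ℕ) : ℝ) ≠ 0 := by
        have : 0 < p + q := by omega
        positivity
      have h4 : (p : ℝ) - n - 1 ≠ 0 := by linarith
      push_cast at h3 ⊢
      field_simp
      ring
    · have h5 : 0 < (p : ℝ) - n - 1 := by linarith
      have h6 : 0 < (p : ℝ) - n := by linarith
      positivity
end
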